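/- Let f ∈ L log L(𝕋²) and for n ≥ 1 define I^{(1)}_n(x,y,f) = p.v. (1/2π)∫_𝕋 [cos(nu)/(2 tan(u/2))] · ( p.v. (1/π)∫_𝕋 f(x+u+v, y+v)/(2 tan(v/2)) dv ) du. Then there is an absolute constant c > 0 such that for every λ > 0, |{(x,y) ∈ 𝕋² : bmo[I^{(1)}_n(x,y,f)] > λ}| ≤ (c/λ)·(1 + ∬_{𝕋²} |f| log⁺|f|). -/

import Mathlib

open MeasureTheory Filter Set

noncomputable section

/-- `[-π, π)`, a fundamental domain for the circle `𝕋 = ℝ/2πℤ`. -/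
def T1 : Set ℝ := Set.Ico (-Real.pi) Real.pi

/-- `[-π, π)²`, a fundamental domain for the torus `𝕋²`. -/
def T2 : Set (ℝ × ℝ) := T1 ×ˢ T1

/-- `log⁺ u = log u` for `u > 1`, and `0` otherwise. -/
def logPlus (u : ℝ) : ℝ := if 1 < u then Real.log u else 0

/-- `f` is `2π`-periodic in each variable. -/
def Biperiodic (f : ℝ × ℝ → ℝ) : Prop :=
  ∀ x y : ℝ, f (x + 2 * Real.pi, y) = f (x, y) ∧ f (x, y + 2 * Real.pi) = f (x, y)

/-- Fourier coefficients `f̂(m,n)` of a function on `𝕋²`. -/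
def fourierCoef2 (f : ℝ × ℝ → ℝ) (m n : ℤ) : ℂ :=
  (1 / (4 * (Real.pi : ℂ) ^ 2)) *
    ∫ p in T2, (f p : ℂ) * Complex.exp (-Complex.I * ((m : ℂ) * (p.1 : ℂ) + (n : ℂ) * (p.2 : ℂ)))

/-- Quadratic partial sums `S_{nn}(x, y, f)` of the double Fourier series.
(For real `f` the symmetric sum is real, so we take the real part.) -/
def Snn (f : ℝ × ℝ → ℝ) (n : ℕ) (x y : ℝ) : ℝ :=
  (∑ m ∈ Finset.Icc (-(n : ℤ)) (n : ℤ), ∑ k ∈ Finset.Icc (-(n : ℤ)) (n : ℤ),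
    fourierCoef2 f m k * Complex.exp (Complex.I * ((m : ℂ) * (x : ℂ) + (k : ℂ) * (y : ℂ)))).re

/-- The `BMO[0,1]` norm:
`‖g‖_BMO = sup_{I ⊂ [0,1]} (1/|I|) ∫_I |g - g_I| + |∫_0^1 g|`. -/
def bmoNorm (g : ℝ → ℝ) : ℝ :=
  (⨆ I : {p : ℝ × ℝ // 0 ≤ p.1 ∧ p.1 < p.2 ∧ p.2 ≤ 1},
      (I.1.2 - I.1.1)⁻¹ *
        ∫ t in Set.Icc I.1.1 I.1.2,
          |g t - (I.1.2 - I.1.1)⁻¹ * ∫ s in Set.Icc I.1.1 I.1.2, g s|) +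
    |∫ t in Set.Icc (0 : ℝ) 1, g t|

/-- The step function `Σ_{k=0}^n ξ_k 𝟙_{δ_k^n}` with `δ_k^n = [k/(n+1), (k+1)/(n+1)]`. -/
def stepFun (ξ : ℕ → ℝ) (n : ℕ) (t : ℝ) : ℝ :=
  ∑ k ∈ Finset.range (n + 1),
    Set.indicator (Set.Icc ((k : ℝ) / ((n : ℝ) + 1)) (((k : ℝ) + 1) / ((n : ℝ) + 1)))
      (fun _ => ξ k) t

/-- `bmo[ξ_n] = sup_{n ≥ 0} ‖Σ_{k=0}^n ξ_k 𝟙_{δ_k^n}‖_BMO`. -/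
def bmoSeq (ξ : ℕ → ℝ) : ℝ := ⨆ n : ℕ, bmoNorm (stepFun ξ n)

/-- `L` is the principal value `p.v. ∫_𝕋 g`, i.e. the limit as `ε → 0⁺` of the
integrals over `{ε < |t| < π}`. -/
def pvT1 (g : ℝ → ℝ) (L : ℝ) : Prop :=
  Filter.Tendsto (fun ε : ℝ => ∫ t in {t : ℝ | ε < |t| ∧ |t| < Real.pi}, g t)
    (nhdsWithin 0 (Set.Ioi 0)) (nhds L)

/-- `L` is the two-dimensional principal value `p.v. ∬_{𝕋²} g`, the limit as `ε → 0⁺`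
of the integrals over `{ε < |t| < π, ε < |s| < π}`. -/
def pvT2 (g : ℝ × ℝ → ℝ) (L : ℝ) : Prop :=
  Filter.Tendsto
    (fun ε : ℝ =>
      ∫ q in {q : ℝ × ℝ | (ε < |q.1| ∧ |q.1| < Real.pi) ∧ ε < |q.2| ∧ |q.2| < Real.pi}, g q)
    (nhdsWithin 0 (Set.Ioi 0)) (nhds L)

/-- Luxemburg norm with respect to a Young function `M`. -/
def luxNorm {α : Type*} [MeasurableSpace α] (μ : Measure α) (M : ℝ → ℝ) (g : α → ℝ) : ℝ :=
  sInf {lam : ℝ | 0 < lam ∧ ∫⁻ x, ENNReal.ofReal (M (|g x| / lam)) ∂μ ≤ 1}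

/-- The Young function `Φ(t) = t log⁺ t`. -/
def PhiY (t : ℝ) : ℝ := t * logPlus t

/-- The Young function `Ψ(t) = eᵗ - 1`. -/
def PsiY (t : ℝ) : ℝ := Real.exp t - 1


open MeasureTheory Filter Set
open scoped ENNReal

/-- Uncentered Hardy–Littlewood exceptional set. -/
def hlBad (γ : ℝ → ℝ≥0∞) (lam : ℝ) : Set ℝ :=
  ⋃ i ∈ {i : ℝ × ℝ | 0 < i.2 ∧ ENNReal.ofReal (2 * i.2 * lam) < ∫⁻ t in Metric.ball i.1 i.2, γ t},
    Metric.ball i.1 i.2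

lemma hlBad_isOpen (γ : ℝ → ℝ≥0∞) (lam : ℝ) : IsOpen (hlBad γ lam) :=
  isOpen_biUnion fun _ _ => Metric.isOpen_ball

lemma hlBad_compl {γ : ℝ → ℝ≥0∞} {lam x : ℝ} (hx : x ∉ hlBad γ lam) {r : ℝ} (hr : 0 < r) :
    ∫⁻ t in Metric.ball x r, γ t ≤ ENNReal.ofReal (2 * r * lam) := by
  by_contra h
  push Not at h
  apply hx
  simp only [hlBad, mem_iUnion]
  exact ⟨(x, r), ⟨hr, h⟩, Metric.mem_ball_self hr⟩

lemma hlBad_volume (γ : ℝ → ℝ≥0∞) {lam : ℝ} (hlam : 0 < lam) :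
    volume (hlBad γ lam) ≤ ENNReal.ofReal (4 / lam) * ∫⁻ t, γ t := by
  by_cases hfin : ∫⁻ t, γ t = ∞
  · rw [hfin, ENNReal.mul_top (by simp; positivity)]; exact le_top
  set t : Set (ℝ × ℝ) := {i : ℝ × ℝ | 0 < i.2 ∧
    ENNReal.ofReal (2 * i.2 * lam) < ∫⁻ t in Metric.ball i.1 i.2, γ t} with ht
  obtain ⟨u, hut, hdisj, hcov⟩ := Vitali.exists_disjoint_subfamily_covering_enlargement_ball
    t (fun i => i.1) (fun i => i.2) ((∫⁻ t, γ t).toReal / (2 * lam)) (by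
      rintro ⟨c, r⟩ ⟨h1, h2⟩
      have h3 : ENNReal.ofReal (2 * r * lam) ≤ ∫⁻ t, γ t :=
        h2.le.trans (setLIntegral_le_lintegral _ _)
      have h4 := (ENNReal.ofReal_le_iff_le_toReal hfin).1 h3
      simp only
      rw [le_div_iff₀ (by positivity)]
      linarith) 4 (by norm_num)
  have hcount : u.Countable := by
    refine hdisj.countable_of_isOpen (fun i _ => Metric.isOpen_ball) ?_
    intro i hi
    exact ⟨i.1, Metric.mem_ball_self (hut hi).1⟩
  have hsub : hlBad γ lam ⊆ ⋃ i ∈ u, Metric.ball i.1 (4 * i.2) := by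
    intro x hx
    simp only [hlBad, mem_iUnion] at hx
    obtain ⟨i, hi, hxi⟩ := hx
    obtain ⟨b, hb, hsub⟩ := hcov i hi
    simp only [mem_iUnion]
    exact ⟨b, hb, hsub hxi⟩
  calc volume (hlBad γ lam) ≤ volume (⋃ i ∈ u, Metric.ball i.1 (4 * i.2)) := measure_mono hsub
    _ ≤ ∑' i : u, volume (Metric.ball i.1.1 (4 * i.1.2)) := measure_biUnion_le _ hcount _
    _ ≤ ∑' i : u, ENNReal.ofReal (4 / lam) * ∫⁻ t in Metric.ball i.1.1 i.1.2, γ t := by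
        refine ENNReal.tsum_le_tsum fun i => ?_
        obtain ⟨h1, h2⟩ := hut i.2
        rw [Real.volume_ball]
        calc ENNReal.ofReal (2 * (4 * i.1.2)) = ENNReal.ofReal (4 / lam) * ENNReal.ofReal (2 * i.1.2 * lam) := by
              rw [← ENNReal.ofReal_mul (by positivity)]
              congr 1
              field_simp
          _ ≤ _ := by gcongr
    _ = ENNReal.ofReal (4 / lam) * ∫⁻ t in ⋃ i ∈ u, Metric.ball i.1 i.2, γ t := by
        rw [ENNReal.tsum_mul_left, lintegral_biUnion hcount (fun i _ => measurableSet_ball) hdisj]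
    _ ≤ _ := by
        exact mul_le_mul_right (setLIntegral_le_lintegral _ _) _

/-- Poisson-type averages are controlled by ball averages. -/
lemma poisson_avg_le {γ : ℝ → ℝ≥0∞} (hγ : Measurable γ) {lam x : ℝ} (hlam : 0 ≤ lam)
    (h : ∀ r : ℝ, 0 < r → ∫⁻ t in Metric.ball x r, γ t ≤ ENNReal.ofReal (2 * r * lam))
    {a : ℝ} (ha : 0 < a) :
    ∫⁻ t, γ t * ENNReal.ofReal (a / (a ^ 2 + (t - x) ^ 2)) ≤ ENNReal.ofReal (16 * lam) := by
  have key : ∀ t, γ t * ENNReal.ofReal (a / (a ^ 2 + (t - x) ^ 2)) ≤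
      ∑' k : ℕ, ENNReal.ofReal (4 * (4 : ℝ)⁻¹ ^ k / a) *
        (Metric.ball x (2 ^ k * a)).indicator γ t := by
    intro t
    have hex : ∃ k : ℕ, |t - x| < 2 ^ k * a := by
      obtain ⟨k, hk⟩ := pow_unbounded_of_one_lt (|t - x| / a) (one_lt_two : (1 : ℝ) < 2)
      exact ⟨k, by rwa [div_lt_iff₀ ha] at hk⟩
    classical
    set k := Nat.find hex with hk
    have hk1 : |t - x| < 2 ^ k * a := Nat.find_spec hex
    refine le_trans ?_ (ENNReal.le_tsum k)
    rw [indicator_of_mem (by simpa [Metric.mem_ball, Real.dist_eq] using hk1), mul_comm]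
    refine mul_le_mul_left (ENNReal.ofReal_le_ofReal ?_) _
    have hlow : 4⁻¹ * 4 ^ k * a ^ 2 ≤ a ^ 2 + (t - x) ^ 2 := by
      rcases Nat.eq_zero_or_pos k with h0 | hpos
      · rw [h0]; nlinarith [sq_nonneg (t - x), sq_nonneg a]
      · obtain ⟨j, hj⟩ := Nat.exists_eq_succ_of_ne_zero hpos.ne'
        have hjn : ¬ |t - x| < 2 ^ j * a := Nat.find_min hex (by omega)
        push Not at hjn
        have h5 : (2 ^ j * a) ^ 2 ≤ (t - x) ^ 2 := by
          rw [← sq_abs (t - x)]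
          exact pow_le_pow_left₀ (by positivity) hjn 2
        have h6 : ((2 : ℝ) ^ j * a) ^ 2 = 4⁻¹ * 4 ^ k * a ^ 2 := by
          rw [hj, mul_pow, ← pow_mul, mul_comm j 2, pow_mul, Nat.succ_eq_add_one, pow_succ]
          ring
        nlinarith [sq_nonneg a]
    rw [div_le_div_iff₀ (by positivity) ha]
    have h7 : (4 : ℝ)⁻¹ ^ k * 4 ^ k = 1 := by rw [← mul_pow]; norm_num
    have h8 : (0 : ℝ) < 4⁻¹ ^ k := by positivity
    calc a * a = 4 * 4⁻¹ ^ k * (4⁻¹ * 4 ^ k * a ^ 2) := by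
          linear_combination (-a ^ 2) * h7
      _ ≤ _ := by gcongr
  calc _ ≤ ∫⁻ t, ∑' k : ℕ, ENNReal.ofReal (4 * (4 : ℝ)⁻¹ ^ k / a) *
        (Metric.ball x (2 ^ k * a)).indicator γ t := lintegral_mono key
    _ = ∑' k : ℕ, ∫⁻ t, ENNReal.ofReal (4 * (4 : ℝ)⁻¹ ^ k / a) *
        (Metric.ball x (2 ^ k * a)).indicator γ t := by
        refine lintegral_tsum fun k => ?_
        exact ((hγ.indicator measurableSet_ball).const_mul _).aemeasurable
    _ ≤ ∑' k : ℕ, ENNReal.ofReal (8 * lam * (2 : ℝ)⁻¹ ^ k) := by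
        refine ENNReal.tsum_le_tsum fun k => ?_
        rw [lintegral_const_mul _ (hγ.indicator measurableSet_ball),
          lintegral_indicator measurableSet_ball]
        refine (mul_le_mul_right (h _ (by positivity)) _).trans (le_of_eq ?_)
        rw [← ENNReal.ofReal_mul (by positivity)]
        congr 1
        have : (4 : ℝ)⁻¹ ^ k * 2 ^ k = 2⁻¹ ^ k := by rw [← mul_pow]; norm_num
        field_simp
        field_simp at this
        linear_combination 8 * lam * this
    _ = ENNReal.ofReal (16 * lam) := by
        rw [← ENNReal.ofReal_tsum_of_nonneg (fun k => by positivity)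
          ((summable_geometric_of_lt_one (by norm_num) (by norm_num)).mul_left _),
          tsum_mul_left, tsum_geometric_of_lt_one (by norm_num) (by norm_num)]
        congr 1; ring

set_option linter.all false
open MeasureTheory Filter Set
open scoped ENNReal

noncomputable section

def ct (u : ℝ) : ℝ := 1 / (2 * Real.tan (u / 2))
def Qk (r u : ℝ) : ℝ := r * Real.sin u / ((1 - r) ^ 2 + 4 * r * Real.sin (u / 2) ^ 2)
def Pk (r u : ℝ) : ℝ := (1 - r ^ 2) / ((1 - r) ^ 2 + 4 * r * Real.sin (u / 2) ^ 2)

lemma ct_neg (u : ℝ) : ct (-u) = -ct u := by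
  unfold ct
  rw [neg_div, Real.tan_neg]
  simp [neg_inv]

lemma ct_abs_le {u : ℝ} (h0 : u ≠ 0) (h1 : |u| < Real.pi) : |ct u| ≤ 1 / |u| := by
  have main : ∀ v : ℝ, 0 < v → v < Real.pi → |ct v| ≤ 1 / v := by
    intro v hv hv1
    have h := Real.le_tan (x := v / 2) (by linarith) (by linarith)
    unfold ct
    rw [abs_of_nonneg (by have : 0 ≤ Real.tan (v / 2) := by linarith
                          positivity)]
    apply one_div_le_one_div_of_le hv; linarith
  rcases lt_or_gt_of_ne h0 with h | h
  · rw [abs_of_neg h] at h1 ⊢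
    have := main (-u) (by linarith) h1
    rwa [ct_neg, abs_neg] at this
  · rw [abs_of_pos h] at h1 ⊢
    exact main u h h1

lemma sin_half_ne {u : ℝ} (h0 : u ≠ 0) (h1 : |u| ≤ Real.pi) : Real.sin (u / 2) ≠ 0 := by
  have := abs_le.1 h1
  intro h
  have := (Real.sin_eq_zero_iff_of_lt_of_lt (x := u / 2) (by linarith [Real.pi_pos])
    (by linarith [Real.pi_pos])).1 h
  apply h0; linarith

lemma ct_eq' {u : ℝ} (h0 : u ≠ 0) (h1 : |u| < Real.pi) :
    ct u = Real.cos (u / 2) / (2 * Real.sin (u / 2)) := by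
  unfold ct
  rw [Real.tan_eq_sin_div_cos, ← mul_div_assoc, one_div_div]

lemma ct_eq {u : ℝ} (h0 : u ≠ 0) (h1 : |u| < Real.pi) :
    ct u = Real.sin u / (4 * Real.sin (u / 2) ^ 2) := by
  rw [ct_eq' h0 h1]
  have h := sin_half_ne h0 h1.le
  have : Real.sin u = 2 * Real.sin (u / 2) * Real.cos (u / 2) := by
    rw [← Real.sin_two_mul]; ring_nf
  rw [this]
  field_simp
  ring

lemma sin_half_sq_ge {u : ℝ} (h1 : |u| ≤ Real.pi) : u ^ 2 / 10 ≤ Real.sin (u / 2) ^ 2 := by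
  have hpi : Real.pi ^ 2 < 10 := by nlinarith [Real.pi_lt_d2, Real.pi_pos]
  have h := Real.mul_le_sin (x := |u| / 2) (by positivity) (by linarith)
  have h2 : 2 / Real.pi * (|u| / 2) = |u| / Real.pi := by field_simp
  rw [h2] at h
  have h3 : Real.sin (u / 2) ^ 2 = Real.sin (|u| / 2) ^ 2 := by
    rcases abs_cases u with ⟨h, _⟩ | ⟨h, _⟩ <;> rw [h]
    rw [neg_div, Real.sin_neg]; ring
  rw [h3]
  calc u ^ 2 / 10 ≤ (|u| / Real.pi) ^ 2 := by
        rw [div_pow, sq_abs]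
        apply div_le_div_of_nonneg_left (sq_nonneg _) (by positivity [Real.pi_pos]) hpi.le
    _ ≤ _ := by
        apply pow_le_pow_left₀ (by positivity [Real.pi_pos]) h

lemma D_lower {r u : ℝ} (h0 : 0 ≤ r) (h1 : r ≤ 1) (hu : |u| ≤ Real.pi) :
    2 / 25 * ((1 - r) ^ 2 + u ^ 2) ≤ (1 - r) ^ 2 + 4 * r * Real.sin (u / 2) ^ 2 := by
  have h := sin_half_sq_ge hu
  have h2 : Real.sin (u / 2) ^ 2 ≤ 1 := Real.sin_sq_le_one _
  set s := Real.sin (u / 2) ^ 2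
  have hs : 0 ≤ s := by positivity
  have h3 : ((1 - r) ^ 2 + 4 * s) / 5 ≤ (1 - r) ^ 2 + 4 * r * s := by
    have e1 : 0 ≤ (1 - s) * (1 - r) ^ 2 := mul_nonneg (by linarith) (sq_nonneg _)
    have e2 : 0 ≤ s * ((1 - r) ^ 2 * (4 / 5) + 4 * r - 4 / 5) := by
      apply mul_nonneg hs
      nlinarith
    nlinarith
  nlinarith [sq_nonneg (1 - r)]

lemma D_pos {r u : ℝ} (h0 : 0 ≤ r) (h1 : r < 1) :
    0 < (1 - r) ^ 2 + 4 * r * Real.sin (u / 2) ^ 2 := by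
  have : 0 < (1 - r) ^ 2 := by have : 0 < 1 - r := by linarith
                               positivity
  positivity

lemma kernel_diff {e u : ℝ} (he : 0 < e) (he1 : e ≤ 1) (h0 : u ≠ 0) (h1 : |u| < Real.pi) :
    |(if e < |u| then ct u else 0) - Qk (1 - e) u| ≤ 13 * (e / (e ^ 2 + u ^ 2)) := by
  have hD := D_lower (r := 1 - e) (u := u) (by linarith) (by linarith) h1.le
  have hDp := D_pos (r := 1 - e) (u := u) (by linarith) (by linarith)
  have hup : 0 < |u| := abs_pos.2 h0
  have hpos : 0 < e ^ 2 + u ^ 2 := by positivity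
  rw [sub_sub_cancel] at hD hDp
  have hs := sin_half_ne h0 h1.le
  split_ifs with h
  · have : ct u - Qk (1 - e) u = ct u * (e ^ 2 / (e ^ 2 + 4 * (1 - e) * Real.sin (u / 2) ^ 2)) := by
      rw [ct_eq h0 h1]; unfold Qk
      rw [sub_sub_cancel, div_sub_div _ _ (by positivity) hDp.ne', div_mul_div_comm,
        div_eq_div_iff (mul_ne_zero (by positivity) hDp.ne') (mul_ne_zero (by positivity) hDp.ne')]
      ring
    rw [this, abs_mul, abs_of_nonneg (by positivity : 0 ≤ e ^ 2 / (e ^ 2 + 4 * (1 - e) * Real.sin (u / 2) ^ 2))]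
    calc _ ≤ (1 / |u|) * (e ^ 2 / (2 / 25 * (e ^ 2 + u ^ 2))) := by
          gcongr
          exact ct_abs_le h0 h1
      _ ≤ (1 / e) * (e ^ 2 / (2 / 25 * (e ^ 2 + u ^ 2))) := by gcongr
      _ = 25 / 2 * (e / (e ^ 2 + u ^ 2)) := by field_simp
      _ ≤ _ := by gcongr; norm_num
  · push Not at h
    rw [zero_sub, abs_neg]
    unfold Qk
    rw [sub_sub_cancel, abs_div, abs_of_pos hDp, abs_mul, abs_of_nonneg (by linarith : 0 ≤ 1 - e)]
    calc _ ≤ e / (2 / 25 * (e ^ 2 + u ^ 2)) := by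
          gcongr
          have : |Real.sin u| ≤ |u| := Real.abs_sin_le_abs
          nlinarith [abs_nonneg (Real.sin u)]
      _ = 25 / 2 * (e / (e ^ 2 + u ^ 2)) := by field_simp
      _ ≤ _ := by gcongr; norm_num

lemma Pk_nonneg {r u : ℝ} (h0 : 0 ≤ r) (h1 : r < 1) : 0 ≤ Pk r u := by
  unfold Pk
  have := D_pos (u := u) h0 h1
  have : 0 ≤ 1 - r ^ 2 := by nlinarith
  positivity

lemma Pk_le {r u : ℝ} (h0 : 0 ≤ r) (h1 : r < 1) (hu : |u| ≤ Real.pi) :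
    Pk r u ≤ 25 * ((1 - r) / ((1 - r) ^ 2 + u ^ 2)) := by
  have hD := D_lower h0 h1.le hu
  have hr : 0 < 1 - r := by linarith
  unfold Pk
  calc _ ≤ (2 * (1 - r)) / (2 / 25 * ((1 - r) ^ 2 + u ^ 2)) := by
        gcongr
        nlinarith
    _ = _ := by field_simp

/-- `|φ|` cut off to `[-3π, 3π]`. -/
def cutE (φ : ℝ → ℝ) : ℝ → ℝ≥0∞ :=
  (Icc (-(3 * Real.pi)) (3 * Real.pi)).indicator fun t => ‖φ t‖ₑ

lemma cutE_measurable {φ : ℝ → ℝ} (h : Measurable φ) : Measurable (cutE φ) :=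
  h.enorm.indicator measurableSet_Icc

/-- All Poisson-type averages at `x` are at most `16 lam`. -/
def GoodP (γ : ℝ → ℝ≥0∞) (lam x : ℝ) : Prop :=
  ∀ a : ℝ, 0 < a → ∫⁻ t, γ t * ENNReal.ofReal (a / (a ^ 2 + (t - x) ^ 2)) ≤ ENNReal.ofReal (16 * lam)

lemma lint_K {φ : ℝ → ℝ} {lam x : ℝ} (hx : |x| ≤ Real.pi)
    (hg : GoodP (cutE φ) lam x) {s : Set ℝ} (hs : MeasurableSet s) (hs1 : ∀ u ∈ s, |u| ≤ Real.pi)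
    {k : ℝ → ℝ} {C a : ℝ} (hC : 0 ≤ C) (ha : 0 < a)
    (hk : ∀ u ∈ s, |k u| ≤ C * (a / (a ^ 2 + u ^ 2))) :
    ∫⁻ u in s, ‖k u * φ (x + u)‖ₑ ≤ ENNReal.ofReal (16 * C * lam) := by
  calc ∫⁻ u in s, ‖k u * φ (x + u)‖ₑ
      ≤ ∫⁻ u in s, ENNReal.ofReal C * (cutE φ (x + u) * ENNReal.ofReal (a / (a ^ 2 + (x + u - x) ^ 2))) := by
        refine setLIntegral_mono' hs fun u hu => ?_
        have h1 : cutE φ (x + u) = ‖φ (x + u)‖ₑ := by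
          unfold cutE
          rw [indicator_of_mem]
          have h2 := abs_le.1 hx
          have h3 := abs_le.1 (hs1 u hu)
          constructor <;> linarith [Real.pi_pos]
        rw [h1, add_sub_cancel_left, enorm_mul, mul_left_comm, ← ENNReal.ofReal_mul hC, mul_comm]
        gcongr
        rw [Real.enorm_eq_ofReal_abs]
        exact ENNReal.ofReal_le_ofReal (hk u hu)
    _ ≤ ∫⁻ u, ENNReal.ofReal C * (cutE φ (x + u) * ENNReal.ofReal (a / (a ^ 2 + (x + u - x) ^ 2))) :=
        setLIntegral_le_lintegral _ _
    _ = ENNReal.ofReal C * ∫⁻ t, cutE φ t * ENNReal.ofReal (a / (a ^ 2 + (t - x) ^ 2)) := by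
        rw [lintegral_const_mul' _ _ ENNReal.ofReal_ne_top]
        congr 1
        exact lintegral_add_left_eq_self
          (fun t => cutE φ t * ENNReal.ofReal (a / (a ^ 2 + (t - x) ^ 2))) x
    _ ≤ ENNReal.ofReal C * ENNReal.ofReal (16 * lam) := by
        gcongr; exact hg a ha
    _ = _ := by rw [← ENNReal.ofReal_mul hC]; congr 1; ring

lemma int_K {φ : ℝ → ℝ} {lam x : ℝ} (hlam : 0 ≤ lam) (hx : |x| ≤ Real.pi)
    (hg : GoodP (cutE φ) lam x) {s : Set ℝ} (hs : MeasurableSet s) (hs1 : ∀ u ∈ s, |u| ≤ Real.pi)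
    {k : ℝ → ℝ} {C a : ℝ} (hC : 0 ≤ C) (ha : 0 < a)
    (hk : ∀ u ∈ s, |k u| ≤ C * (a / (a ^ 2 + u ^ 2))) :
    |∫ u in s, k u * φ (x + u)| ≤ 16 * C * lam := by
  have h := (enorm_integral_le_lintegral_enorm (μ := volume.restrict s)
    (fun u => k u * φ (x + u))).trans (lint_K hx hg hs hs1 hC ha hk)
  rw [Real.enorm_eq_ofReal_abs] at h
  exact (ENNReal.ofReal_le_ofReal_iff (by positivity)).1 h

end

set_option linter.all false
open MeasureTheory Filter Set
open scoped ENNReal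

noncomputable section

/-- The open period interval. -/
def J1 : Set ℝ := Ioo (-Real.pi) Real.pi

lemma J1_meas : MeasurableSet J1 := measurableSet_Ioo

lemma J1_abs {u : ℝ} (hu : u ∈ J1) : |u| < Real.pi := abs_lt.2 hu

/-- Measurable, `2π`-periodic, integrable over a period. -/
structure PerInt (φ : ℝ → ℝ) : Prop where
  meas : Measurable φ
  per : Function.Periodic φ (2 * Real.pi)
  int : IntegrableOn φ J1

lemma J1_ae : J1 =ᵐ[volume] Ioc (-Real.pi) Real.pi := Ioo_ae_eq_Ioc

lemma per_lint_Ioc {g : ℝ → ℝ≥0∞} (hg : Function.Periodic g (2 * Real.pi)) (s t : ℝ) :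
    ∫⁻ u in Ioc s (s + 2 * Real.pi), g u = ∫⁻ u in Ioc t (t + 2 * Real.pi), g u := by
  haveI : VAddInvariantMeasure (AddSubgroup.zmultiples (2 * Real.pi)) ℝ volume :=
    ⟨fun c s _ => measure_preimage_add _ _ _⟩
  apply IsAddFundamentalDomain.setLIntegral_eq (G := AddSubgroup.zmultiples (2 * Real.pi))
  exacts [isAddFundamentalDomain_Ioc Real.two_pi_pos s, isAddFundamentalDomain_Ioc Real.two_pi_pos t,
    hg.map_vadd_zmultiples]

lemma per_lint_J1 {g : ℝ → ℝ≥0∞} (hg : Function.Periodic g (2 * Real.pi)) (x : ℝ) :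
    ∫⁻ u in J1, g (x + u) = ∫⁻ u in J1, g u := by
  rw [setLIntegral_congr J1_ae, setLIntegral_congr J1_ae]
  have h := per_lint_Ioc hg (x - Real.pi) (-Real.pi)
  have e1 : -Real.pi + 2 * Real.pi = Real.pi := by ring
  have e2 : x - Real.pi + 2 * Real.pi = x + Real.pi := by ring
  rw [e1, e2] at h
  rw [← h]
  rw [← lintegral_indicator measurableSet_Ioc, ← lintegral_indicator measurableSet_Ioc,
    ← lintegral_add_left_eq_self ((Ioc (x - Real.pi) (x + Real.pi)).indicator fun a => g a) x]
  congr 1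
  ext u
  simp only [indicator, mem_Ioc]
  congr 1
  apply propext
  constructor <;> rintro ⟨h1, h2⟩ <;> constructor <;> linarith

lemma lint_cutE {φ : ℝ → ℝ} (hφ : Function.Periodic φ (2 * Real.pi)) :
    ∫⁻ t, cutE φ t ≤ 3 * ∫⁻ u in J1, ‖φ u‖ₑ := by
  have hper : Function.Periodic (fun t => ‖φ t‖ₑ) (2 * Real.pi) := fun t => by
    simp only [hφ t]
  have hJ : ∀ s, ∫⁻ u in Ioc s (s + 2 * Real.pi), ‖φ u‖ₑ = ∫⁻ u in J1, ‖φ u‖ₑ := by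
    intro s
    rw [setLIntegral_congr J1_ae, per_lint_Ioc hper s (-Real.pi)]
    congr 3; ring
  unfold cutE
  rw [lintegral_indicator measurableSet_Icc, ← setLIntegral_congr Ioc_ae_eq_Icc]
  have hsub : Ioc (-(3 * Real.pi)) (3 * Real.pi) ⊆
      (Ioc (-(3 * Real.pi)) (-(3 * Real.pi) + 2 * Real.pi) ∪ Ioc (-Real.pi) (-Real.pi + 2 * Real.pi)) ∪
        Ioc Real.pi (Real.pi + 2 * Real.pi) := by
    intro u hu
    simp only [mem_union, mem_Ioc] at hu ⊢
    by_cases h1 : u ≤ -Real.pi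
    · left; left; constructor <;> linarith
    · by_cases h2 : u ≤ Real.pi
      · left; right; constructor <;> linarith
      · right; constructor <;> linarith
  calc _ ≤ _ := lintegral_mono_set hsub
    _ ≤ _ := lintegral_union_le _ _ _
    _ ≤ _ := add_le_add_left (lintegral_union_le _ _ _) _
    _ = _ := by rw [hJ, hJ, hJ]; ring

lemma PerInt.shift {φ : ℝ → ℝ} (h : PerInt φ) (x : ℝ) : IntegrableOn (fun u => φ (x + u)) J1 := by
  refine ⟨(h.meas.comp (measurable_const.add measurable_id)).aestronglyMeasurable, ?_⟩
  have := per_lint_J1 (g := fun t => ‖φ t‖ₑ) (fun t => by simp only [h.per t]) x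
  rw [HasFiniteIntegral, this]
  exact h.int.2

lemma per_int_J1 {g : ℝ → ℂ} (hg : Function.Periodic g (2 * Real.pi)) (x : ℝ) :
    ∫ u in (0 : ℝ)..(2 * Real.pi), g u = ∫ u in J1, g (x + u) := by
  have h := hg.intervalIntegral_add_eq 0 (x - Real.pi)
  rw [zero_add] at h
  rw [h]
  have e2 : x - Real.pi + 2 * Real.pi = x + Real.pi := by ring
  rw [e2, setIntegral_congr_set J1_ae, ← intervalIntegral.integral_of_le (by linarith [Real.pi_pos]),
    intervalIntegral.integral_comp_add_left]
  rfl

lemma PerInt.arg_eq {φ : ℝ → ℝ} (h : Function.Periodic φ (2 * Real.pi)) (θ : ℝ) :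
    φ (Complex.arg (circleMap 0 1 θ)) = φ θ := by
  rw [circleMap_zero, Complex.ofReal_one, one_mul, Complex.arg_exp_mul_I,
    toIocMod, h.sub_zsmul_eq]

/-- The Herglotz integral of `φ`. -/
def FH (φ : ℝ → ℝ) (w : ℂ) : ℂ :=
  Real.circleAverage (fun ζ => herglotzRieszKernel 0 w ζ • ((φ ζ.arg : ℝ) : ℂ)) 0 1

lemma PerInt.circleInt {φ : ℝ → ℝ} (h : PerInt φ) : CircleIntegrable (fun ζ => φ ζ.arg) 0 1 := by
  unfold CircleIntegrable
  simp only [PerInt.arg_eq h.per]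
  have h1 : IntervalIntegrable φ volume (-Real.pi) (-Real.pi + 2 * Real.pi) := by
    have e1 : -Real.pi + 2 * Real.pi = Real.pi := by ring
    rw [e1, intervalIntegrable_iff_integrableOn_Ioo_of_le (by linarith [Real.pi_pos])]
    exact h.int
  exact Function.Periodic.intervalIntegrable h.per Real.two_pi_pos.ne' h1 _ _

lemma FH_diff {φ : ℝ → ℝ} (h : PerInt φ) : DifferentiableOn ℂ (FH φ) (Metric.ball 0 1) := by
  apply differentiableOn_circleAverage_herglotzRieszKernel_smul
  have := h.circleInt
  simp only [CircleIntegrable, intervalIntegrable_iff] at this ⊢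
  exact Complex.ofRealCLM.integrable_comp this

lemma herg_kernel {r : ℝ} (h0 : 0 ≤ r) (h1 : r < 1) (x u : ℝ) :
    herglotzRieszKernel 0 (r * Complex.exp (x * Complex.I)) (circleMap 0 1 (x + u)) =
      (Pk r u : ℂ) - 2 * Complex.I * (Qk r u : ℂ) := by
  have hD := D_pos (u := u) h0 h1
  have hhalf : Real.sin (u / 2) ^ 2 = (1 - Real.cos u) / 2 := by
    rw [Real.sin_sq_eq_half_sub]; ring_nf
  unfold herglotzRieszKernel Pk Qk
  rw [hhalf] at hD ⊢
  rw [circleMap_zero]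
  push_cast
  have hE : Complex.exp ((x + u) * Complex.I) = Complex.exp (x * Complex.I) *
      (Complex.cos u + Complex.sin u * Complex.I) := by
    rw [add_mul, Complex.exp_add, Complex.exp_mul_I (u : ℂ)]
  have hx : Complex.exp (x * Complex.I) ≠ 0 := Complex.exp_ne_zero _
  have hc : Complex.cos u ^ 2 + Complex.sin u ^ 2 = 1 := by
    rw [add_comm]; exact Complex.sin_sq_add_cos_sq _
  have hDc : (1 - (r : ℂ)) ^ 2 + 4 * r * ((1 - Complex.cos u) / 2) ≠ 0 := by
    have := hD.ne'
    exact_mod_cast this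
  have hne : Complex.cos u + Complex.sin u * Complex.I - r ≠ 0 := by
    intro h
    have h2 : (1 - (r : ℂ)) ^ 2 + 4 * r * ((1 - Complex.cos u) / 2) =
        (Complex.cos u + Complex.sin u * Complex.I - r) * (Complex.cos u - Complex.sin u * Complex.I - r) := by
      linear_combination (-1 : ℂ) * hc + (Complex.sin u)^2 * Complex.I_sq
    rw [h, zero_mul] at h2
    exact hDc h2
  rw [hE]
  have e1 : (1 * (Complex.exp (x * Complex.I) * (Complex.cos u + Complex.sin u * Complex.I)) - 0 +
      (r * Complex.exp (x * Complex.I) - 0)) / (1 * (Complex.exp (x * Complex.I) * (Complex.cos u + Complex.sin u * Complex.I)) - 0 -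
      (r * Complex.exp (x * Complex.I) - 0)) =
      (Complex.cos u + Complex.sin u * Complex.I + r) / (Complex.cos u + Complex.sin u * Complex.I - r) := by
    rw [← mul_div_mul_left _ (Complex.cos u + Complex.sin u * Complex.I - r) hx]
    congr 1 <;> ring
  rw [e1, ← mul_div_assoc (2 * Complex.I), ← sub_div, div_eq_div_iff hne hDc]
  linear_combination (-2 * (r:ℂ)) * hc + (2 * r * Complex.sin u ^ 2) * Complex.I_sq

lemma FH_polar {φ : ℝ → ℝ} (h : Function.Periodic φ (2 * Real.pi)) {r : ℝ} (h0 : 0 ≤ r) (h1 : r < 1) (x : ℝ) :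
    FH φ (r * Complex.exp (x * Complex.I)) = (2 * Real.pi)⁻¹ •
      ∫ u in J1, ((Pk r u : ℂ) - 2 * Complex.I * (Qk r u : ℂ)) * (φ (x + u) : ℂ) := by
  unfold FH
  rw [Real.circleAverage_def]
  congr 1
  have hper : Function.Periodic (fun θ : ℝ => herglotzRieszKernel 0 (r * Complex.exp (x * Complex.I))
      (circleMap 0 1 θ) • ((φ (Complex.arg (circleMap 0 1 θ)) : ℝ) : ℂ)) (2 * Real.pi) := by
    intro θ
    simp only [periodic_circleMap 0 1 θ]
  rw [per_int_J1 hper x]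
  congr 1
  ext u
  rw [PerInt.arg_eq h, herg_kernel h0 h1, smul_eq_mul]
end

set_option linter.all false
open MeasureTheory Filter Set
open scoped ENNReal
noncomputable section

lemma Pk_cont {r : ℝ} (h0 : 0 ≤ r) (h1 : r < 1) : Continuous (Pk r) := by
  unfold Pk
  exact Continuous.div (by fun_prop) (by fun_prop) (fun u => (D_pos h0 h1).ne')

lemma Qk_cont {r : ℝ} (h0 : 0 ≤ r) (h1 : r < 1) : Continuous (Qk r) := by
  unfold Qk
  exact Continuous.div (by fun_prop) (by fun_prop) (fun u => (D_pos h0 h1).ne')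

lemma int_mul_J1 {k φ : ℝ → ℝ} (hk : Continuous k) (hφ : IntegrableOn φ J1) :
    IntegrableOn (fun u => k u * φ u) J1 := by
  obtain ⟨C, hC⟩ := (isCompact_Icc (a := -Real.pi) (b := Real.pi)).exists_bound_of_continuousOn hk.continuousOn
  exact Integrable.bdd_mul hφ hk.aestronglyMeasurable
    ((ae_restrict_iff' J1_meas).2 (ae_of_all _ fun u hu => hC u ⟨hu.1.le, hu.2.le⟩))

lemma FH_re {φ : ℝ → ℝ} (h : PerInt φ) {r : ℝ} (h0 : 0 ≤ r) (h1 : r < 1) (x : ℝ) :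
    (FH φ (r * Complex.exp (x * Complex.I))).re = (2 * Real.pi)⁻¹ * ∫ u in J1, Pk r u * φ (x + u) := by
  have hP := int_mul_J1 (Pk_cont h0 h1) (h.shift x)
  have hQ := int_mul_J1 (Qk_cont h0 h1) (h.shift x)
  rw [FH_polar h.per h0 h1, Complex.smul_re, smul_eq_mul]
  congr 1
  have e : ∀ u, ((Pk r u : ℂ) - 2 * Complex.I * (Qk r u : ℂ)) * (φ (x + u) : ℂ) =
      ((Pk r u * φ (x + u) : ℝ) : ℂ) + (-2 * Complex.I) * ((Qk r u * φ (x + u) : ℝ) : ℂ) := by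
    intro u; push_cast; ring
  simp only [e]
  rw [integral_add (hP.ofReal) (hQ.ofReal.const_mul _), integral_const_mul, integral_complex_ofReal, integral_complex_ofReal]
  simp

lemma FH_im {φ : ℝ → ℝ} (h : PerInt φ) {r : ℝ} (h0 : 0 ≤ r) (h1 : r < 1) (x : ℝ) :
    (FH φ (r * Complex.exp (x * Complex.I))).im = -(Real.pi)⁻¹ * ∫ u in J1, Qk r u * φ (x + u) := by
  have hP := int_mul_J1 (Pk_cont h0 h1) (h.shift x)
  have hQ := int_mul_J1 (Qk_cont h0 h1) (h.shift x)
  rw [FH_polar h.per h0 h1, Complex.smul_im, smul_eq_mul]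
  have e : ∀ u, ((Pk r u : ℂ) - 2 * Complex.I * (Qk r u : ℂ)) * (φ (x + u) : ℂ) =
      ((Pk r u * φ (x + u) : ℝ) : ℂ) + (-2 * Complex.I) * ((Qk r u * φ (x + u) : ℝ) : ℂ) := by
    intro u; push_cast; ring
  simp only [e]
  rw [integral_add (hP.ofReal) (hQ.ofReal.const_mul _), integral_const_mul, integral_complex_ofReal, integral_complex_ofReal]
  simp
  have := Real.pi_pos
  field_simp

lemma polar_mem {r : ℝ} (h0 : 0 ≤ r) (h1 : r < 1) (x : ℝ) :
    (r : ℂ) * Complex.exp (x * Complex.I) ∈ Metric.ball (0 : ℂ) 1 := by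
  rw [mem_ball_zero_iff, norm_mul, Complex.norm_exp_ofReal_mul_I, mul_one, Complex.norm_real, Real.norm_eq_abs,
    abs_of_nonneg h0]
  exact h1

lemma polar_ex {z : ℂ} (hz : z ∈ Metric.ball (0 : ℂ) 1) :
    ∃ r x : ℝ, 0 ≤ r ∧ r < 1 ∧ z = r * Complex.exp (x * Complex.I) :=
  ⟨‖z‖, z.arg, norm_nonneg _, mem_ball_zero_iff.1 hz, (Complex.norm_mul_exp_arg_mul_I z).symm⟩

lemma circ_cont {h : ℂ → ℂ} (hh : DifferentiableOn ℂ h (Metric.ball 0 1)) {R : ℝ} (h0 : 0 ≤ R) (h1 : R < 1) :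
    Continuous (fun θ : ℝ => h (R * Complex.exp (θ * Complex.I))) :=
  hh.continuousOn.comp_continuous (by fun_prop) (fun θ => polar_mem h0 h1 θ)

lemma harm {h : ℂ → ℂ} (hh : DifferentiableOn ℂ h (Metric.ball 0 1)) {R ρ : ℝ} (h0 : 0 ≤ R) (h1 : R < 1)
    (k0 : 0 ≤ ρ) (k1 : ρ < 1) (x : ℝ) :
    h (((R * ρ : ℝ) : ℂ) * Complex.exp (x * Complex.I)) =
      (2 * Real.pi)⁻¹ • ∫ u in J1, Pk ρ u • h (R * Complex.exp (((x + u : ℝ) : ℂ) * Complex.I)) := by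
  have hR1 : ∀ z ∈ Metric.closedBall (0 : ℂ) 1, (R : ℂ) * z ∈ Metric.ball (0 : ℂ) 1 := by
    intro z hz
    rw [mem_closedBall_zero_iff] at hz
    rw [mem_ball_zero_iff, norm_mul, Complex.norm_real, Real.norm_eq_abs, abs_of_nonneg h0]
    nlinarith
  have hd : DiffContOnCl ℂ (fun z => h (R * z)) (Metric.ball 0 1) := by
    constructor
    · exact hh.comp (by fun_prop) (fun z hz => hR1 z (Metric.ball_subset_closedBall hz))
    · rw [closure_ball _ one_ne_zero]
      exact hh.continuousOn.comp (by fun_prop) hR1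
  have hm := hd.circleAverage_re_herglotzRieszKernel_smul (polar_mem k0 k1 x)
  rw [Real.circleAverage_def] at hm
  have hper : Function.Periodic (fun θ : ℝ => ((Complex.re ∘ herglotzRieszKernel 0 (ρ * Complex.exp (x * Complex.I))) •
      fun z => h (R * z)) (circleMap 0 1 θ)) (2 * Real.pi) := by
    intro θ
    simp only [periodic_circleMap 0 1 θ]
  rw [per_int_J1 hper x] at hm
  have e : (((R * ρ : ℝ) : ℂ) * Complex.exp (x * Complex.I)) = R * (ρ * Complex.exp (x * Complex.I)) := by
    push_cast; ring
  rw [e, ← hm]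
  congr 2
  ext u
  rw [Pi.smul_apply', Function.comp_apply, herg_kernel k0 k1, circleMap_zero]
  simp
end

set_option linter.all false
open MeasureTheory Filter Set
open scoped ENNReal
noncomputable section

lemma goodP_of {φ : ℝ → ℝ} (hφ : Measurable φ) {lam x : ℝ} (hlam : 0 ≤ lam)
    (hx : x ∉ hlBad (cutE φ) lam) : GoodP (cutE φ) lam x := fun a ha =>
  poisson_avg_le (cutE_measurable hφ) hlam (fun r hr => hlBad_compl hx hr) ha

lemma FH_re_nonneg {φ : ℝ → ℝ} (h : PerInt φ) (hp : ∀ x, 0 ≤ φ x) {z : ℂ} (hz : z ∈ Metric.ball (0:ℂ) 1) :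
    0 ≤ (FH φ z).re := by
  obtain ⟨r, x, h0, h1, rfl⟩ := polar_ex hz
  rw [FH_re h h0 h1]
  have := Real.pi_pos
  refine mul_nonneg (by positivity) (setIntegral_nonneg J1_meas fun u _ => mul_nonneg (Pk_nonneg h0 h1) (hp _))

lemma Pk_zero (u : ℝ) : Pk 0 u = 1 := by simp [Pk]
lemma Qk_zero (u : ℝ) : Qk 0 u = 0 := by simp [Qk]

lemma FH_zero {φ : ℝ → ℝ} (h : PerInt φ) : FH φ 0 = (((2 * Real.pi)⁻¹ * ∫ u in J1, φ u : ℝ) : ℂ) := by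
  have h1 := FH_re h le_rfl zero_lt_one 0
  have h2 := FH_im h le_rfl zero_lt_one 0
  simp only [Complex.ofReal_zero, zero_mul, Pk_zero, Qk_zero, zero_add, one_mul, integral_zero, mul_zero] at h1 h2
  apply Complex.ext
  · rw [h1, Complex.ofReal_re]
  · rw [h2, Complex.ofReal_im]

lemma harm_re {h : ℂ → ℂ} (hh : DifferentiableOn ℂ h (Metric.ball 0 1)) {R ρ : ℝ} (h0 : 0 ≤ R) (h1 : R < 1)
    (k0 : 0 ≤ ρ) (k1 : ρ < 1) (x : ℝ) :
    (h (((R * ρ : ℝ) : ℂ) * Complex.exp (x * Complex.I))).re =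
      (2 * Real.pi)⁻¹ * ∫ u in J1, Pk ρ u * (h (R * Complex.exp (((x + u : ℝ) : ℂ) * Complex.I))).re := by
  rw [harm hh h0 h1 k0 k1, Complex.smul_re, smul_eq_mul]
  congr 1
  rw [← Complex.reCLM_apply, ← Complex.reCLM.integral_comp_comm]
  · simp
  · have hc : Continuous (fun u : ℝ => Pk ρ u • h (R * Complex.exp (((x + u : ℝ) : ℂ) * Complex.I))) :=
      (Pk_cont k0 k1).smul ((circ_cont hh h0 h1).comp (by fun_prop : Continuous fun u : ℝ => x + u))
    exact (hc.continuousOn.integrableOn_Icc (a := -Real.pi) (b := Real.pi)).mono_set Ioo_subset_Icc_self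

lemma max_pos {h : ℂ → ℂ} (hh : DifferentiableOn ℂ h (Metric.ball 0 1))
    (hp : ∀ z ∈ Metric.ball (0:ℂ) 1, 0 ≤ (h z).re) {R : ℝ} (h0 : 0 < R) (h1 : R < 1) :
    volume {x : ℝ | |x| ≤ Real.pi ∧ ∃ r : ℝ, 0 ≤ r ∧ r < R ∧
      1 / 4 ≤ (h (r * Complex.exp (x * Complex.I))).re} ≤ ENNReal.ofReal (3600 * (2 * Real.pi) * (h 0).re) := by
  set ψ : ℝ → ℝ := fun θ => (h (R * Complex.exp (θ * Complex.I))).re with hψ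
  have hc : Continuous ψ := Complex.continuous_re.comp (circ_cont hh h0.le h1)
  have hper : Function.Periodic ψ (2 * Real.pi) := by
    intro θ
    simp only [hψ]
    congr 3
    push_cast
    rw [add_mul, Complex.exp_add, Complex.exp_two_pi_mul_I, mul_one]
  have hpos : ∀ θ, 0 ≤ ψ θ := fun θ => hp _ (polar_mem h0.le h1 θ)
  have hpsiI : IntegrableOn ψ J1 :=
    (hc.continuousOn.integrableOn_Icc (a := -Real.pi) (b := Real.pi)).mono_set Ioo_subset_Icc_self
  have hsub : {x : ℝ | |x| ≤ Real.pi ∧ ∃ r : ℝ, 0 ≤ r ∧ r < R ∧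
      1 / 4 ≤ (h (r * Complex.exp (x * Complex.I))).re} ⊆ hlBad (cutE ψ) (1 / 300) := by
    rintro x ⟨hx, r, hr0, hrR, hr⟩
    by_contra hbad
    have hg := goodP_of hc.measurable (by norm_num) hbad
    have k0 : 0 ≤ r / R := by positivity
    have k1 : r / R < 1 := (div_lt_one h0).2 hrR
    have hk := int_K (by norm_num) hx hg J1_meas (fun u hu => (J1_abs hu).le) (k := Pk (r / R)) (C := 25)
      (a := 1 - r / R) (by norm_num) (by linarith) (fun u hu => by
        rw [abs_of_nonneg (Pk_nonneg k0 k1)]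
        exact Pk_le k0 k1 (J1_abs hu).le)
    have hm := harm_re hh h0.le h1 k0 k1 x
    have e : R * (r / R) = r := by field_simp
    rw [e] at hm
    rw [hm] at hr
    have h2 := (le_abs_self _).trans hk
    have hpi := Real.pi_gt_three
    have h3 : (2 * Real.pi)⁻¹ ≤ 6⁻¹ := by
      apply inv_anti₀ <;> linarith
    have h4 : (2 * Real.pi)⁻¹ * ∫ u in J1, Pk (r / R) u * ψ (x + u) ≤ 6⁻¹ * (16 * 25 * (1 / 300)) := by
      apply mul_le_mul h3 h2 (setIntegral_nonneg J1_meas fun u _ => mul_nonneg (Pk_nonneg k0 k1) (hpos _)) (by norm_num)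
    have : (1:ℝ) / 4 ≤ 6⁻¹ * (16 * 25 * (1 / 300)) := hr.trans h4
    norm_num at this
  refine (measure_mono hsub).trans ((hlBad_volume _ (by norm_num)).trans ?_)
  have e1 : ∫⁻ u in J1, ‖ψ u‖ₑ = ENNReal.ofReal (∫ u in J1, ψ u) := by
    rw [ofReal_integral_eq_lintegral_ofReal hpsiI (ae_of_all _ hpos)]
    congr 1; ext u
    rw [Real.enorm_eq_ofReal (hpos u)]
  have e2 : ∫ u in J1, ψ u = 2 * Real.pi * (h 0).re := by
    have hm := harm_re hh h0.le h1 le_rfl zero_lt_one 0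
    simp only [mul_zero, Complex.ofReal_zero, zero_mul, Pk_zero, one_mul, zero_add] at hm
    rw [hm]
    have := Real.pi_pos
    field_simp
    rfl
  calc _ ≤ ENNReal.ofReal (4 / (1 / 300)) * (3 * ∫⁻ u in J1, ‖ψ u‖ₑ) := by gcongr; exact lint_cutE hper
    _ = _ := by
      rw [e1, e2, show (3 : ℝ≥0∞) = ENNReal.ofReal 3 by simp, ← ENNReal.ofReal_mul (by norm_num),
        ← ENNReal.ofReal_mul (by norm_num)]
      congr 1; ring

/-- Weak type bound for the maximal conjugate Poisson integral. -/
lemma conj_max {φ : ℝ → ℝ} (h : PerInt φ) (hp : ∀ x, 0 ≤ φ x) {lam : ℝ} (hlam : 0 < lam) :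
    volume {x : ℝ | |x| ≤ Real.pi ∧ ∃ r : ℝ, 0 ≤ r ∧ r < 1 ∧ lam < |∫ u in J1, Qk r u * φ (x + u)|} ≤
      ENNReal.ofReal (3600 * Real.pi / lam) * ∫⁻ u in J1, ‖φ u‖ₑ := by
  have hpi := Real.pi_pos
  set μ := lam / Real.pi with hμ
  have hμ0 : 0 < μ := by positivity
  set H : ℂ → ℂ := fun z => FH φ z / (FH φ z + μ) with hH
  have hne : ∀ z ∈ Metric.ball (0:ℂ) 1, FH φ z + μ ≠ 0 := by
    intro z hz h0
    have := congrArg Complex.re h0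
    simp at this
    linarith [FH_re_nonneg h hp hz]
  have hd : DifferentiableOn ℂ H (Metric.ball 0 1) :=
    (FH_diff h).div ((FH_diff h).add_const _) hne
  have hre : ∀ z, (H z).re = ((FH φ z).re ^ 2 + (FH φ z).im ^ 2 + μ * (FH φ z).re) /
      (((FH φ z).re + μ) ^ 2 + (FH φ z).im ^ 2) := by
    intro z
    simp only [hH, Complex.div_re, Complex.normSq_apply]
    simp
    rw [← add_div]
    congr 1 <;> ring
  have hpos : ∀ z ∈ Metric.ball (0:ℂ) 1, 0 ≤ (H z).re := by
    intro z hz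
    rw [hre]
    have := FH_re_nonneg h hp hz
    positivity
  have hI : (∫ u in J1, φ u) = (∫⁻ u in J1, ‖φ u‖ₑ).toReal := by
    rw [integral_eq_lintegral_of_nonneg_ae (ae_of_all _ hp) h.meas.aestronglyMeasurable]
    congr 2; ext u; rw [Real.enorm_eq_ofReal (hp u)]
  have hI0 : 0 ≤ ∫ u in J1, φ u := by rw [hI]; positivity
  have hzero : (H 0).re ≤ (2 * Real.pi)⁻¹ * (∫ u in J1, φ u) / μ := by
    rw [hre, FH_zero h]
    simp only [Complex.ofReal_re, Complex.ofReal_im]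
    set U := (2 * Real.pi)⁻¹ * (∫ u in J1, φ u) with hU
    have hU0 : 0 ≤ U := by positivity
    rw [div_le_div_iff₀ (by positivity) hμ0]
    nlinarith [mul_nonneg hU0 hμ0.le, mul_nonneg hU0 hU0, mul_nonneg hU0 (mul_nonneg hU0 hU0), mul_nonneg (mul_nonneg hU0 hU0) hμ0.le]
  have hquart : ∀ z ∈ Metric.ball (0:ℂ) 1, μ ≤ |(FH φ z).im| → 1 / 4 ≤ (H z).re := by
    intro z hz hV
    rw [hre]
    have hU := FH_re_nonneg h hp hz
    have hV2 : μ ^ 2 ≤ (FH φ z).im ^ 2 := by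
      rw [← sq_abs (FH φ z).im]; gcongr
    rw [div_le_div_iff₀ (by norm_num) (by positivity)]
    nlinarith [mul_nonneg hU hμ0.le, sq_nonneg (FH φ z).re]
  set E : ℕ → Set ℝ := fun n => {x : ℝ | |x| ≤ Real.pi ∧ ∃ r : ℝ, 0 ≤ r ∧ r < 1 - 1 / ((n:ℝ) + 2) ∧
      1 / 4 ≤ (H (r * Complex.exp (x * Complex.I))).re} with hE
  have hmono : Monotone E := by
    intro m n hmn x
    rintro ⟨hx, r, hr0, hr1, hr⟩
    refine ⟨hx, r, hr0, hr1.trans_le ?_, hr⟩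
    have : (m:ℝ) ≤ n := by exact_mod_cast hmn
    gcongr
  have hsub : {x : ℝ | |x| ≤ Real.pi ∧ ∃ r : ℝ, 0 ≤ r ∧ r < 1 ∧ lam < |∫ u in J1, Qk r u * φ (x + u)|} ⊆ ⋃ n, E n := by
    rintro x ⟨hx, r, hr0, hr1, hr⟩
    obtain ⟨n, hn⟩ := exists_nat_one_div_lt (sub_pos.2 hr1)
    refine mem_iUnion.2 ⟨n, hx, r, hr0, ?_, hquart _ (polar_mem hr0 hr1 x) ?_⟩
    · have : 1 / ((n:ℝ) + 2) ≤ 1 / ((n:ℝ) + 1) := by gcongr; norm_num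
      linarith
    · rw [FH_im h hr0 hr1, abs_mul, abs_neg, abs_of_pos (by positivity), hμ, div_eq_inv_mul]
      gcongr
  refine (measure_mono hsub).trans ?_
  rw [hmono.measure_iUnion]
  refine iSup_le fun n => (max_pos hd hpos ?_ ?_).trans ?_
  · have : 1 / ((n:ℝ) + 2) < 1 := by
      rw [div_lt_one (by positivity)]; have : (0:ℝ) ≤ n := by positivity
      linarith
    linarith
  · have : 0 < 1 / ((n:ℝ) + 2) := by positivity
    linarith
  · have hfin : ∫⁻ u in J1, ‖φ u‖ₑ ≠ ⊤ := h.int.2.ne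
    rw [← ENNReal.ofReal_toReal hfin, ← hI, ← ENNReal.ofReal_mul (by positivity)]
    apply ENNReal.ofReal_le_ofReal
    calc 3600 * (2 * Real.pi) * (H 0).re ≤ 3600 * (2 * Real.pi) * ((2 * Real.pi)⁻¹ * (∫ u in J1, φ u) / μ) := by gcongr
      _ = _ := by rw [hμ]; field_simp
end

set_option linter.all false
open MeasureTheory Filter Set
open scoped ENNReal
noncomputable section

lemma cont_int_J1 {g : ℝ → ℝ} (hc : Continuous g) : IntegrableOn g J1 :=
  (hc.continuousOn.integrableOn_Icc (a := -Real.pi) (b := Real.pi)).mono_set Ioo_subset_Icc_self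

lemma vol_J1 : volume.real J1 = 2 * Real.pi := by
  have := Real.pi_pos
  rw [measureReal_def, J1, Real.volume_Ioo, ENNReal.toReal_ofReal (by linarith)]; ring

lemma perInt_const (c : ℝ) : PerInt (fun _ => c) :=
  ⟨measurable_const, fun _ => rfl, cont_int_J1 continuous_const⟩

lemma int_Pk {r : ℝ} (h0 : 0 ≤ r) (h1 : r < 1) : ∫ u in J1, Pk r u = 2 * Real.pi := by
  have h := harm_re (h := fun _ => 1) (by fun_prop) (R := 0) le_rfl zero_lt_one h0 h1 0
  simp only [Complex.one_re, mul_one] at h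
  have := Real.pi_pos
  field_simp at h
  linarith

lemma Qk_neg (r u : ℝ) : Qk r (-u) = - Qk r u := by
  unfold Qk
  rw [Real.sin_neg, neg_div, Real.sin_neg]; ring

lemma int_Qk {r : ℝ} : ∫ u in J1, Qk r u = 0 := by
  have h : ∫ u in J1, Qk r u = ∫ u in (-Real.pi)..Real.pi, Qk r u := by
    rw [setIntegral_congr_set J1_ae, intervalIntegral.integral_of_le (by linarith [Real.pi_pos])]
  have h2 := intervalIntegral.integral_comp_neg (a := -Real.pi) (b := Real.pi) (Qk r)
  simp only [Qk_neg, neg_neg, intervalIntegral.integral_neg] at h2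
  rw [h]; linarith

lemma mean_re {h : ℂ → ℂ} (hh : DifferentiableOn ℂ h (Metric.ball 0 1)) {R : ℝ} (h0 : 0 ≤ R) (h1 : R < 1) :
    ∫ u in J1, (h (R * Complex.exp ((u : ℂ) * Complex.I))).re = 2 * Real.pi * (h 0).re := by
  have hm := harm_re hh h0 h1 le_rfl zero_lt_one 0
  simp only [mul_zero, Complex.ofReal_zero, zero_mul, Pk_zero, one_mul, zero_add] at hm
  rw [hm, mul_inv_cancel_left₀]
  have := Real.pi_pos
  positivity

lemma arg_bound {z : ℂ} (hz : 0 < z.re) : |z.im| ≤ z.re + 4 / Real.pi * (z.im * z.arg) := by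
  have hpi := Real.pi_pos
  have hsign : z.im * z.arg = |z.im| * |z.arg| := by
    rw [← abs_mul, abs_of_nonneg]
    rcases le_or_gt 0 z.im with h | h
    · exact mul_nonneg h (Complex.arg_nonneg_iff.2 h)
    · exact mul_nonneg_of_nonpos_of_nonpos h.le (Complex.arg_neg_iff.2 h).le
  rw [hsign]
  rcases le_or_gt |z.im| z.re with h | h
  · have : 0 ≤ 4 / Real.pi * (|z.im| * |z.arg|) := by positivity
    linarith
  · have ha : Real.pi / 4 ≤ |z.arg| := by
      by_contra hlt
      push Not at hlt
      have ht : Real.tan |z.arg| < Real.tan (Real.pi / 4) :=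
        Real.tan_lt_tan_of_lt_of_lt_pi_div_two (by linarith [abs_nonneg z.arg]) (by linarith) hlt
      rw [Real.tan_pi_div_four] at ht
      have h3 : |Real.tan z.arg| = |z.im| / z.re := by
        rw [Complex.tan_arg, abs_div, abs_of_pos hz]
      have h4 : |Real.tan z.arg| ≤ Real.tan |z.arg| := by
        rcases abs_cases z.arg with ⟨e, hs⟩ | ⟨e, hs⟩
        · rw [e, abs_of_nonneg]
          exact Real.tan_nonneg_of_nonneg_of_le_pi_div_two hs (by linarith)
        · rw [e, Real.tan_neg, ← abs_neg, ← Real.tan_neg, abs_of_nonneg]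
          exact Real.tan_nonneg_of_nonneg_of_le_pi_div_two (by linarith) (by linarith)
      have h5 : 1 < |z.im| / z.re := (one_lt_div hz).2 h
      linarith
    have h6 : |z.im| ≤ 4 / Real.pi * (|z.im| * |z.arg|) := by
      have : |z.im| * (Real.pi / 4) ≤ |z.im| * |z.arg| := by gcongr
      calc |z.im| = 4 / Real.pi * (|z.im| * (Real.pi / 4)) := by field_simp
        _ ≤ _ := by gcongr
    linarith

lemma log_bound {z : ℂ} (hz : 1 ≤ z.re) :
    z.re * Real.log ‖z‖ ≤ z.re * Real.log z.re + |z.im| / 4 + z.re := by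
  have h0 : 0 < z.re := by linarith
  have hn : ‖z‖ ≤ z.re + |z.im| := by
    have := Complex.norm_le_abs_re_add_abs_im z
    rwa [abs_of_pos h0] at this
  have hzp : 0 < ‖z‖ := h0.trans_le (Complex.re_le_norm z)
  have h1 : Real.log ‖z‖ ≤ Real.log (z.re + |z.im|) := Real.log_le_log hzp hn
  have e : z.re + |z.im| = 4 * z.re * ((z.re + |z.im|) / (4 * z.re)) := by field_simp
  have h2 : Real.log (z.re + |z.im|) = Real.log 4 + Real.log z.re + Real.log ((z.re + |z.im|) / (4 * z.re)) := by
    rw [← Real.log_mul (by norm_num) h0.ne', ← Real.log_mul (by positivity) (by positivity)]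
    rw [← e]
  have h3 := Real.log_le_sub_one_of_pos (x := (z.re + |z.im|) / (4 * z.re)) (by positivity)
  have h4 : Real.log 4 ≤ 1.4 := by
    rw [show (4:ℝ) = 2 ^ 2 by norm_num, Real.log_pow]
    have := Real.log_two_lt_d9
    push_cast; linarith
  have h5 : Real.log ‖z‖ ≤ Real.log z.re + (z.re + |z.im|) / (4 * z.re) + 0.4 := by linarith
  calc z.re * Real.log ‖z‖ ≤ z.re * (Real.log z.re + (z.re + |z.im|) / (4 * z.re) + 0.4) := by gcongr
    _ = z.re * Real.log z.re + |z.im| / 4 + 0.65 * z.re := by field_simp; ring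
    _ ≤ _ := by linarith

lemma tangent {a b : ℝ} (ha : 0 < a) (hb : 0 < b) :
    a * Real.log a + (Real.log a + 1) * (b - a) ≤ b * Real.log b := by
  have h := Real.log_le_sub_one_of_pos (x := a / b) (by positivity)
  rw [Real.log_div ha.ne' hb.ne'] at h
  have h2 : b * (Real.log a - Real.log b) ≤ b * (a / b - 1) := by gcongr
  have e : b * (a / b - 1) = a - b := by field_simp
  rw [e] at h2
  nlinarith

lemma logPlus_nonneg (u : ℝ) : 0 ≤ logPlus u := by
  unfold logPlus; split_ifs with h
  · exact Real.log_nonneg h.le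
  · exact le_rfl

lemma le_logPlus {t : ℝ} (ht : 0 ≤ t) : t ≤ 3 + t * logPlus t := by
  rcases le_or_gt t 3 with h | h
  · have := mul_nonneg ht (logPlus_nonneg t); linarith
  · have : 1 ≤ logPlus t := by
      unfold logPlus
      rw [if_pos (by linarith), Real.le_log_iff_exp_le (by linarith)]
      linarith [Real.exp_one_lt_d9]
    nlinarith

lemma wlogw {t : ℝ} (ht : 0 ≤ t) : (1 + t) * Real.log (1 + t) ≤ 6 + 4 * (t * logPlus t) := by
  have hl2 := Real.log_two_lt_d9
  rcases le_or_gt t 1 with h | h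
  · have h1 : Real.log (1 + t) ≤ Real.log 2 := Real.log_le_log (by linarith) (by linarith)
    have h0 : 0 ≤ Real.log (1 + t) := Real.log_nonneg (by linarith)
    have := mul_nonneg ht (logPlus_nonneg t)
    nlinarith
  · have h1 : Real.log (1 + t) ≤ Real.log 2 + Real.log t := by
      rw [← Real.log_mul (by norm_num) (by linarith)]
      exact Real.log_le_log (by linarith) (by linarith)
    have h0 : 0 ≤ Real.log (1 + t) := Real.log_nonneg (by linarith)
    have h3 := le_logPlus ht
    have h4 : logPlus t = Real.log t := if_pos h
    have h5 : 0 ≤ Real.log t := Real.log_nonneg h.le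
    calc (1 + t) * Real.log (1 + t) ≤ (2 * t) * (1 + Real.log t) := by gcongr <;> linarith
      _ ≤ _ := by rw [h4] at h3 ⊢; nlinarith

lemma meas_logPlus : Measurable logPlus :=
  Measurable.ite measurableSet_Ioi Real.measurable_log measurable_const

lemma llogl {φ : ℝ → ℝ} (h : PerInt φ) (hp : ∀ x, 0 ≤ φ x) (hL : IntegrableOn (fun u => φ u * logPlus (φ u)) J1)
    {r : ℝ} (h0 : 0 ≤ r) (h1 : r < 1) :
    ∫⁻ x in J1, ‖∫ u in J1, Qk r u * φ (x + u)‖ₑ ≤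
      ENNReal.ofReal (1000 * (1 + ∫ u in J1, φ u * logPlus (φ u))) := by
  have hpi := Real.pi_pos
  have hpi3 := Real.pi_gt_three
  have hpi4 := Real.pi_lt_four
  set w : ℝ → ℝ := fun u => 1 + φ u with hw
  have hwP : PerInt w := ⟨measurable_const.add h.meas, fun x => by simp only [hw, h.per x],
    (cont_int_J1 continuous_const).add h.int⟩
  set g : ℝ → ℝ := fun u => w u * Real.log (w u) with hg
  have hw1 : ∀ u, 1 ≤ w u := fun u => by simp only [hw]; linarith [hp u]
  have hg0 : ∀ u, 0 ≤ g u := fun u => mul_nonneg (by linarith [hw1 u]) (Real.log_nonneg (hw1 u))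
  have hbI : IntegrableOn (fun u => 6 + 4 * (φ u * logPlus (φ u))) J1 :=
    (cont_int_J1 continuous_const).add (hL.const_mul 4)
  have hgm : Measurable g := hwP.meas.mul (Real.measurable_log.comp hwP.meas)
  have hgP : PerInt g := by
    refine ⟨hgm, fun x => by simp only [hg, hwP.per x], ?_⟩
    refine hbI.mono' hgm.aestronglyMeasurable (ae_of_all _ fun u => ?_)
    rw [Real.norm_eq_abs, abs_of_nonneg (hg0 u)]
    exact wlogw (hp u)
  set F := FH w with hF
  set P : ℝ → ℂ := fun x => F (r * Complex.exp (x * Complex.I)) with hP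
  have hU : ∀ z ∈ Metric.ball (0:ℂ) 1, 1 ≤ (F z).re := by
    intro z hz
    obtain ⟨s, x, s0, s1, rfl⟩ := polar_ex hz
    rw [hF, FH_re hwP s0 s1]
    have : 2 * Real.pi ≤ ∫ u in J1, Pk s u * w (x + u) := by
      rw [← int_Pk s0 s1]
      apply setIntegral_mono_on (cont_int_J1 (Pk_cont s0 s1)) (int_mul_J1 (Pk_cont s0 s1) (hwP.shift x)) J1_meas
      intro u _
      nlinarith [hw1 (x + u), Pk_nonneg (u := u) s0 s1]
    rw [inv_mul_eq_div, one_le_div (by positivity)]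
    exact this
  have hFd : DifferentiableOn ℂ F (Metric.ball 0 1) := FH_diff hwP
  have hslit : ∀ z ∈ Metric.ball (0:ℂ) 1, F z ∈ Complex.slitPlane := fun z hz =>
    Or.inl (by linarith [hU z hz])
  set G : ℂ → ℂ := fun z => F z * Complex.log (F z) with hG
  have hGd : DifferentiableOn ℂ G (Metric.ball 0 1) := hFd.mul (hFd.clog hslit)
  have hPc : Continuous P := circ_cont hFd h0 h1
  have hP1 : ∀ x, 1 ≤ (P x).re := fun x => hU _ (polar_mem h0 h1 x)
  have hPs : ∀ x, P x ∈ Complex.slitPlane := fun x => hslit _ (polar_mem h0 h1 x)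
  have cU : Continuous fun x => (P x).re := Complex.continuous_re.comp hPc
  have cV : Continuous fun x => (P x).im := Complex.continuous_im.comp hPc
  have cL : Continuous fun x => Complex.log (P x) := hPc.clog hPs
  have cA : Continuous fun x => (P x).arg := by
    have := Complex.continuous_im.comp cL
    simpa [Function.comp_def, Complex.log_im] using this
  have cN : Continuous fun x => Real.log ‖P x‖ := by
    have := Complex.continuous_re.comp cL
    simpa [Function.comp_def, Complex.log_re] using this
  have cUL : Continuous fun x => Real.log (P x).re := cU.log (fun x => by linarith [hP1 x])
  have iU : IntegrableOn (fun x => (P x).re) J1 := cont_int_J1 cU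
  have iV : IntegrableOn (fun x => |(P x).im|) J1 := cont_int_J1 cV.abs
  have iVA : IntegrableOn (fun x => (P x).im * (P x).arg) J1 := cont_int_J1 (cV.mul cA)
  have iUN : IntegrableOn (fun x => (P x).re * Real.log ‖P x‖) J1 := cont_int_J1 (cU.mul cN)
  have iUL : IntegrableOn (fun x => (P x).re * Real.log (P x).re) J1 := cont_int_J1 (cU.mul cUL)
  have hmean : 0 ≤ ∫ x in J1, ((P x).re * Real.log ‖P x‖ - (P x).im * (P x).arg) := by
    have hm := mean_re hGd h0 h1
    have e : ∀ x : ℝ, (G (r * Complex.exp (x * Complex.I))).re =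
        (P x).re * Real.log ‖P x‖ - (P x).im * (P x).arg := by
      intro x
      simp only [hG, Complex.mul_re, Complex.log_re, Complex.log_im, hP]
    simp only [e] at hm
    rw [hm]
    have hz := hU 0 (Metric.mem_ball_self one_pos)
    simp only [hG, hF, FH_zero hwP] at hz ⊢
    rw [Complex.ofReal_re] at hz
    rw [← Complex.ofReal_log (by linarith), ← Complex.ofReal_mul, Complex.ofReal_re]
    have := Real.log_nonneg hz
    positivity
  have hUint : ∫ x in J1, (P x).re = ∫ x in J1, w x := by
    rw [mean_re hFd h0 h1, hF, FH_zero hwP, Complex.ofReal_re]; field_simp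
  have hGint : ∫ x in J1, (FH g (r * Complex.exp (x * Complex.I))).re = ∫ x in J1, g x := by
    rw [mean_re (FH_diff hgP) h0 h1, FH_zero hgP, Complex.ofReal_re]; field_simp
  have hJensen : ∀ x, (P x).re * Real.log (P x).re ≤ (FH g (r * Complex.exp (x * Complex.I))).re := by
    intro x
    set a := (P x).re with ha
    have ha0 : 0 < a := by linarith [hP1 x]
    have ha2 : a = (2 * Real.pi)⁻¹ * ∫ u in J1, Pk r u * w (x + u) := FH_re hwP h0 h1 x
    rw [FH_re hgP h0 h1]
    have i1 := int_mul_J1 (Pk_cont h0 h1) (hwP.shift x)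
    have i2 := int_mul_J1 (Pk_cont h0 h1) (hgP.shift x)
    have i3 := cont_int_J1 (Pk_cont h0 h1)
    have hle : ∫ u in J1, ((a * Real.log a - (Real.log a + 1) * a) * Pk r u + (Real.log a + 1) * (Pk r u * w (x + u))) ≤
        ∫ u in J1, Pk r u * g (x + u) := by
      apply setIntegral_mono_on ((i3.const_mul _).add (i1.const_mul _)) i2 J1_meas
      intro u _
      have ht := tangent ha0 (b := w (x + u)) (by linarith [hw1 (x + u)])
      have := mul_le_mul_of_nonneg_left ht (Pk_nonneg (u := u) h0 h1)
      simp only [hg, Pi.add_apply]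
      linarith
    rw [integral_add (i3.const_mul _) (i1.const_mul _), integral_const_mul, integral_const_mul, int_Pk h0 h1] at hle
    have e : ∫ u in J1, Pk r u * w (x + u) = 2 * Real.pi * a := by rw [ha2]; field_simp
    rw [e] at hle
    rw [inv_mul_eq_div, le_div_iff₀ (by positivity)]
    linarith
  have hULint : ∫ x in J1, (P x).re * Real.log (P x).re ≤ ∫ x in J1, g x := by
    rw [← hGint]
    exact setIntegral_mono_on iUL (cont_int_J1 (Complex.continuous_re.comp (circ_cont (FH_diff hgP) h0 h1)))
      J1_meas (fun x _ => hJensen x)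
  have hV1 : ∫ x in J1, |(P x).im| ≤ (∫ x in J1, (P x).re) + 4 / Real.pi * ∫ x in J1, (P x).im * (P x).arg := by
    rw [← integral_const_mul, ← integral_add iU (iVA.const_mul _)]
    exact setIntegral_mono_on iV (iU.add (iVA.const_mul _))
      J1_meas (fun x _ => arg_bound (by linarith [hP1 x]))
  have hV2 : ∫ x in J1, (P x).im * (P x).arg ≤ ∫ x in J1, (P x).re * Real.log ‖P x‖ := by
    rw [integral_sub iUN iVA] at hmean
    linarith
  have hV3 : ∫ x in J1, (P x).re * Real.log ‖P x‖ ≤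
      (∫ x in J1, (P x).re * Real.log (P x).re) + (∫ x in J1, |(P x).im|) / 4 + ∫ x in J1, (P x).re := by
    have i4 : IntegrableOn (fun x => (P x).re * Real.log (P x).re + |(P x).im| / 4) J1 := iUL.add (iV.div_const _)
    rw [← integral_div, ← integral_add iUL (iV.div_const _), ← integral_add i4 iU]
    exact setIntegral_mono_on iUN
      ((iUL.add (iV.div_const _)).add iU)
      J1_meas (fun x _ => log_bound (hP1 x))
  set L := ∫ u in J1, φ u * logPlus (φ u) with hLdef
  have hL0 : 0 ≤ L := setIntegral_nonneg J1_meas fun u _ => mul_nonneg (hp u) (logPlus_nonneg _)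
  have hwint : ∫ x in J1, w x ≤ 4 * (2 * Real.pi) + L := by
    have : ∫ x in J1, w x ≤ ∫ x in J1, (4 + φ x * logPlus (φ x)) :=
      setIntegral_mono_on hwP.int ((cont_int_J1 continuous_const).add hL) J1_meas
        (fun x _ => by have := le_logPlus (hp x); simp only [hw]; linarith)
    rw [integral_add (cont_int_J1 continuous_const) hL, setIntegral_const, vol_J1, smul_eq_mul] at this
    linarith
  have hgint : ∫ x in J1, g x ≤ 6 * (2 * Real.pi) + 4 * L := by
    have : ∫ x in J1, g x ≤ ∫ x in J1, (6 + 4 * (φ x * logPlus (φ x))) :=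
      setIntegral_mono_on hgP.int hbI J1_meas (fun x _ => wlogw (hp x))
    rw [integral_add (cont_int_J1 continuous_const) (hL.const_mul 4), setIntegral_const, vol_J1, smul_eq_mul, integral_const_mul] at this
    linarith
  have hfin : ∫ x in J1, |(P x).im| ≤ 250 * (1 + L) := by
    set A := ∫ x in J1, |(P x).im|
    set B := ∫ x in J1, (P x).im * (P x).arg
    set D := ∫ x in J1, (P x).re * Real.log ‖P x‖
    have hA0 : 0 ≤ A := setIntegral_nonneg J1_meas fun u _ => abs_nonneg _
    have hU0 : 0 ≤ ∫ x in J1, (P x).re := setIntegral_nonneg J1_meas fun u _ => by linarith [hP1 u]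
    have hUL0 : 0 ≤ ∫ x in J1, (P x).re * Real.log (P x).re :=
      setIntegral_nonneg J1_meas fun u _ => mul_nonneg (by linarith [hP1 u]) (Real.log_nonneg (hP1 u))
    have k1 : 4 / Real.pi * B ≤ 4 / 3 * ((∫ x in J1, (P x).re * Real.log (P x).re) + A / 4 + ∫ x in J1, (P x).re) := by
      calc 4 / Real.pi * B ≤ 4 / Real.pi * ((∫ x in J1, (P x).re * Real.log (P x).re) + A / 4 + ∫ x in J1, (P x).re) := by
            gcongr; linarith
        _ ≤ _ := by gcongr
    linarith
  have eV : ∀ x, ∫ u in J1, Qk r u * φ (x + u) = -Real.pi * (P x).im := by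
    intro x
    have e1 : (P x).im = _ := FH_im hwP h0 h1 x
    have e2 : ∫ u in J1, Qk r u * w (x + u) = ∫ u in J1, Qk r u * φ (x + u) := by
      have : ∀ u, Qk r u * w (x + u) = Qk r u + Qk r u * φ (x + u) := fun u => by simp only [hw]; ring
      simp only [this]
      rw [integral_add (cont_int_J1 (Qk_cont h0 h1)) (int_mul_J1 (Qk_cont h0 h1) (h.shift x)), int_Qk, zero_add]
    rw [e1, e2]; field_simp
  simp only [eV]
  have e3 : ∫⁻ x in J1, ‖-Real.pi * (P x).im‖ₑ = ENNReal.ofReal (∫ x in J1, Real.pi * |(P x).im|) := by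
    rw [ofReal_integral_eq_lintegral_ofReal (iV.const_mul _) (ae_of_all _ fun x => by positivity)]
    congr 1; ext x
    rw [Real.enorm_eq_ofReal_abs, abs_mul, abs_neg, abs_of_pos hpi]
  rw [e3, integral_const_mul]
  apply ENNReal.ofReal_le_ofReal
  have hA0 : 0 ≤ ∫ x in J1, |(P x).im| := setIntegral_nonneg J1_meas fun u _ => abs_nonneg _
  nlinarith
end

set_option linter.all false
open MeasureTheory Filter Set
open scoped ENNReal
noncomputable section

def Dk (n : ℕ) (t : ℝ) : ℂ := ∑ p ∈ Finset.range n, Complex.exp (((p : ℝ) * t : ℝ) * Complex.I)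

lemma Dk_norm_le (n : ℕ) (t : ℝ) : ‖Dk n t‖ ≤ n := by
  refine (norm_sum_le _ _).trans ?_
  simp only [Complex.norm_exp_ofReal_mul_I]
  simp

lemma Dk_mul (n : ℕ) (t : ℝ) : Dk n t * (Complex.exp (t * Complex.I) - 1) = Complex.exp (((n : ℝ) * t : ℝ) * Complex.I) - 1 := by
  unfold Dk
  have e : ∀ p : ℕ, Complex.exp (((p : ℝ) * t : ℝ) * Complex.I) = Complex.exp (t * Complex.I) ^ p := by
    intro p
    rw [← Complex.exp_nat_mul]; congr 1; push_cast; ring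
  simp only [e]
  exact geom_sum_mul _ _

lemma exp_sub_one_norm (t : ℝ) : ‖Complex.exp (t * Complex.I) - 1‖ ^ 2 = 4 * Real.sin (t / 2) ^ 2 := by
  rw [Complex.sq_norm, Complex.normSq_apply, Complex.exp_mul_I]
  simp [Complex.cos_ofReal_re, Complex.sin_ofReal_re]
  have h1 := Real.sin_sq_add_cos_sq t
  have h2 : Real.sin (t / 2) ^ 2 = (1 - Real.cos t) / 2 := by
    rw [Real.sin_sq_eq_half_sub]; ring_nf
  rw [h2]
  nlinarith

lemma Dk_bound {m : ℕ} (hm : 1 ≤ m) {t : ℝ} (ht : |t| ≤ Real.pi) :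
    ‖Dk (2 * m) t‖ ^ 2 ≤ 20 / ((1 / (m : ℝ)) ^ 2 + t ^ 2) := by
  have hm0 : (0:ℝ) < m := by exact_mod_cast hm
  have h1 : ‖Dk (2 * m) t‖ ^ 2 ≤ 4 * (m:ℝ) ^ 2 := by
    have := Dk_norm_le (2 * m) t
    push_cast at this
    nlinarith [norm_nonneg (Dk (2 * m) t)]
  have h2 : ‖Dk (2 * m) t‖ ^ 2 * t ^ 2 ≤ 10 := by
    have hA := congrArg norm (Dk_mul (2 * m) t)
    rw [norm_mul] at hA
    have hB : ‖Complex.exp (((((2 * m : ℕ) : ℝ) * t : ℝ) : ℂ) * Complex.I) - 1‖ ≤ 2 := by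
      refine (norm_sub_le _ _).trans ?_
      rw [Complex.norm_exp_ofReal_mul_I]; norm_num
    have hC : (‖Dk (2 * m) t‖ * ‖Complex.exp (t * Complex.I) - 1‖) ^ 2 ≤ 2 ^ 2 := by
      rw [hA]; gcongr
    rw [mul_pow, exp_sub_one_norm] at hC
    have hD := sin_half_sq_ge ht
    nlinarith [sq_nonneg ‖Dk (2 * m) t‖]
  rw [le_div_iff₀ (by positivity), mul_add]
  have h3 : ‖Dk (2 * m) t‖ ^ 2 * (1 / (m:ℝ)) ^ 2 ≤ 4 := by
    rw [div_pow, one_pow, mul_one_div, div_le_iff₀ (by positivity)]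
    exact h1
  linarith

def zf (Φ : ℝ → ℝ) (y : ℝ) : ℂ := ∫ u, Complex.exp ((y * u : ℝ) * Complex.I) * (Φ u : ℂ)

lemma zf_sq {Φ : ℝ → ℝ} (y : ℝ) :
    ((‖zf Φ y‖ ^ 2 : ℝ) : ℂ) = ∫ w : ℝ × ℝ, Complex.exp ((y * (w.1 - w.2) : ℝ) * Complex.I) * (Φ w.1 : ℂ) * (Φ w.2 : ℂ) := by
  have h1 : ((‖zf Φ y‖ ^ 2 : ℝ) : ℂ) = zf Φ y * (starRingEnd ℂ) (zf Φ y) := by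
    rw [Complex.mul_conj, Complex.normSq_eq_norm_sq]
  rw [h1]
  unfold zf
  rw [← integral_conj, ← integral_prod_mul]
  congr 1
  ext w
  rw [map_mul, Complex.conj_ofReal, ← Complex.exp_conj, map_mul, Complex.conj_ofReal, Complex.conj_I]
  have : Complex.exp ((y * (w.1 - w.2) : ℝ) * Complex.I) = Complex.exp ((y * w.1 : ℝ) * Complex.I) *
      Complex.exp ((y * w.2 : ℝ) * -Complex.I) := by
    rw [← Complex.exp_add]; congr 1; push_cast; ring
  rw [this]; ring

lemma zf_integrable {Φ : ℝ → ℝ} (hΦ : Integrable Φ) (y : ℝ) :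
    Integrable (fun w : ℝ × ℝ => Complex.exp ((y * (w.1 - w.2) : ℝ) * Complex.I) * (Φ w.1 : ℂ) * (Φ w.2 : ℂ)) := by
  have h := (hΦ.ofReal (𝕜 := ℂ)).mul_prod (hΦ.ofReal (𝕜 := ℂ))
  have h2 := Integrable.bdd_mul (c := 1) h (f := fun w : ℝ × ℝ => Complex.exp ((y * (w.1 - w.2) : ℝ) * Complex.I))
    (by apply Continuous.aestronglyMeasurable; fun_prop) (ae_of_all _ fun w => by rw [Complex.norm_exp_ofReal_mul_I])
  refine h2.congr (ae_of_all _ fun w => ?_)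
  simp [mul_assoc]

lemma zf_count {Φ : ℝ → ℝ} (c : ℝ) (m : ℕ) :
    (m : ℝ) * ∑ d ∈ Finset.range m, ‖zf Φ (c + d)‖ ^ 2 ≤
      ∑ p ∈ Finset.range (2 * m), ∑ q ∈ Finset.range (2 * m), ‖zf Φ (c + p - q)‖ ^ 2 := by
  rw [← Finset.sum_product']
  have e : (m : ℝ) * ∑ d ∈ Finset.range m, ‖zf Φ (c + d)‖ ^ 2 =
      ∑ w ∈ Finset.range m ×ˢ Finset.range m, ‖zf Φ (c + w.2)‖ ^ 2 := by
    rw [Finset.sum_product]; simp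
  rw [e]
  have e2 : ∑ w ∈ Finset.range m ×ˢ Finset.range m, ‖zf Φ (c + w.2)‖ ^ 2 =
      ∑ w ∈ (Finset.range m ×ˢ Finset.range m).image (fun w => (w.1 + w.2, w.1)), ‖zf Φ (c + w.1 - w.2)‖ ^ 2 := by
    rw [Finset.sum_image]
    · apply Finset.sum_congr rfl
      intro w _
      congr 3; push_cast; ring
    · intro a _ b _ hab
      simp only [Prod.mk.injEq] at hab
      ext <;> omega
  rw [e2]
  apply Finset.sum_le_sum_of_subset_of_nonneg
  · intro w hw
    simp only [Finset.mem_image, Finset.mem_product, Finset.mem_range] at hw ⊢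
    obtain ⟨a, ha, rfl⟩ := hw
    simp only
    omega
  · intro w _ _; positivity

lemma zf_fejer {Φ : ℝ → ℝ} (hΦ : Integrable Φ) (hs : ∀ u v, Φ u ≠ 0 → Φ v ≠ 0 → |u - v| ≤ Real.pi)
    (c : ℝ) {m : ℕ} (hm : 1 ≤ m) :
    ENNReal.ofReal ((m : ℝ) * ∑ d ∈ Finset.range m, ‖zf Φ (c + d)‖ ^ 2) ≤
      ∫⁻ w : ℝ × ℝ, ‖Φ w.1‖ₑ * ‖Φ w.2‖ₑ * ENNReal.ofReal (20 / ((1 / (m : ℝ)) ^ 2 + (w.1 - w.2) ^ 2)) := by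
  refine (ENNReal.ofReal_le_ofReal (zf_count c m)).trans ?_
  set S : ℝ := ∑ p ∈ Finset.range (2 * m), ∑ q ∈ Finset.range (2 * m), ‖zf Φ (c + p - q)‖ ^ 2 with hS
  have hS0 : 0 ≤ S := by positivity
  have h1 : (S : ℂ) = ∫ w : ℝ × ℝ, Complex.exp ((c * (w.1 - w.2) : ℝ) * Complex.I) *
      (Dk (2 * m) (w.1 - w.2) * (starRingEnd ℂ) (Dk (2 * m) (w.1 - w.2))) * (Φ w.1 : ℂ) * (Φ w.2 : ℂ) := by
    rw [hS]
    simp only [Complex.ofReal_sum, zf_sq]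
    have e1 : ∀ p ∈ Finset.range (2 * m), ∑ q ∈ Finset.range (2 * m),
        ∫ w : ℝ × ℝ, Complex.exp (((c + p - q) * (w.1 - w.2) : ℝ) * Complex.I) * (Φ w.1 : ℂ) * (Φ w.2 : ℂ) =
        ∫ w : ℝ × ℝ, ∑ q ∈ Finset.range (2 * m), Complex.exp (((c + p - q) * (w.1 - w.2) : ℝ) * Complex.I) * (Φ w.1 : ℂ) * (Φ w.2 : ℂ) := by
      intro p _
      rw [integral_finsetSum]
      intro q _; exact zf_integrable hΦ _
    rw [Finset.sum_congr rfl e1, ← integral_finsetSum]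
    swap
    · intro p _
      exact integrable_finsetSum _ fun q _ => zf_integrable hΦ _
    congr 1
    ext w
    simp only [Dk, map_sum, Finset.sum_mul_sum, Finset.mul_sum, Finset.sum_mul]
    rw [Finset.sum_comm]
    refine Finset.sum_congr rfl fun p _ => Finset.sum_congr rfl fun q _ => ?_
    congr 2
    rw [← Complex.exp_conj, map_mul, Complex.conj_ofReal, Complex.conj_I, ← Complex.exp_add, ← Complex.exp_add]
    congr 1; push_cast; ring
  have h2 : ENNReal.ofReal S = ‖(S : ℂ)‖ₑ := by
    rw [← ofReal_norm_eq_enorm, Complex.norm_real, Real.norm_eq_abs, abs_of_nonneg hS0]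
  rw [h2, h1]
  refine (enorm_integral_le_lintegral_enorm _).trans (lintegral_mono fun w => ?_)
  simp only [enorm_mul]
  by_cases hz1 : Φ w.1 = 0
  · simp [hz1]
  by_cases hz2 : Φ w.2 = 0
  · simp [hz2]
  have hb := Dk_bound hm (hs _ _ hz1 hz2)
  have e1 : ‖Complex.exp ((c * (w.1 - w.2) : ℝ) * Complex.I)‖ₑ = 1 := by
    rw [← ofReal_norm_eq_enorm, Complex.norm_exp_ofReal_mul_I, ENNReal.ofReal_one]
  have e2 : ‖Dk (2 * m) (w.1 - w.2)‖ₑ * ‖(starRingEnd ℂ) (Dk (2 * m) (w.1 - w.2))‖ₑ =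
      ENNReal.ofReal (‖Dk (2 * m) (w.1 - w.2)‖ ^ 2) := by
    rw [← ofReal_norm_eq_enorm, ← ofReal_norm_eq_enorm, RCLike.norm_conj, ← ENNReal.ofReal_mul (norm_nonneg _), sq]
  have e3 : ∀ t : ℝ, ‖(t : ℂ)‖ₑ = ‖t‖ₑ := fun t => by
    rw [← ofReal_norm_eq_enorm, ← ofReal_norm_eq_enorm, Complex.norm_real]
  rw [e1, e2, e3, e3, one_mul, mul_assoc, mul_comm]
  gcongr
end

set_option linter.all false
open MeasureTheory Filter Set
open scoped ENNReal
noncomputable section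

def Rm (γ : ℝ → ℝ≥0∞) (Ω : Set ℝ) (x : ℝ) : ℝ≥0∞ :=
  ∫⁻ s, γ s * ENNReal.ofReal (Metric.infDist s Ωᶜ / (Metric.infDist s Ωᶜ ^ 2 + (s - x) ^ 2))

lemma pois_one {a : ℝ} (ha : 0 < a) (x : ℝ) : ∫⁻ t, ENNReal.ofReal (a / (a ^ 2 + (t - x) ^ 2)) ≤ 16 := by
  have h := poisson_avg_le (γ := fun _ => 1) (lam := 1) (x := x) measurable_const zero_le_one (fun r hr => by
    rw [setLIntegral_const, one_mul, Real.volume_ball, mul_one]) ha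
  simpa using h

lemma Rm_integral {γ : ℝ → ℝ≥0∞} (hγ : Measurable γ) (Ω : Set ℝ) : ∫⁻ x, Rm γ Ω x ≤ 16 * ∫⁻ s, γ s := by
  unfold Rm
  have hc : Continuous fun s => Metric.infDist s Ωᶜ := Metric.continuous_infDist_pt _
  rw [lintegral_lintegral_swap]
  · have : ∀ s, ∫⁻ x, γ s * ENNReal.ofReal (Metric.infDist s Ωᶜ / (Metric.infDist s Ωᶜ ^ 2 + (s - x) ^ 2)) ≤ 16 * γ s := by
      intro s
      rw [lintegral_const_mul _ (by fun_prop), mul_comm]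
      gcongr
      rcases (Metric.infDist_nonneg (x := s) (s := Ωᶜ)).eq_or_lt with h | h
      · simp [← h]
      · have := pois_one h s
        refine le_trans (le_of_eq ?_) this
        congr 1; ext t; congr 3; ring
    exact (lintegral_mono this).trans (lintegral_const_mul _ hγ).le
  · apply Measurable.aemeasurable
    have h1 : Measurable fun w : ℝ × ℝ => Metric.infDist w.2 Ωᶜ := hc.measurable.comp measurable_snd
    exact (hγ.comp measurable_snd).mul
      (h1.div ((h1.pow_const 2).add ((measurable_snd.sub measurable_fst).pow_const 2))).ennreal_ofReal

lemma inner_bound {γ : ℝ → ℝ≥0∞} {Ω : Set ℝ} (hΩ : IsOpen Ω) (hne : Ωᶜ.Nonempty) {lam : ℝ} (hlam : 0 ≤ lam)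
    (hgood : ∀ x ∈ Ωᶜ, GoodP γ lam x) {a : ℝ} (ha : 0 < a) (s : ℝ) :
    ∫⁻ t, γ t * ENNReal.ofReal (a ^ 2 / (a ^ 2 + (s - t) ^ 2)) ≤
      ENNReal.ofReal (48 * lam * (a + Metric.infDist s Ωᶜ)) := by
  obtain ⟨s0, hs0, hd⟩ := hΩ.isClosed_compl.exists_infDist_eq_dist hne s
  have hδ := Metric.infDist_nonneg (x := s) (s := Ωᶜ)
  set δ := Metric.infDist s Ωᶜ
  rw [Real.dist_eq] at hd
  set b := a + δ with hb
  have hb0 : 0 < b := by positivity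
  have hk : ∀ t, ENNReal.ofReal (a ^ 2 / (a ^ 2 + (s - t) ^ 2)) ≤
      ENNReal.ofReal (3 * b) * ENNReal.ofReal (b / (b ^ 2 + (t - s0) ^ 2)) := by
    intro t
    rw [← ENNReal.ofReal_mul (by positivity)]
    apply ENNReal.ofReal_le_ofReal
    rw [← mul_div_assoc, div_le_div_iff₀ (by positivity) (by positivity)]
    have h1 : (t - s0) ^ 2 ≤ 2 * (s - t) ^ 2 + 2 * δ ^ 2 := by
      rw [hd, sq_abs]; nlinarith [sq_nonneg (s - t + (s - s0))]
    have h2 : a ^ 2 ≤ b ^ 2 := by gcongr; linarith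
    have h3 : δ ^ 2 ≤ b ^ 2 := by gcongr; linarith
    have h4 : a ^ 2 * (t - s0) ^ 2 ≤ a ^ 2 * (2 * (s - t) ^ 2 + 2 * δ ^ 2) := by gcongr
    have h5 : a ^ 2 * δ ^ 2 ≤ a ^ 2 * b ^ 2 := by gcongr
    have h6 : a ^ 2 * (s - t) ^ 2 ≤ b ^ 2 * (s - t) ^ 2 := by gcongr
    nlinarith [sq_nonneg (b * (s - t))]
  calc _ ≤ ∫⁻ t, ENNReal.ofReal (3 * b) * (γ t * ENNReal.ofReal (b / (b ^ 2 + (t - s0) ^ 2))) := by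
        apply lintegral_mono; intro t
        calc _ ≤ γ t * (ENNReal.ofReal (3 * b) * ENNReal.ofReal (b / (b ^ 2 + (t - s0) ^ 2))) := mul_le_mul' le_rfl (hk t)
          _ = _ := by ring
    _ = ENNReal.ofReal (3 * b) * ∫⁻ t, (γ t * ENNReal.ofReal (b / (b ^ 2 + (t - s0) ^ 2))) :=
        lintegral_const_mul' _ _ ENNReal.ofReal_ne_top
    _ ≤ ENNReal.ofReal (3 * b) * ENNReal.ofReal (16 * lam) := by gcongr; exact hgood s0 hs0 b hb0
    _ = _ := by rw [← ENNReal.ofReal_mul (by positivity)]; congr 1; ring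

lemma outer_bound {γ : ℝ → ℝ≥0∞} (hγ : Measurable γ) {Ω : Set ℝ} (hΩ : IsOpen Ω) {lam : ℝ} (hlam : 0 ≤ lam)
    (hgood : ∀ x ∈ Ωᶜ, GoodP γ lam x) {a : ℝ} (ha : 0 < a) {x : ℝ} (hx : x ∈ Ωᶜ) {Φ : ℝ → ℝ}
    (h0 : ∀ u, |u| ≤ a → Φ u = 0) (h1 : ∀ u, a < |u| → ‖Φ u‖ₑ ≤ γ (x + u) * ENNReal.ofReal (1 / |u|)) :
    ∫⁻ w : ℝ × ℝ, ‖Φ w.1‖ₑ * ‖Φ w.2‖ₑ * ENNReal.ofReal (20 / (a ^ 2 + (w.1 - w.2) ^ 2)) ≤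
      ENNReal.ofReal (3840 * lam / a ^ 2) * (ENNReal.ofReal (16 * lam) + Rm γ Ω x) := by
  set G : ℝ → ℝ≥0∞ := fun u => if a < |u| then γ (x + u) else 0 with hG
  have hGm : Measurable G := Measurable.ite (measurableSet_lt measurable_const measurable_id.abs)
    (hγ.comp (measurable_const.add measurable_id)) measurable_const
  set T : ℝ × ℝ → ℝ≥0∞ := fun w => G w.1 * ENNReal.ofReal (1 / w.1 ^ 2) *
    (G w.2 * ENNReal.ofReal (20 / (a ^ 2 + (w.1 - w.2) ^ 2))) with hT
  have hTm : Measurable T := by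
    apply Measurable.mul
    · exact (hGm.comp measurable_fst).mul (by fun_prop)
    · exact (hGm.comp measurable_snd).mul (by fun_prop)
  have hpt : ∀ w : ℝ × ℝ, ‖Φ w.1‖ₑ * ‖Φ w.2‖ₑ * ENNReal.ofReal (20 / (a ^ 2 + (w.1 - w.2) ^ 2)) ≤ T w + T w.swap := by
    rintro ⟨u, v⟩
    simp only [hT, hG, Prod.swap]
    rcases le_or_gt |u| a with hu | hu
    · simp [h0 u hu]
    rcases le_or_gt |v| a with hv | hv
    · simp [h0 v hv]
    rw [if_pos hu, if_pos hv]
    have hu0 : 0 < |u| := ha.trans hu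
    have hv0 : 0 < |v| := ha.trans hv
    have hk : ENNReal.ofReal (1 / |u|) * ENNReal.ofReal (1 / |v|) ≤ ENNReal.ofReal (1 / u ^ 2) + ENNReal.ofReal (1 / v ^ 2) := by
      rw [← ENNReal.ofReal_mul (by positivity), ← ENNReal.ofReal_add (by positivity) (by positivity)]
      apply ENNReal.ofReal_le_ofReal
      rw [← sq_abs u, ← sq_abs v]
      have e1 : 1 / |u| ^ 2 = (1 / |u|) ^ 2 := by rw [div_pow, one_pow]
      have e2 : 1 / |v| ^ 2 = (1 / |v|) ^ 2 := by rw [div_pow, one_pow]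
      rw [e1, e2]
      nlinarith [sq_nonneg (1 / |u| - 1 / |v|), sq_nonneg (1 / |u|), sq_nonneg (1 / |v|)]
    have e : (v - u) ^ 2 = (u - v) ^ 2 := by ring
    rw [e]
    calc _ ≤ γ (x + u) * ENNReal.ofReal (1 / |u|) * (γ (x + v) * ENNReal.ofReal (1 / |v|)) *
          ENNReal.ofReal (20 / (a ^ 2 + (u - v) ^ 2)) := by gcongr; exacts [h1 u hu, h1 v hv]
      _ = γ (x + u) * γ (x + v) * ENNReal.ofReal (20 / (a ^ 2 + (u - v) ^ 2)) *
          (ENNReal.ofReal (1 / |u|) * ENNReal.ofReal (1 / |v|)) := by ring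
      _ ≤ γ (x + u) * γ (x + v) * ENNReal.ofReal (20 / (a ^ 2 + (u - v) ^ 2)) *
          (ENNReal.ofReal (1 / u ^ 2) + ENNReal.ofReal (1 / v ^ 2)) := by gcongr
      _ = _ := by ring
  have hTi : ∫⁻ w, T w ≤ ENNReal.ofReal (1920 * lam / a ^ 2) * (ENNReal.ofReal (16 * lam) + Rm γ Ω x) := by
    have hv : (volume : Measure (ℝ × ℝ)) = volume.prod volume := rfl
    rw [hv, lintegral_prod _ hTm.aemeasurable]
    have hin : ∀ u, ∫⁻ v, T (u, v) ≤ ENNReal.ofReal (1920 * lam / a ^ 2) *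
        (γ (x + u) * ENNReal.ofReal (a / (a ^ 2 + ((x + u) - x) ^ 2)) + γ (x + u) *
          ENNReal.ofReal (Metric.infDist (x + u) Ωᶜ / (Metric.infDist (x + u) Ωᶜ ^ 2 + ((x + u) - x) ^ 2))) := by
      intro u
      simp only [hT]
      rcases le_or_gt |u| a with hu | hu
      · simp [hG, hu.not_gt]
      have hu0 : 0 < |u| := ha.trans hu
      have hm1 : Measurable (fun v => G v * ENNReal.ofReal (20 / (a ^ 2 + (u - v) ^ 2))) := hGm.mul (by fun_prop)
      rw [lintegral_const_mul _ hm1]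
      have hI : ∫⁻ v, G v * ENNReal.ofReal (20 / (a ^ 2 + (u - v) ^ 2)) ≤
          ENNReal.ofReal (20 / a ^ 2 * (48 * lam * (a + Metric.infDist (x + u) Ωᶜ))) := by
        calc _ ≤ ∫⁻ v, ENNReal.ofReal (20 / a ^ 2) * (γ (x + v) * ENNReal.ofReal (a ^ 2 / (a ^ 2 + ((x + u) - (x + v)) ^ 2))) := by
              apply lintegral_mono; intro v
              have e1 : ENNReal.ofReal (20 / (a ^ 2 + (u - v) ^ 2)) =
                  ENNReal.ofReal (20 / a ^ 2) * ENNReal.ofReal (a ^ 2 / (a ^ 2 + ((x + u) - (x + v)) ^ 2)) := by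
                rw [← ENNReal.ofReal_mul (by positivity)]; congr 1
                have : x + u - (x + v) = u - v := by ring
                rw [this]; field_simp
              have e2 : G v ≤ γ (x + v) := by simp only [hG]; split_ifs; exacts [le_rfl, zero_le]
              simp only [e1]
              calc _ ≤ γ (x + v) * (ENNReal.ofReal (20 / a ^ 2) * ENNReal.ofReal (a ^ 2 / (a ^ 2 + ((x + u) - (x + v)) ^ 2))) := by gcongr
                _ = _ := by ring
          _ = ENNReal.ofReal (20 / a ^ 2) * ∫⁻ v, (γ (x + v) * ENNReal.ofReal (a ^ 2 / (a ^ 2 + ((x + u) - (x + v)) ^ 2))) :=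
              lintegral_const_mul' _ _ ENNReal.ofReal_ne_top
          _ = ENNReal.ofReal (20 / a ^ 2) * ∫⁻ t, (γ t * ENNReal.ofReal (a ^ 2 / (a ^ 2 + ((x + u) - t) ^ 2))) := by
              congr 1
              exact lintegral_add_left_eq_self (fun t => γ t * ENNReal.ofReal (a ^ 2 / (a ^ 2 + ((x + u) - t) ^ 2))) x
          _ ≤ ENNReal.ofReal (20 / a ^ 2) * ENNReal.ofReal (48 * lam * (a + Metric.infDist (x + u) Ωᶜ)) := by
              gcongr; exact inner_bound hΩ ⟨x, hx⟩ hlam hgood ha (x + u)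
          _ = _ := by rw [← ENNReal.ofReal_mul (by positivity)]
      have hGu : G u = γ (x + u) := if_pos hu
      have hδ := Metric.infDist_nonneg (x := x + u) (s := Ωᶜ)
      have hδu : Metric.infDist (x + u) Ωᶜ ≤ |u| := by
        have := Metric.infDist_le_dist_of_mem (x := x + u) hx
        rwa [Real.dist_eq, add_sub_cancel_left] at this
      rw [hGu]
      set δ := Metric.infDist (x + u) Ωᶜ
      have e3 : x + u - x = u := by ring
      rw [e3, ← mul_add, ← ENNReal.ofReal_add (by positivity) (by positivity)]
      calc _ ≤ γ (x + u) * ENNReal.ofReal (1 / u ^ 2) * ENNReal.ofReal (20 / a ^ 2 * (48 * lam * (a + δ))) := by gcongr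
        _ = γ (x + u) * ENNReal.ofReal (1 / u ^ 2 * (20 / a ^ 2 * (48 * lam * (a + δ)))) := by
            rw [mul_assoc, ← ENNReal.ofReal_mul (by positivity)]
        _ ≤ γ (x + u) * ENNReal.ofReal (1920 * lam / a ^ 2 * (a / (a ^ 2 + u ^ 2) + δ / (δ ^ 2 + u ^ 2))) := by
            gcongr _ * ENNReal.ofReal ?_
            have hu2 : 0 < u ^ 2 := by rw [← sq_abs]; positivity
            have k1 : a / u ^ 2 ≤ 2 * (a / (a ^ 2 + u ^ 2)) := by
              rw [← mul_div_assoc, div_le_div_iff₀ hu2 (by positivity)]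
              have : a ^ 2 ≤ u ^ 2 := by rw [← sq_abs u]; gcongr
              nlinarith
            have k2 : δ / u ^ 2 ≤ 2 * (δ / (δ ^ 2 + u ^ 2)) := by
              rw [← mul_div_assoc, div_le_div_iff₀ hu2 (by positivity)]
              have : δ ^ 2 ≤ u ^ 2 := by rw [← sq_abs u]; gcongr
              nlinarith
            calc 1 / u ^ 2 * (20 / a ^ 2 * (48 * lam * (a + δ))) = 960 * lam / a ^ 2 * (a / u ^ 2 + δ / u ^ 2) := by ring
              _ ≤ 960 * lam / a ^ 2 * (2 * (a / (a ^ 2 + u ^ 2)) + 2 * (δ / (δ ^ 2 + u ^ 2))) := by gcongr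
              _ = _ := by ring
        _ = _ := by rw [ENNReal.ofReal_mul (by positivity)]; ring
    refine (lintegral_mono hin).trans ?_
    rw [lintegral_const_mul' _ _ ENNReal.ofReal_ne_top]
    gcongr
    have e := lintegral_add_left_eq_self (μ := volume) (fun t => γ t * ENNReal.ofReal (a / (a ^ 2 + (t - x) ^ 2)) + γ t *
          ENNReal.ofReal (Metric.infDist t Ωᶜ / (Metric.infDist t Ωᶜ ^ 2 + (t - x) ^ 2))) x
    have hm2 : Measurable (fun t => γ t * ENNReal.ofReal (a / (a ^ 2 + (t - x) ^ 2))) := hγ.mul (by fun_prop)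
    rw [e, lintegral_add_left hm2]
    gcongr
    · exact hgood x hx a ha
    · exact le_rfl
  calc _ ≤ ∫⁻ w, (T w + T w.swap) := lintegral_mono hpt
    _ = (∫⁻ w, T w) + ∫⁻ w, T (Prod.swap w) := lintegral_add_left hTm _
    _ = (∫⁻ w, T w) + ∫⁻ w, T w := by
        congr 1
        have hv : (volume : Measure (ℝ × ℝ)) = volume.prod volume := rfl
        rw [hv]
        exact lintegral_prod_swap T
    _ ≤ ENNReal.ofReal (1920 * lam / a ^ 2) * (ENNReal.ofReal (16 * lam) + Rm γ Ω x) + ENNReal.ofReal (1920 * lam / a ^ 2) * (ENNReal.ofReal (16 * lam) + Rm γ Ω x) := add_le_add hTi hTi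
    _ = _ := by
        rw [← two_mul, ← mul_assoc, show (2 : ℝ≥0∞) = ENNReal.ofReal 2 by simp, ← ENNReal.ofReal_mul (by norm_num)]
        congr 2; ring
end

set_option linter.all false
open MeasureTheory Filter Set
open scoped ENNReal
noncomputable section

structure Good1 (φ : ℝ → ℝ) (lam x : ℝ) : Prop where
  hx : |x| ≤ Real.pi
  gp : GoodP (cutE φ) lam x
  gq : ∀ r : ℝ, 0 ≤ r → r < 1 → |∫ u in J1, Qk r u * φ (x + u)| ≤ 2 * lam
  gf : ∀ a : ℝ, 0 < a → ∀ Φ : ℝ → ℝ, (∀ u, |u| ≤ a → Φ u = 0) →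
    (∀ u, a < |u| → ‖Φ u‖ₑ ≤ cutE φ (x + u) * ENNReal.ofReal (1 / |u|)) →
    ∫⁻ w : ℝ × ℝ, ‖Φ w.1‖ₑ * ‖Φ w.2‖ₑ * ENNReal.ofReal (20 / (a ^ 2 + (w.1 - w.2) ^ 2)) ≤
      ENNReal.ofReal (65280 * lam ^ 2 / a ^ 2)

lemma PerInt.pos {φ : ℝ → ℝ} (h : PerInt φ) : PerInt (fun x => max (φ x) 0) :=
  ⟨h.meas.max measurable_const, fun x => by simp only [h.per x], h.int.pos_part⟩

lemma PerInt.neg' {φ : ℝ → ℝ} (h : PerInt φ) : PerInt (fun x => max (-φ x) 0) :=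
  ⟨h.meas.neg.max measurable_const, fun x => by simp only [h.per x], h.int.neg_part⟩

lemma good_exists {φ : ℝ → ℝ} (h : PerInt φ) {lam : ℝ} (hlam : 0 < lam) :
    ∃ B : Set ℝ, volume B ≤ ENNReal.ofReal (30000 / lam) * ∫⁻ u in J1, ‖φ u‖ₑ ∧
      ∀ x, |x| ≤ Real.pi → x ∉ B → Good1 φ lam x := by
  set I := ∫⁻ u in J1, ‖φ u‖ₑ with hI
  set γ := cutE φ with hγ
  have hγm : Measurable γ := cutE_measurable h.meas
  have hγi : ∫⁻ t, γ t ≤ 3 * I := lint_cutE h.per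
  set Ω := hlBad γ lam with hΩ
  have hΩo : IsOpen Ω := hlBad_isOpen _ _
  set B2 := {x | ENNReal.ofReal lam ≤ Rm γ Ω x}
  set B3 := {x : ℝ | |x| ≤ Real.pi ∧ ∃ r : ℝ, 0 ≤ r ∧ r < 1 ∧ lam < |∫ u in J1, Qk r u * (max (φ (x + u)) 0)|}
  set B4 := {x : ℝ | |x| ≤ Real.pi ∧ ∃ r : ℝ, 0 ≤ r ∧ r < 1 ∧ lam < |∫ u in J1, Qk r u * (max (-φ (x + u)) 0)|}
  have hl0 : ENNReal.ofReal lam ≠ 0 := by simp [hlam]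
  have v1 : volume Ω ≤ ENNReal.ofReal (12 / lam) * I := by
    refine (hlBad_volume γ hlam).trans ?_
    calc _ ≤ ENNReal.ofReal (4 / lam) * (3 * I) := by gcongr
      _ = _ := by
        rw [← mul_assoc, show (3 : ℝ≥0∞) = ENNReal.ofReal 3 by simp, ← ENNReal.ofReal_mul (by positivity)]
        congr 2; ring
  have hRmm : Measurable (Rm γ Ω) := by
    unfold Rm
    have hc : Continuous fun s => Metric.infDist s Ωᶜ := Metric.continuous_infDist_pt _
    apply Measurable.lintegral_prod_right' (f := fun w : ℝ × ℝ => γ w.2 * ENNReal.ofReal (Metric.infDist w.2 Ωᶜ / (Metric.infDist w.2 Ωᶜ ^ 2 + (w.2 - w.1) ^ 2)))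
    have h1 : Measurable fun w : ℝ × ℝ => Metric.infDist w.2 Ωᶜ := hc.measurable.comp measurable_snd
    exact (hγm.comp measurable_snd).mul
      (h1.div ((h1.pow_const 2).add ((measurable_snd.sub measurable_fst).pow_const 2))).ennreal_ofReal
  have v2 : volume B2 ≤ ENNReal.ofReal (48 / lam) * I := by
    have := meas_ge_le_lintegral_div (μ := volume) hRmm.aemeasurable hl0 ENNReal.ofReal_ne_top
    refine this.trans ?_
    calc _ ≤ (16 * (3 * I)) / ENNReal.ofReal lam := by
          gcongr; exact (Rm_integral hγm Ω).trans (by gcongr)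
      _ = _ := by
        rw [ENNReal.ofReal_div_of_pos hlam, ENNReal.div_eq_inv_mul, ENNReal.div_eq_inv_mul, ← mul_assoc 16,
          show ENNReal.ofReal 48 = 16 * 3 by norm_num]; ring
  have hpi : Real.pi ≤ 4 := Real.pi_le_four
  have v3 : volume B3 ≤ ENNReal.ofReal (14400 / lam) * I := by
    refine (conj_max h.pos (fun x => le_max_right _ _) hlam).trans ?_
    gcongr ENNReal.ofReal ?_ * ?_
    · gcongr; nlinarith
    · refine lintegral_mono fun u => ?_
      rw [Real.enorm_eq_ofReal_abs, Real.enorm_eq_ofReal_abs]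
      apply ENNReal.ofReal_le_ofReal
      rw [abs_of_nonneg (le_max_right _ _)]
      exact max_le (le_abs_self _) (abs_nonneg _)
  have v4 : volume B4 ≤ ENNReal.ofReal (14400 / lam) * I := by
    refine (conj_max h.neg' (fun x => le_max_right _ _) hlam).trans ?_
    gcongr ENNReal.ofReal ?_ * ?_
    · gcongr; nlinarith
    · refine lintegral_mono fun u => ?_
      rw [Real.enorm_eq_ofReal_abs, Real.enorm_eq_ofReal_abs]
      apply ENNReal.ofReal_le_ofReal
      rw [abs_of_nonneg (le_max_right _ _)]
      exact max_le (neg_le_abs _) (abs_nonneg _)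
  refine ⟨Ω ∪ B2 ∪ B3 ∪ B4, ?_, ?_⟩
  · calc _ ≤ volume Ω + volume B2 + volume B3 + volume B4 :=
          (measure_union_le _ _).trans (by gcongr; exact (measure_union_le _ _).trans (by gcongr; exact measure_union_le _ _))
      _ ≤ ENNReal.ofReal (12 / lam) * I + ENNReal.ofReal (48 / lam) * I + ENNReal.ofReal (14400 / lam) * I + ENNReal.ofReal (14400 / lam) * I := by gcongr
      _ = ENNReal.ofReal (28860 / lam) * I := by
          rw [← add_mul, ← add_mul, ← add_mul, ← ENNReal.ofReal_add (by positivity) (by positivity),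
            ← ENNReal.ofReal_add (by positivity) (by positivity), ← ENNReal.ofReal_add (by positivity) (by positivity)]
          congr 2; ring
      _ ≤ _ := by gcongr; norm_num
  · intro x hx hB
    simp only [mem_union, not_or] at hB
    obtain ⟨⟨⟨h1, h2⟩, h3⟩, h4⟩ := hB
    refine ⟨hx, goodP_of h.meas hlam.le h1, ?_, ?_⟩
    · intro r hr hr1
      have k3 : |∫ u in J1, Qk r u * (max (φ (x + u)) 0)| ≤ lam := by
        by_contra hc; exact h3 ⟨hx, r, hr, hr1, not_le.1 hc⟩
      have k4 : |∫ u in J1, Qk r u * (max (-φ (x + u)) 0)| ≤ lam := by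
        by_contra hc; exact h4 ⟨hx, r, hr, hr1, not_le.1 hc⟩
      have i3 : IntegrableOn (fun u => Qk r u * (max (φ (x + u)) 0)) J1 :=
        int_mul_J1 (Qk_cont hr hr1) (h.pos.shift x)
      have i4 : IntegrableOn (fun u => Qk r u * (max (-φ (x + u)) 0)) J1 :=
        int_mul_J1 (Qk_cont hr hr1) (h.neg'.shift x)
      have e : ∫ u in J1, Qk r u * φ (x + u) = (∫ u in J1, Qk r u * (max (φ (x + u)) 0)) - ∫ u in J1, Qk r u * (max (-φ (x + u)) 0) := by
        rw [← integral_sub i3 i4]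
        congr 1; ext u
        rw [← mul_sub]; congr 1
        rcases le_total (φ (x + u)) 0 with hh | hh
        · rw [max_eq_right hh, max_eq_left (by linarith)]; ring
        · rw [max_eq_left hh, max_eq_right (by linarith)]; ring
      rw [e]
      refine (abs_sub _ _).trans ?_
      linarith
    · intro a ha Φ p0 p1
      refine (outer_bound hγm hΩo hlam.le (fun y hy => goodP_of h.meas hlam.le hy) ha h1 p0 p1).trans ?_
      have h2' : Rm γ Ω x ≤ ENNReal.ofReal lam := (not_le.1 h2).le
      calc _ ≤ ENNReal.ofReal (3840 * lam / a ^ 2) * (ENNReal.ofReal (16 * lam) + ENNReal.ofReal lam) := by gcongr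
        _ = _ := by
          rw [← ENNReal.ofReal_add (by positivity) hlam.le, ← ENNReal.ofReal_mul (by positivity)]
          congr 1; ring
end

set_option linter.all false
open MeasureTheory Filter Set
open scoped ENNReal
noncomputable section

def Se (e : ℝ) : Set ℝ := {t : ℝ | e < |t| ∧ |t| < Real.pi}

lemma Se_meas (e : ℝ) : MeasurableSet (Se e) :=
  (measurableSet_lt measurable_const measurable_id.abs).inter (measurableSet_lt measurable_id.abs measurable_const)

lemma Se_sub (e : ℝ) : Se e ⊆ J1 := fun _ hu => abs_lt.1 hu.2

lemma ct_meas : Measurable ct := by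
  unfold ct
  have : Measurable Real.tan := by
    have h : Real.tan = fun x => Real.sin x / Real.cos x := funext Real.tan_eq_sin_div_cos
    rw [h]; exact Real.measurable_sin.div Real.measurable_cos
  exact measurable_const.div (measurable_const.mul (this.comp (measurable_id.div_const 2)))

lemma intB {φ : ℝ → ℝ} (h : PerInt φ) (x : ℝ) {s : Set ℝ} (hs : MeasurableSet s) (hsub : s ⊆ J1) {k : ℝ → ℝ}
    (hk : Measurable k) {C : ℝ} (hC : ∀ u ∈ s, |k u| ≤ C) : IntegrableOn (fun u => k u * φ (x + u)) s :=
  Integrable.bdd_mul ((h.shift x).mono_set hsub) hk.aestronglyMeasurable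
    ((ae_restrict_iff' hs).2 (ae_of_all _ fun u hu => hC u hu))

lemma ct_Se {e : ℝ} (he : 0 < e) {u : ℝ} (hu : u ∈ Se e) : |ct u| ≤ 1 / e := by
  have h0 : 0 < |u| := he.trans hu.1
  exact (ct_abs_le (abs_pos.1 h0) hu.2).trans (one_div_le_one_div_of_le he hu.1.le)

lemma intS {φ : ℝ → ℝ} (h : PerInt φ) (x : ℝ) {e : ℝ} (he : 0 < e) {k : ℝ → ℝ} (hk : Measurable k) {C : ℝ}
    (hC : ∀ u, |k u| ≤ C) : IntegrableOn (fun u => k u * ct u * φ (x + u)) (Se e) := by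
  refine intB h x (Se_meas e) (Se_sub e) (hk.mul ct_meas) (C := C * (1 / e)) fun u hu => ?_
  rw [abs_mul]
  exact mul_le_mul (hC u) (ct_Se he hu) (abs_nonneg _) ((abs_nonneg _).trans (hC u))

lemma cut_int {s : Set ℝ} {e : ℝ} (hs : Se e = s ∩ {u | e < |u|}) (g : ℝ → ℝ) :
    ∫ u in Se e, g u = ∫ u in s, (if e < |u| then g u else 0) := by
  have hm : MeasurableSet {u : ℝ | e < |u|} := measurableSet_lt measurable_const measurable_id.abs
  rw [hs, ← setIntegral_indicator hm]
  rfl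

lemma H_bound {φ : ℝ → ℝ} (h : PerInt φ) {lam x : ℝ} (hlam : 0 ≤ lam) (g : Good1 φ lam x) {e : ℝ} (he : 0 < e) (he1 : e ≤ 1) :
    |∫ u in Se e, ct u * φ (x + u)| ≤ 210 * lam := by
  have e1 : ∫ u in Se e, ct u * φ (x + u) = ∫ u in J1, (if e < |u| then ct u else 0) * φ (x + u) := by
    rw [cut_int (s := J1) (by ext u; simp only [Se, J1, mem_setOf_eq, mem_inter_iff, mem_Ioo, abs_lt]; tauto)]
    congr 1; ext u; rw [ite_mul, zero_mul]
  have hQ := int_mul_J1 (Qk_cont (r := 1 - e) (by linarith) (by linarith)) (h.shift x)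
  have hm : Measurable fun u => (if e < |u| then ct u else 0) :=
    Measurable.ite (measurableSet_lt measurable_const measurable_id.abs) ct_meas measurable_const
  have hi : IntegrableOn (fun u => (if e < |u| then ct u else 0) * φ (x + u)) J1 := by
    refine intB h x J1_meas subset_rfl hm (C := 1 / e) fun u hu => ?_
    split_ifs with hh
    · exact ct_Se he ⟨hh, J1_abs hu⟩
    · rw [abs_zero]; positivity
  have e2 : ∫ u in Se e, ct u * φ (x + u) =
      (∫ u in J1, ((if e < |u| then ct u else 0) - Qk (1 - e) u) * φ (x + u)) + ∫ u in J1, Qk (1 - e) u * φ (x + u) := by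
    rw [e1, ← sub_eq_iff_eq_add, ← integral_sub hi hQ]
    congr 1; ext u; ring
  have b1 : |∫ u in J1, ((if e < |u| then ct u else 0) - Qk (1 - e) u) * φ (x + u)| ≤ 16 * 13 * lam := by
    refine int_K hlam g.hx g.gp J1_meas (fun u hu => (J1_abs hu).le) (by norm_num) he fun u hu => ?_
    rcases eq_or_ne u 0 with h0 | h0
    · subst h0
      simp [Qk, he.not_gt]; positivity
    · exact kernel_diff he he1 h0 (J1_abs hu)
  have b2 := g.gq (1 - e) (by linarith) (by linarith)
  rw [e2]
  refine (abs_add_le _ _).trans ?_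
  linarith

lemma tele (N : ℕ) (u : ℝ) : 2 * Real.sin (u / 2) * ∑ k ∈ Finset.range N, Real.cos (((k + 1 : ℕ) : ℝ) * u) =
    Real.sin ((N + 1 / 2) * u) - Real.sin (u / 2) := by
  induction N with
  | zero => simp; rw [inv_mul_eq_div, sub_self]
  | succ n ih =>
    rw [Finset.sum_range_succ, mul_add, ih]
    have h1 : (((n + 1 : ℕ) : ℝ) + 1 / 2) * u = ((n + 1 : ℕ) : ℝ) * u + u / 2 := by ring
    have h2 : ((n : ℝ) + 1 / 2) * u = ((n + 1 : ℕ) : ℝ) * u - u / 2 := by push_cast; ring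
    rw [h1, h2, Real.sin_add, Real.sin_sub]; ring

lemma AN_bound {N : ℕ} (hN : 1 ≤ N) {u : ℝ} (h0 : u ≠ 0) (h1 : |u| < Real.pi) :
    |(1 / (N : ℝ) * (∑ k ∈ Finset.range N, Real.cos (((k + 1 : ℕ) : ℝ) * u)) - 1 + (if 1 / (N : ℝ) < |u| then 1 else 0)) * ct u| ≤
      8 * ((1 / (N : ℝ)) / ((1 / (N : ℝ)) ^ 2 + u ^ 2)) := by
  have hN0 : (0 : ℝ) < N := by exact_mod_cast hN
  have hu0 : 0 < |u| := abs_pos.2 h0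
  have hct := ct_abs_le h0 h1
  set a := 1 / (N : ℝ) with ha
  have ha0 : 0 < a := by positivity
  have haN : a * N = 1 := by rw [ha]; field_simp
  rw [abs_mul]
  split_ifs with hh
  · rw [sub_add_cancel, abs_mul, abs_of_pos ha0]
    have hs := sin_half_sq_ge h1.le
    have hs1 : |u| / 4 ≤ |Real.sin (u / 2)| := by
      apply abs_le_of_sq_le_sq' _ (abs_nonneg _) |>.2
      rw [div_pow, sq_abs, sq_abs]
      nlinarith [sq_nonneg u]
    have ht : |2 * Real.sin (u / 2) * ∑ k ∈ Finset.range N, Real.cos (((k + 1 : ℕ) : ℝ) * u)| ≤ 2 := by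
      rw [tele]
      refine (abs_sub _ _).trans ?_
      linarith [Real.abs_sin_le_one ((N + 1 / 2) * u), Real.abs_sin_le_one (u / 2)]
    rw [abs_mul, abs_mul, abs_two] at ht
    set S := |∑ k ∈ Finset.range N, Real.cos (((k + 1 : ℕ) : ℝ) * u)|
    have hS0 : 0 ≤ S := abs_nonneg _
    have hS : S ≤ 4 / |u| := by
      rw [le_div_iff₀ hu0]
      nlinarith
    calc a * S * |ct u| ≤ a * (4 / |u|) * (1 / |u|) := by gcongr
      _ = 4 * (a / |u| ^ 2) := by field_simp
      _ ≤ _ := by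
        rw [sq_abs]
        have : a ^ 2 ≤ u ^ 2 := by rw [← sq_abs u]; gcongr
        have hu2 : 0 < u ^ 2 := by positivity
        clear_value a
        rw [← mul_div_assoc, ← mul_div_assoc, div_le_div_iff₀ hu2 (by positivity)]
        nlinarith
  · have hh := not_lt.1 hh
    have hA : |a * (∑ k ∈ Finset.range N, Real.cos (((k + 1 : ℕ) : ℝ) * u)) - 1 + 0| ≤ N * |u| := by
      have e : a * (∑ k ∈ Finset.range N, Real.cos (((k + 1 : ℕ) : ℝ) * u)) - 1 + 0 =
          a * ∑ k ∈ Finset.range N, (Real.cos (((k + 1 : ℕ) : ℝ) * u) - 1) := by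
        rw [Finset.sum_sub_distrib, mul_sub]; simp [haN]
      rw [e, abs_mul, abs_of_pos ha0]
      calc _ ≤ a * ∑ k ∈ Finset.range N, |Real.cos (((k + 1 : ℕ) : ℝ) * u) - 1| := by gcongr; exact Finset.abs_sum_le_sum_abs _ _
        _ ≤ a * ∑ k ∈ Finset.range N, N * |u| := by
          gcongr with k hk
          have := Real.abs_cos_sub_cos_le (((k + 1 : ℕ) : ℝ) * u) 0
          rw [Real.cos_zero, sub_zero, abs_mul, Nat.abs_cast] at this
          refine this.trans ?_
          gcongr
          exact Finset.mem_range.1 hk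
        _ = _ := by rw [Finset.sum_const, Finset.card_range, nsmul_eq_mul, ← mul_assoc, haN, one_mul]
    calc _ ≤ N * |u| * (1 / |u|) := by gcongr
      _ = 1 / a := by rw [ha]; field_simp
      _ ≤ _ := by
        have : u ^ 2 ≤ a ^ 2 := by rw [← sq_abs u]; gcongr
        rw [← mul_div_assoc, div_le_div_iff₀ ha0 (by positivity)]
        nlinarith
end

set_option linter.all false
open MeasureTheory Filter Set
open scoped ENNReal
noncomputable section

def pvK (φ : ℝ → ℝ) (x : ℝ) (k : ℕ) (u : ℝ) : ℝ :=
  (1 / (2 * Real.pi)) * (Real.cos (((k + 1 : ℕ) : ℝ) * u) / (2 * Real.tan (u / 2))) * φ (x + u)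

lemma pvK_eq (φ : ℝ → ℝ) (x : ℝ) (k : ℕ) (u : ℝ) :
    pvK φ x k u = (1 / (2 * Real.pi)) * (Real.cos (((k + 1 : ℕ) : ℝ) * u) * ct u * φ (x + u)) := by
  unfold pvK ct; ring

lemma cosm (k : ℕ) : Measurable fun u : ℝ => Real.cos (((k + 1 : ℕ) : ℝ) * u) := by fun_prop

lemma pi_le_one {z b : ℝ} (hb : 0 ≤ b) (h : |z| ≤ b) : |1 / (2 * Real.pi) * z| ≤ b := by
  rw [abs_mul]
  have : |1 / (2 * Real.pi)| ≤ 1 := by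
    rw [abs_of_nonneg (by positivity), div_le_one (by positivity)]
    linarith [Real.pi_gt_three]
  nlinarith [abs_nonneg z, abs_nonneg (1 / (2 * Real.pi))]

lemma Se_cut {e b : ℝ} (h : e ≤ b) : Se b = Se e ∩ {u | b < |u|} := by
  ext u; simp only [Se, mem_setOf_eq, mem_inter_iff]
  exact ⟨fun ⟨p, q⟩ => ⟨⟨by linarith, q⟩, p⟩, fun ⟨⟨_, q⟩, p⟩ => ⟨p, q⟩⟩

lemma evt_small {b : ℝ} (hb : 0 < b) : ∀ᶠ e : ℝ in nhdsWithin 0 (Set.Ioi 0), 0 < e ∧ e < b :=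
  Ioo_mem_nhdsGT hb

lemma mean_bound {φ : ℝ → ℝ} (h : PerInt φ) {lam x : ℝ} (hlam : 0 ≤ lam) (g : Good1 φ lam x) {ξ : ℕ → ℝ}
    (hξ : ∀ k, pvT1 (pvK φ x k) (ξ k)) {N : ℕ} (hN : 1 ≤ N) :
    |∑ k ∈ Finset.range N, ξ k| ≤ N * (600 * lam) := by
  have hN0 : (0 : ℝ) < N := by exact_mod_cast hN
  have hN1 : (1 : ℝ) ≤ N := by exact_mod_cast hN
  set a := 1 / (N : ℝ) with ha
  have ha0 : 0 < a := by positivity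
  have ha1 : a ≤ 1 := by rw [ha, div_le_one hN0]; exact hN1
  have haN : N * a = 1 := by rw [ha]; field_simp
  have ht : Tendsto (fun e : ℝ => ∑ k ∈ Finset.range N, ∫ t in Se e, pvK φ x k t) (nhdsWithin 0 (Set.Ioi 0))
      (nhds (∑ k ∈ Finset.range N, ξ k)) := tendsto_finsetSum _ fun k _ => hξ k
  refine le_of_tendsto ht.abs ?_
  filter_upwards [evt_small ha0] with e he
  have hi : ∀ k, IntegrableOn (fun u => Real.cos (((k + 1 : ℕ) : ℝ) * u) * ct u * φ (x + u)) (Se e) := fun k =>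
    intS h x he.1 (cosm k) (C := 1) fun u => Real.abs_cos_le_one _
  set A : ℝ → ℝ := fun u => a * (∑ k ∈ Finset.range N, Real.cos (((k + 1 : ℕ) : ℝ) * u)) - 1 + (if a < |u| then 1 else 0) with hA
  have hAm : Measurable A := by
    refine Measurable.add (Measurable.sub (measurable_const.mul (Finset.measurable_fun_sum _ fun k _ => cosm k)) measurable_const) ?_
    exact Measurable.ite (measurableSet_lt measurable_const measurable_id.abs) measurable_const measurable_const
  have b1 : |∫ u in Se e, (A u * ct u) * φ (x + u)| ≤ 16 * 8 * lam := by
    refine int_K hlam g.hx g.gp (Se_meas e) (fun u hu => hu.2.le) (by norm_num) ha0 fun u hu => ?_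
    exact AN_bound hN (abs_pos.1 (he.1.trans hu.1)) hu.2
  have i1 : IntegrableOn (fun u => 1 * ct u * φ (x + u)) (Se e) := intS h x he.1 measurable_const (C := 1) (by simp)
  have i2 : IntegrableOn (fun u => (if a < |u| then 1 else 0) * ct u * φ (x + u)) (Se e) :=
    intS h x he.1 (Measurable.ite (measurableSet_lt measurable_const measurable_id.abs) measurable_const measurable_const)
      (C := 1) (fun u => by split_ifs <;> simp)
  have i3 : IntegrableOn (fun u => a * ∑ k ∈ Finset.range N, Real.cos (((k + 1 : ℕ) : ℝ) * u) * ct u * φ (x + u)) (Se e) :=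
    (integrable_finset_sum _ fun k _ => hi k).const_mul a
  have e1 : ∑ k ∈ Finset.range N, ∫ t in Se e, pvK φ x k t = N * (1 / (2 * Real.pi) *
      ((∫ u in Se e, (A u * ct u) * φ (x + u)) + (∫ u in Se e, 1 * ct u * φ (x + u)) -
        ∫ u in Se e, (if a < |u| then 1 else 0) * ct u * φ (x + u))) := by
    have e2 : ∫ u in Se e, (A u * ct u) * φ (x + u) =
        (∫ u in Se e, a * ∑ k ∈ Finset.range N, Real.cos (((k + 1 : ℕ) : ℝ) * u) * ct u * φ (x + u)) -
          (∫ u in Se e, 1 * ct u * φ (x + u)) + ∫ u in Se e, (if a < |u| then 1 else 0) * ct u * φ (x + u) := by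
      have i13 : IntegrableOn (fun u => a * (∑ k ∈ Finset.range N, Real.cos (((k + 1 : ℕ) : ℝ) * u) * ct u * φ (x + u)) - 1 * ct u * φ (x + u)) (Se e) := i3.sub i1
      rw [← integral_sub i3 i1, ← integral_add i13 i2]
      congr 1; ext u
      simp only [hA, ← Finset.sum_mul]; ring
    rw [e2, integral_const_mul, integral_finset_sum _ fun k _ => hi k]
    simp only [pvK_eq, integral_const_mul]
    rw [← Finset.mul_sum]
    generalize (∑ i ∈ Finset.range N, ∫ u in Se e, Real.cos (((i + 1 : ℕ) : ℝ) * u) * ct u * φ (x + u)) = X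
    linear_combination (-(1 / (2 * Real.pi) * X)) * haN
  have b2 := H_bound h hlam g he.1 (he.2.le.trans ha1)
  have b3 := H_bound h hlam g ha0 ha1
  have e3 : ∫ u in Se e, (if a < |u| then 1 else 0) * ct u * φ (x + u) = ∫ u in Se a, ct u * φ (x + u) := by
    rw [cut_int (Se_cut he.2.le)]
    congr 1; ext u; split_ifs <;> ring
  simp only [one_mul] at e1
  rw [e1, e3, abs_mul, abs_of_pos hN0]
  gcongr
  apply pi_le_one (by positivity)
  refine (abs_sub _ _).trans ?_
  have := abs_add_le (∫ u in Se e, (A u * ct u) * φ (x + u)) (∫ u in Se e, ct u * φ (x + u))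
  linarith

def Ph (φ : ℝ → ℝ) (x : ℝ) (s : Set ℝ) : ℝ → ℝ := s.indicator fun u => ct u * φ (x + u)

lemma zf_re {φ : ℝ → ℝ} {x : ℝ} {s : Set ℝ} (hs : MeasurableSet s) (hi : IntegrableOn (fun u => ct u * φ (x + u)) s) (y : ℝ) :
    (zf (Ph φ x s) y).re = ∫ u in s, Real.cos (y * u) * ct u * φ (x + u) := by
  have hi' : Integrable (Ph φ x s) := hi.integrable_indicator hs
  have h2 : Integrable (fun u : ℝ => Complex.exp ((y * u : ℝ) * Complex.I) * (Ph φ x s u : ℂ)) :=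
    Integrable.bdd_mul (c := 1) (hi'.ofReal (𝕜 := ℂ)) (by apply Continuous.aestronglyMeasurable; fun_prop)
      (ae_of_all _ fun w => by rw [Complex.norm_exp_ofReal_mul_I])
  unfold zf
  have := integral_re h2
  simp only [RCLike.re_eq_complex_re] at this
  rw [← this, ← integral_indicator hs]
  congr 1; ext u
  rw [Complex.re_mul_ofReal, Complex.exp_ofReal_mul_I_re]
  unfold Ph
  by_cases hu : u ∈ s
  · simp only [indicator_of_mem hu]; ring
  · simp only [indicator_of_notMem hu]; ring

lemma zf_sum_bound {φ : ℝ → ℝ} (h : PerInt φ) {lam x : ℝ} (g : Good1 φ lam x) {m : ℕ} (hm : 1 ≤ m) (c : ℝ)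
    {s : Set ℝ} (hs : MeasurableSet s) (hsub : s ⊆ Se (1 / (m : ℝ))) (hd : ∀ u ∈ s, ∀ v ∈ s, |u - v| ≤ Real.pi) :
    ∑ d ∈ Finset.range m, ‖zf (Ph φ x s) (c + d)‖ ^ 2 ≤ m * (65280 * lam ^ 2) := by
  have hm0 : (0 : ℝ) < m := by exact_mod_cast hm
  have ha0 : 0 < 1 / (m : ℝ) := by positivity
  have hi : IntegrableOn (fun u => ct u * φ (x + u)) s := by
    have := (intS h x ha0 (k := fun _ => 1) measurable_const (C := 1) (by simp)).mono_set hsub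
    simpa using this
  have h1 := zf_fejer (Φ := Ph φ x s) (hi.integrable_indicator hs) (fun u v hu hv => hd u (mem_of_indicator_ne_zero hu) v (mem_of_indicator_ne_zero hv)) c hm
  have h2 := g.gf (1 / (m : ℝ)) ha0 (Ph φ x s) (fun u hu => indicator_of_notMem (fun hh => (hsub hh).1.not_ge hu) _)
    (fun u hu => by
      by_cases hh : u ∈ s
      · have hu2 := (hsub hh).2
        have hc : cutE φ (x + u) = ‖φ (x + u)‖ₑ := by
          unfold cutE
          apply indicator_of_mem
          have p1 := abs_le.1 g.hx
          have p2 := abs_lt.1 hu2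
          constructor <;> linarith
        unfold Ph
        rw [hc, indicator_of_mem hh, enorm_mul, mul_comm]
        gcongr
        rw [Real.enorm_eq_ofReal_abs]
        exact ENNReal.ofReal_le_ofReal (ct_abs_le (abs_pos.1 (ha0.trans hu)) hu2)
      · unfold Ph; rw [indicator_of_notMem hh]; simp)
  have h3 := (ENNReal.ofReal_le_ofReal_iff (by positivity)).1 (h1.trans h2)
  have e : 65280 * lam ^ 2 / (1 / (m : ℝ)) ^ 2 = m * (m * (65280 * lam ^ 2)) := by field_simp
  rw [e] at h3
  exact le_of_mul_le_mul_left h3 hm0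

lemma osc_bound {φ : ℝ → ℝ} (h : PerInt φ) {lam x : ℝ} (hlam : 0 ≤ lam) (g : Good1 φ lam x) {ξ : ℕ → ℝ}
    (hξ : ∀ k, pvT1 (pvK φ x k) (ξ k)) (k0 : ℕ) {m : ℕ} (hm : 1 ≤ m) :
    ∑ i ∈ Finset.range m, ∑ j ∈ Finset.range m, |ξ (k0 + i) - ξ (k0 + j)| ≤ m ^ 2 * (1100 * lam) := by
  have hm0 : (0 : ℝ) < m := by exact_mod_cast hm
  set a := 1 / (m : ℝ) with ha
  have ha0 : 0 < a := by positivity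
  have hma : (m : ℝ) = 1 / a := by rw [ha]; field_simp
  set hh : ℕ → ℝ := fun i => ∫ u in Se a, Real.cos (((k0 + i + 1 : ℕ) : ℝ) * u) * ct u * φ (x + u) with hhd
  have key : ∀ i ∈ Finset.range m, ∀ j ∈ Finset.range m, |ξ (k0 + i) - ξ (k0 + j)| ≤ 32 * lam + |hh i| + |hh j| := by
    intro i him j hjm
    have him := Finset.mem_range.1 him
    have hjm := Finset.mem_range.1 hjm
    have ht := (hξ (k0 + i)).sub (hξ (k0 + j))
    refine le_of_tendsto ht.abs ?_
    filter_upwards [evt_small ha0] with e he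
    change |(∫ t in Se e, pvK φ x (k0 + i) t) - ∫ t in Se e, pvK φ x (k0 + j) t| ≤ _
    have hi : ∀ k, IntegrableOn (fun u => Real.cos (((k + 1 : ℕ) : ℝ) * u) * ct u * φ (x + u)) (Se e) := fun k =>
      intS h x he.1 (cosm k) (C := 1) fun u => Real.abs_cos_le_one _
    have hite : ∀ k, ∫ u in Se a, Real.cos (((k + 1 : ℕ) : ℝ) * u) * ct u * φ (x + u) =
        ∫ u in Se e, (if a < |u| then Real.cos (((k + 1 : ℕ) : ℝ) * u) else 0) * ct u * φ (x + u) := by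
      intro k
      rw [cut_int (Se_cut he.2.le)]
      congr 1; ext u; split_ifs <;> ring
    have hii : ∀ k, IntegrableOn (fun u => (if a < |u| then Real.cos (((k + 1 : ℕ) : ℝ) * u) else 0) * ct u * φ (x + u)) (Se e) := fun k =>
      intS h x he.1 (Measurable.ite (measurableSet_lt measurable_const measurable_id.abs) (cosm k) measurable_const) (C := 1) fun u => by
        split_ifs
        · exact Real.abs_cos_le_one _
        · simp
    set k : ℝ → ℝ := fun u => (if a < |u| then 0 else Real.cos (((k0 + i + 1 : ℕ) : ℝ) * u) - Real.cos (((k0 + j + 1 : ℕ) : ℝ) * u)) * ct u with hk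
    have b1 : |∫ u in Se e, k u * φ (x + u)| ≤ 16 * 2 * lam := by
      refine int_K hlam g.hx g.gp (Se_meas e) (fun u hu => hu.2.le) (by norm_num) ha0 fun u hu => ?_
      have hu0 : 0 < |u| := he.1.trans hu.1
      simp only [hk]
      split_ifs with hau
      · simp; positivity
      · have hct := ct_abs_le (abs_pos.1 hu0) hu.2
        have hc := Real.abs_cos_sub_cos_le (((k0 + i + 1 : ℕ) : ℝ) * u) (((k0 + j + 1 : ℕ) : ℝ) * u)
        have hij : |((k0 + i + 1 : ℕ) : ℝ) - ((k0 + j + 1 : ℕ) : ℝ)| ≤ m := by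
          have p1 : (i : ℝ) < m := by exact_mod_cast him
          have p2 : (j : ℝ) < m := by exact_mod_cast hjm
          have p3 : (0 : ℝ) ≤ i := by positivity
          have p4 : (0 : ℝ) ≤ j := by positivity
          push_cast
          rw [abs_le]; constructor <;> linarith
        rw [← sub_mul, abs_mul] at hc
        rw [abs_mul]
        calc _ ≤ (m * |u|) * (1 / |u|) := by
              gcongr
              exact hc.trans (by gcongr)
          _ = 1 / a := by rw [hma]; field_simp
          _ ≤ _ := by
            have : u ^ 2 ≤ a ^ 2 := by rw [← sq_abs u]; gcongr; exact not_lt.1 hau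
            clear_value a
            rw [← mul_div_assoc, div_le_div_iff₀ ha0 (by positivity)]
            nlinarith
    have e1 : (∫ t in Se e, pvK φ x (k0 + i) t) - ∫ t in Se e, pvK φ x (k0 + j) t =
        1 / (2 * Real.pi) * ((∫ u in Se e, k u * φ (x + u)) + (hh i - hh j)) := by
      simp only [hhd]
      rw [hite (k0 + i), hite (k0 + j)]
      simp only [pvK_eq, integral_const_mul]
      rw [← mul_sub, ← integral_sub (hi _) (hi _), ← integral_sub (hii _) (hii _), ← integral_add]
      · congr 2; ext u
        simp only [hk]; split_ifs <;> ring
      · refine IntegrableOn.congr_fun (f := fun u => (Real.cos (((k0 + i + 1 : ℕ) : ℝ) * u) * ct u * φ (x + u) - Real.cos (((k0 + j + 1 : ℕ) : ℝ) * u) * ct u * φ (x + u)) - ((if a < |u| then Real.cos (((k0 + i + 1 : ℕ) : ℝ) * u) else 0) * ct u * φ (x + u) - (if a < |u| then Real.cos (((k0 + j + 1 : ℕ) : ℝ) * u) else 0) * ct u * φ (x + u)))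
          (((hi _).sub (hi _)).sub ((hii _).sub (hii _))) (fun u _ => ?_) (Se_meas e)
        simp only [hk]; split_ifs <;> ring
      · exact (hii _).sub (hii _)
    rw [e1]
    apply pi_le_one (by positivity)
    have q1 := abs_add_le (∫ u in Se e, k u * φ (x + u)) (hh i - hh j)
    have q2 := abs_sub (hh i) (hh j)
    linarith
  set sp : Set ℝ := Se a ∩ Ioi 0 with hsp
  set sn : Set ℝ := Se a ∩ Iio 0 with hsn
  have hspm : MeasurableSet sp := (Se_meas a).inter measurableSet_Ioi
  have hsnm : MeasurableSet sn := (Se_meas a).inter measurableSet_Iio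
  have zp := zf_sum_bound h g hm ((k0 : ℝ) + 1) hspm inter_subset_left (fun u hu v hv => by
    have p1 := abs_lt.1 hu.1.2
    have p2 := abs_lt.1 hv.1.2
    have p3 : 0 < u := hu.2
    have p4 : 0 < v := hv.2
    rw [abs_le]; constructor <;> linarith)
  have zn := zf_sum_bound h g hm ((k0 : ℝ) + 1) hsnm inter_subset_left (fun u hu v hv => by
    have p1 := abs_lt.1 hu.1.2
    have p2 := abs_lt.1 hv.1.2
    have p3 : u < 0 := hu.2
    have p4 : v < 0 := hv.2
    rw [abs_le]; constructor <;> linarith)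
  have hsplit : Se a = sp ∪ sn := by
    rw [hsp, hsn, ← inter_union_distrib_left]
    ext u
    simp only [mem_inter_iff, mem_union, mem_Ioi, mem_Iio, iff_self_and]
    intro hu
    have : u ≠ 0 := abs_pos.1 (ha0.trans hu.1)
    exact this.symm.lt_or_gt
  have hdisj : Disjoint sp sn := by
    rw [Set.disjoint_left]
    intro u hu hv
    exact lt_asymm (mem_Ioi.1 hu.2) (mem_Iio.1 hv.2)
  have hct : IntegrableOn (fun u => ct u * φ (x + u)) (Se a) := by
    have := intS h x ha0 (k := fun _ => 1) measurable_const (C := 1) (by simp)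
    simpa using this
  have hhz : ∀ i, hh i = (zf (Ph φ x sp) ((k0 : ℝ) + 1 + i)).re + (zf (Ph φ x sn) ((k0 : ℝ) + 1 + i)).re := by
    intro i
    have hi : IntegrableOn (fun u => Real.cos (((k0 + i + 1 : ℕ) : ℝ) * u) * ct u * φ (x + u)) (Se a) :=
      intS h x ha0 (cosm _) (C := 1) fun u => Real.abs_cos_le_one _
    rw [zf_re hspm (hct.mono_set inter_subset_left), zf_re hsnm (hct.mono_set inter_subset_left)]
    simp only [hhd]
    have ec : ((k0 + i + 1 : ℕ) : ℝ) = (k0 : ℝ) + 1 + i := by push_cast; ring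
    rw [ec] at hi ⊢
    nth_rewrite 1 [hsplit]
    exact setIntegral_union hdisj hsnm (hi.mono_set inter_subset_left) (hi.mono_set inter_subset_left)
  have hsq : ∑ i ∈ Finset.range m, hh i ^ 2 ≤ m * (261120 * lam ^ 2) := by
    calc ∑ i ∈ Finset.range m, hh i ^ 2 ≤ ∑ i ∈ Finset.range m, (2 * ‖zf (Ph φ x sp) ((k0 : ℝ) + 1 + i)‖ ^ 2 + 2 * ‖zf (Ph φ x sn) ((k0 : ℝ) + 1 + i)‖ ^ 2) := by
          gcongr with i _
          rw [hhz i]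
          have r1 := Complex.abs_re_le_norm (zf (Ph φ x sp) ((k0 : ℝ) + 1 + i))
          have r2 := Complex.abs_re_le_norm (zf (Ph φ x sn) ((k0 : ℝ) + 1 + i))
          have s1 := sq_le_sq' (abs_le.1 r1).1 (abs_le.1 r1).2
          have s2 := sq_le_sq' (abs_le.1 r2).1 (abs_le.1 r2).2
          nlinarith [sq_nonneg ((zf (Ph φ x sp) ((k0 : ℝ) + 1 + i)).re - (zf (Ph φ x sn) ((k0 : ℝ) + 1 + i)).re)]
      _ ≤ _ := by rw [Finset.sum_add_distrib, ← Finset.mul_sum, ← Finset.mul_sum]; linarith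
  have hsum : ∑ i ∈ Finset.range m, |hh i| ≤ m * (511 * lam) := by
    have hcs := sq_sum_le_card_mul_sum_sq (s := Finset.range m) (f := fun i => |hh i|)
    simp only [sq_abs, Finset.card_range] at hcs
    apply le_of_sq_le_sq _ (by positivity)
    refine hcs.trans ?_
    calc _ ≤ (m : ℝ) * (m * (261120 * lam ^ 2)) := by gcongr
      _ ≤ _ := by
        have : 0 ≤ (m : ℝ) ^ 2 * lam ^ 2 := by positivity
        nlinarith
  calc _ ≤ ∑ i ∈ Finset.range m, ∑ j ∈ Finset.range m, (32 * lam + |hh i| + |hh j|) :=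
        Finset.sum_le_sum fun i hi => Finset.sum_le_sum fun j hj => key i hi j hj
    _ = m * m * (32 * lam) + m * (∑ i ∈ Finset.range m, |hh i|) + m * ∑ i ∈ Finset.range m, |hh i| := by
        simp only [Finset.sum_add_distrib, Finset.sum_const, Finset.card_range, nsmul_eq_mul, Finset.mul_sum]
        ring
    _ ≤ m * m * (32 * lam) + m * (m * (511 * lam)) + m * (m * (511 * lam)) := by gcongr
    _ ≤ _ := by nlinarith [mul_nonneg (mul_nonneg hm0.le hm0.le) hlam]
end

set_option linter.all false
open MeasureTheory Filter Set
open scoped ENNReal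
noncomputable section

lemma step_integrable (ξ : ℕ → ℝ) (n : ℕ) : Integrable (stepFun ξ n) := by
  unfold stepFun
  refine integrable_finset_sum _ fun k _ => ?_
  rw [integrable_indicator_iff measurableSet_Icc]
  exact integrableOn_const (by simp)

lemma step_ae (n : ℕ) : ∀ᵐ t : ℝ, ∀ k : ℕ, t * ((n : ℝ) + 1) ≠ k := by
  rw [ae_all_iff]
  intro k
  have h0 : (n : ℝ) + 1 ≠ 0 := by positivity
  have : ∀ᵐ t : ℝ, t ∉ ({(k : ℝ) / ((n : ℝ) + 1)} : Set ℝ) := by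
    exact measure_eq_zero_iff_ae_notMem.1 (by simp)
  filter_upwards [this] with t ht h
  exact ht (by rw [mem_singleton_iff, eq_div_iff h0, h])

lemma step_value (ξ : ℕ → ℝ) (n : ℕ) {t : ℝ} (h0 : 0 ≤ t) (h1 : t ≤ 1) (ht : ∀ k : ℕ, t * ((n : ℝ) + 1) ≠ k) :
    ∃ k : ℕ, k ≤ n ∧ (k : ℝ) < t * ((n : ℝ) + 1) ∧ t * ((n : ℝ) + 1) < k + 1 ∧ stepFun ξ n t = ξ k := by
  have hM : (0 : ℝ) < (n : ℝ) + 1 := by positivity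
  set k := ⌊t * ((n : ℝ) + 1)⌋₊ with hk
  have k1 : (k : ℝ) ≤ t * ((n : ℝ) + 1) := Nat.floor_le (by positivity)
  have k2 : t * ((n : ℝ) + 1) < k + 1 := Nat.lt_floor_add_one _
  have k3 : (k : ℝ) < t * ((n : ℝ) + 1) := lt_of_le_of_ne k1 (ht k).symm
  have k4 : k < n + 1 := by
    have : (k : ℝ) < (n : ℝ) + 1 := by nlinarith
    exact_mod_cast this
  refine ⟨k, by omega, k3, k2, ?_⟩
  unfold stepFun
  rw [Finset.sum_eq_single k]
  · rw [indicator_of_mem]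
    constructor
    · rw [div_le_iff₀ hM]; exact k1
    · rw [le_div_iff₀ hM]; exact k2.le
  · intro j _ hj
    rw [indicator_of_notMem]
    rintro ⟨a1, a2⟩
    rw [div_le_iff₀ hM] at a1
    rw [le_div_iff₀ hM] at a2
    have a3 : t * ((n : ℝ) + 1) < j + 1 := lt_of_le_of_ne a2 (by have := ht (j + 1); push_cast at this; exact this)
    have b1 : (j : ℝ) < k + 1 := by linarith
    have b2 : (k : ℝ) < j + 1 := by linarith
    have b1' : j < k + 1 := by exact_mod_cast b1
    have b2' : k < j + 1 := by exact_mod_cast b2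
    omega
  · intro h; exact absurd (Finset.mem_range.2 k4) h

lemma cell_int (n k : ℕ) (c : ℝ) :
    ∫ t, (Icc ((k : ℝ) / ((n : ℝ) + 1)) (((k : ℝ) + 1) / ((n : ℝ) + 1))).indicator (fun _ => c) t = c / ((n : ℝ) + 1) := by
  have hM : (0 : ℝ) < (n : ℝ) + 1 := by positivity
  rw [integral_indicator measurableSet_Icc, setIntegral_const, measureReal_def, Real.volume_Icc, ENNReal.toReal_ofReal]
  · rw [smul_eq_mul]; field_simp; ring
  · rw [sub_nonneg]; gcongr; linarith

lemma step_osc (ξ : ℕ → ℝ) (n : ℕ) {α β : ℝ} (h0 : 0 ≤ α) (h1 : β ≤ 1) {p m : ℕ}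
    (hp : (p : ℝ) ≤ α * ((n : ℝ) + 1)) (hq : β * ((n : ℝ) + 1) ≤ (p : ℝ) + m) (c : ℝ) :
    ∫ t in Icc α β, |stepFun ξ n t - c| ≤ (∑ i ∈ Finset.range m, |ξ (p + i) - c|) / ((n : ℝ) + 1) := by
  have hM : (0 : ℝ) < (n : ℝ) + 1 := by positivity
  set G : ℝ → ℝ := fun t => ∑ i ∈ Finset.range m,
    (Icc (((p + i : ℕ) : ℝ) / ((n : ℝ) + 1)) ((((p + i : ℕ) : ℝ) + 1) / ((n : ℝ) + 1))).indicator (fun _ => |ξ (p + i) - c|) t with hG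
  have hci : ∀ i ∈ Finset.range m, Integrable (fun t => (Icc (((p + i : ℕ) : ℝ) / ((n : ℝ) + 1)) ((((p + i : ℕ) : ℝ) + 1) / ((n : ℝ) + 1))).indicator (fun _ => |ξ (p + i) - c|) t) := by
    intro i _
    rw [integrable_indicator_iff measurableSet_Icc]
    exact integrableOn_const (by simp)
  have hGi : Integrable G := integrable_finset_sum _ hci
  have hnn : ∀ i t, 0 ≤ (Icc (((p + i : ℕ) : ℝ) / ((n : ℝ) + 1)) ((((p + i : ℕ) : ℝ) + 1) / ((n : ℝ) + 1))).indicator (fun _ => |ξ (p + i) - c|) t :=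
    fun i t => indicator_nonneg (fun _ _ => abs_nonneg _) _
  have hGI : ∫ t, G t = (∑ i ∈ Finset.range m, |ξ (p + i) - c|) / ((n : ℝ) + 1) := by
    simp only [hG]
    rw [integral_finset_sum _ hci, Finset.sum_div]
    exact Finset.sum_congr rfl fun i _ => cell_int n (p + i) _
  have hsi : IntegrableOn (fun t => |stepFun ξ n t - c|) (Icc α β) :=
    ((step_integrable ξ n).integrableOn.sub (integrableOn_const (by simp))).abs
  calc _ ≤ ∫ t in Icc α β, G t := by
        refine integral_mono_ae hsi hGi.integrableOn ?_
        filter_upwards [ae_restrict_mem measurableSet_Icc, ae_restrict_of_ae (step_ae n)] with t ht hk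
        obtain ⟨k, kn, k1, k2, e⟩ := step_value ξ n (h0.trans ht.1) (ht.2.trans h1) hk
        have t1 : α * ((n : ℝ) + 1) ≤ t * ((n : ℝ) + 1) := by gcongr; exact ht.1
        have t2 : t * ((n : ℝ) + 1) ≤ β * ((n : ℝ) + 1) := by gcongr; exact ht.2
        have s1 : (p : ℝ) < k + 1 := by linarith
        have s2 : (k : ℝ) < p + m := by linarith
        have s1' : p < k + 1 := by exact_mod_cast s1
        have s2' : k < p + m := by exact_mod_cast s2
        obtain ⟨i, rfl⟩ : ∃ i, k = p + i := ⟨k - p, by omega⟩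
        have him : i ∈ Finset.range m := Finset.mem_range.2 (by omega)
        rw [e]
        have := Finset.single_le_sum (fun j _ => hnn j t) him
        refine le_trans (le_of_eq ?_) this
        rw [indicator_of_mem]
        constructor
        · rw [div_le_iff₀ hM]; exact k1.le
        · rw [le_div_iff₀ hM]; exact k2.le
    _ ≤ ∫ t, G t := setIntegral_le_integral hGi (ae_of_all _ fun t => Finset.sum_nonneg fun i _ => hnn i t)
    _ = _ := hGI

lemma osc_le {g : ℝ → ℝ} {α β : ℝ} (hab : α < β) (hg : IntegrableOn g (Icc α β)) (c : ℝ) :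
    (β - α)⁻¹ * ∫ t in Icc α β, |g t - (β - α)⁻¹ * ∫ s in Icc α β, g s| ≤ (β - α)⁻¹ * (2 * ∫ t in Icc α β, |g t - c|) := by
  have hd : 0 < β - α := by linarith
  set mI := (β - α)⁻¹ * ∫ s in Icc α β, g s with hmI
  have hc : ∀ c : ℝ, IntegrableOn (fun _ : ℝ => c) (Icc α β) := fun c => integrableOn_const (by simp)
  have hv : ∀ c : ℝ, ∫ t in Icc α β, c = (β - α) * c := fun c => by
    rw [setIntegral_const, measureReal_def, Real.volume_Icc, ENNReal.toReal_ofReal hd.le, smul_eq_mul]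
  have i1 : IntegrableOn (fun t => |g t - c|) (Icc α β) := (hg.sub (hc c)).abs
  have i2 : IntegrableOn (fun t => |g t - mI|) (Icc α β) := (hg.sub (hc mI)).abs
  have i3 : IntegrableOn (fun t => |g t - c| + |c - mI|) (Icc α β) := i1.add (hc _)
  gcongr
  have k : (β - α) * |c - mI| ≤ ∫ t in Icc α β, |g t - c| := by
    have e : (β - α) * (c - mI) = -∫ t in Icc α β, (g t - c) := by
      rw [integral_sub hg (hc c), hv, hmI]; field_simp; ring
    calc _ = |(β - α) * (c - mI)| := by rw [abs_mul, abs_of_pos hd]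
      _ = |∫ t in Icc α β, (g t - c)| := by rw [e, abs_neg]
      _ ≤ _ := abs_integral_le_integral_abs
  calc _ ≤ ∫ t in Icc α β, (|g t - c| + |c - mI|) := integral_mono i2 i3 fun t => abs_sub_le _ _ _
    _ = (∫ t in Icc α β, |g t - c|) + (β - α) * |c - mI| := by rw [integral_add i1 (hc _), hv]
    _ ≤ _ := by linarith

lemma bmo_det {ξ : ℕ → ℝ} {A : ℝ} (hA : 0 ≤ A)
    (hM : ∀ N : ℕ, 1 ≤ N → |∑ k ∈ Finset.range N, ξ k| ≤ N * A)
    (hO : ∀ k0 m : ℕ, 1 ≤ m → ∑ i ∈ Finset.range m, ∑ j ∈ Finset.range m, |ξ (k0 + i) - ξ (k0 + j)| ≤ m ^ 2 * A) :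
    bmoSeq ξ ≤ 7 * A := by
  unfold bmoSeq
  refine ciSup_le fun n => ?_
  have hM0 : (0 : ℝ) < (n : ℝ) + 1 := by positivity
  set M := (n : ℝ) + 1 with hMd
  unfold bmoNorm
  have hmean : |∫ t in Icc (0 : ℝ) 1, stepFun ξ n t| ≤ A := by
    have e : ∫ t in Icc (0 : ℝ) 1, stepFun ξ n t = (∑ k ∈ Finset.range (n + 1), ξ k) / M := by
      have e0 : ∫ t in Icc (0 : ℝ) 1, stepFun ξ n t = ∫ t, stepFun ξ n t := by
        apply setIntegral_eq_integral_of_forall_compl_eq_zero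
        intro t ht
        unfold stepFun
        refine Finset.sum_eq_zero fun k hk => indicator_of_notMem (fun hh => ht ⟨?_, ?_⟩) _
        · exact le_trans (by positivity) hh.1
        · refine hh.2.trans ?_
          rw [div_le_one hM0]
          have : (k : ℝ) + 1 ≤ n + 1 := by exact_mod_cast Finset.mem_range.1 hk
          exact this
      rw [e0]
      unfold stepFun
      rw [integral_finset_sum, Finset.sum_div]
      · exact Finset.sum_congr rfl fun k _ => cell_int n k _
      · intro k _
        rw [integrable_indicator_iff measurableSet_Icc]
        exact integrableOn_const (by simp)
    rw [e, abs_div, abs_of_pos hM0, div_le_iff₀ hM0]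
    have := hM (n + 1) (by omega)
    push_cast at this
    linarith
  have hsup : (⨆ I : {p : ℝ × ℝ // 0 ≤ p.1 ∧ p.1 < p.2 ∧ p.2 ≤ 1},
      (I.1.2 - I.1.1)⁻¹ *
        ∫ t in Set.Icc I.1.1 I.1.2,
          |stepFun ξ n t - (I.1.2 - I.1.1)⁻¹ * ∫ s in Set.Icc I.1.1 I.1.2, stepFun ξ n s|) ≤ 6 * A := by
    haveI : Nonempty {p : ℝ × ℝ // 0 ≤ p.1 ∧ p.1 < p.2 ∧ p.2 ≤ 1} := ⟨⟨(0, 1), by norm_num⟩⟩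
    refine ciSup_le fun ⟨⟨α, β⟩, h0, hab, h1⟩ => ?_
    simp only at h0 hab h1 ⊢
    have hd : 0 < β - α := by linarith
    set p := ⌊α * M⌋₊ with hp
    set q := ⌈β * M⌉₊ with hq
    have p1 : (p : ℝ) ≤ α * M := Nat.floor_le (by positivity)
    have p2 : α * M < p + 1 := Nat.lt_floor_add_one _
    have hβ : 0 < β := by linarith
    have q1 : β * M ≤ q := Nat.le_ceil _
    have q2 : (q : ℝ) < β * M + 1 := Nat.ceil_lt_add_one (by positivity)
    have hLpos : 0 < (β - α) * M := by positivity
    have hpq : p < q := by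
      have : (p : ℝ) < q := by nlinarith
      exact_mod_cast this
    obtain ⟨m, hm⟩ : ∃ m, q = p + m := ⟨q - p, by omega⟩
    have hm1 : 1 ≤ m := by omega
    have hmr : (q : ℝ) = p + m := by rw [hm]; push_cast; ring
    rw [hmr] at q1 q2
    have hm0 : (0 : ℝ) < m := by exact_mod_cast hm1
    have hstep := step_osc ξ n h0 h1 p1 q1
    have hO' := hO p m hm1
    rcases le_or_gt 1 ((β - α) * M) with hL | hL
    · obtain ⟨j, hj, hjA⟩ : ∃ j ∈ Finset.range m, ∑ i ∈ Finset.range m, |ξ (p + i) - ξ (p + j)| ≤ m * A := by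
        by_contra hcon
        push Not at hcon
        have := Finset.sum_lt_sum_of_nonempty (s := Finset.range m) (Finset.nonempty_range_iff.2 (by omega)) hcon
        rw [Finset.sum_comm] at this
        rw [Finset.sum_const, Finset.card_range, nsmul_eq_mul] at this
        nlinarith
      refine (osc_le hab (step_integrable ξ n).integrableOn (ξ (p + j))).trans ?_
      have h3 : ∫ t in Icc α β, |stepFun ξ n t - ξ (p + j)| ≤ 3 * A * (β - α) := by
        refine (hstep _).trans ?_
        rw [div_le_iff₀ hM0]
        have hm3 : (m : ℝ) ≤ 3 * ((β - α) * M) := by nlinarith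
        calc _ ≤ m * A := hjA
          _ ≤ 3 * ((β - α) * M) * A := by gcongr
          _ = _ := by ring
      rw [inv_mul_le_iff₀ hd]
      linarith
    · have hm2 : m ≤ 2 := by
        have : (m : ℝ) < 3 := by nlinarith
        have : m < 3 := by exact_mod_cast this
        omega
      have hpt : ∀ i < m, |ξ (p + i) - ξ p| ≤ 2 * A := by
        intro i hi
        rcases Nat.eq_zero_or_pos i with rfl | hi0
        · simp; positivity
        · have hi1 : i = 1 := by omega
          have hm22 : m = 2 := by omega
          subst hi1
          rw [hm22] at hO'
          simp only [Finset.sum_range_succ, Finset.sum_range_zero, add_zero, sub_self, abs_zero, zero_add] at hO'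
          rw [abs_sub_comm (ξ p)] at hO'
          push_cast at hO'
          linarith
      refine (osc_le hab (step_integrable ξ n).integrableOn (ξ p)).trans ?_
      have h3 : ∫ t in Icc α β, |stepFun ξ n t - ξ p| ≤ 2 * A * (β - α) := by
        have hv : ∫ t in Icc α β, 2 * A = 2 * A * (β - α) := by
          rw [setIntegral_const, measureReal_def, Real.volume_Icc, ENNReal.toReal_ofReal hd.le, smul_eq_mul]; ring
        rw [← hv]
        refine integral_mono_ae ((step_integrable ξ n).integrableOn.sub (integrableOn_const (by simp))).abs (integrableOn_const (by simp)) ?_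
        filter_upwards [ae_restrict_mem measurableSet_Icc, ae_restrict_of_ae (step_ae n)] with t ht hk
        obtain ⟨k, kn, k1, k2, e⟩ := step_value ξ n (h0.trans ht.1) (ht.2.trans h1) hk
        have t1 : α * M ≤ t * M := by gcongr; exact ht.1
        have t2 : t * M ≤ β * M := by gcongr; exact ht.2
        have s1 : (p : ℝ) < k + 1 := by linarith
        have s2 : (k : ℝ) < p + m := by linarith
        have s1' : p < k + 1 := by exact_mod_cast s1
        have s2' : k < p + m := by exact_mod_cast s2
        obtain ⟨i, rfl⟩ : ∃ i, k = p + i := ⟨k - p, by omega⟩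
        rw [e]
        exact hpt i (by omega)
      rw [inv_mul_le_iff₀ hd]
      nlinarith
  linarith
end

set_option linter.all false
open MeasureTheory Filter Set
open scoped ENNReal
noncomputable section

lemma weak1 {φ : ℝ → ℝ} (h : PerInt φ) {lam : ℝ} (hlam : 0 < lam) :
    ∃ B : Set ℝ, volume B ≤ ENNReal.ofReal (30000 / lam) * ∫⁻ u in J1, ‖φ u‖ₑ ∧
      ∀ x, |x| ≤ Real.pi → x ∉ B → ∀ ξ : ℕ → ℝ, (∀ k, pvT1 (pvK φ x k) (ξ k)) →
        (∀ N : ℕ, 1 ≤ N → |∑ k ∈ Finset.range N, ξ k| ≤ N * (1100 * lam)) ∧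
        (∀ k0 m : ℕ, 1 ≤ m → ∑ i ∈ Finset.range m, ∑ j ∈ Finset.range m, |ξ (k0 + i) - ξ (k0 + j)| ≤ m ^ 2 * (1100 * lam)) := by
  obtain ⟨B, hB, hg⟩ := good_exists h hlam
  refine ⟨B, hB, fun x hx hxB ξ hξ => ⟨fun N hN => ?_, fun k0 m hm => osc_bound h hlam.le (hg x hx hxB) hξ k0 hm⟩⟩
  refine (mean_bound h hlam.le (hg x hx hxB) hξ hN).trans ?_
  gcongr; norm_num

lemma mono_llog {s t : ℝ} (h0 : 0 ≤ s) (h : s ≤ t) : s * logPlus s ≤ t * logPlus t := by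
  have : logPlus s ≤ logPlus t := by
    unfold logPlus
    split_ifs with h1 h2 h2
    · exact Real.log_le_log (by linarith) h
    · linarith
    · exact Real.log_nonneg h2.le
    · exact le_rfl
  exact mul_le_mul h this (logPlus_nonneg _) (h0.trans h)

lemma trunc_L1 {φ : ℝ → ℝ} (hm : Measurable φ) (hper : Function.Periodic φ (2 * Real.pi)) {e : ℝ} (he : 0 < e) (he1 : e ≤ 1) :
    ∫⁻ y in J1, ‖∫ v in Se e, ct v * φ (y + v)‖ₑ ≤
      6000 * (1 + ∫⁻ u in J1, ENNReal.ofReal (|φ u| * logPlus |φ u|)) := by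
  set L := ∫⁻ u in J1, ENNReal.ofReal (|φ u| * logPlus |φ u|) with hL
  rcases eq_or_ne L ∞ with hLt | hLt
  · rw [hLt]; simp
  have hlm : Measurable fun u => |φ u| * logPlus |φ u| := hm.abs.mul (meas_logPlus.comp hm.abs)
  have hlnn : ∀ u, 0 ≤ |φ u| * logPlus |φ u| := fun u => mul_nonneg (abs_nonneg _) (logPlus_nonneg _)
  have hLi : IntegrableOn (fun u => |φ u| * logPlus |φ u|) J1 := by
    refine ⟨hlm.aestronglyMeasurable, ?_⟩
    rw [HasFiniteIntegral]
    refine lt_of_le_of_lt (lintegral_mono fun u => ?_) (lt_top_iff_ne_top.2 hLt)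
    rw [Real.enorm_eq_ofReal_abs, abs_of_nonneg (hlnn u)]
  have hLr : ENNReal.ofReal (∫ u in J1, |φ u| * logPlus |φ u|) = L :=
    ofReal_integral_eq_lintegral_ofReal hLi (ae_of_all _ hlnn)
  have hvol : volume J1 = ENNReal.ofReal (2 * Real.pi) := by
    unfold J1; rw [Real.volume_Ioo]; congr 1; ring
  set I := ∫⁻ u in J1, ‖φ u‖ₑ with hI
  have hIle : I ≤ ENNReal.ofReal 19 + L := by
    calc I ≤ ∫⁻ u in J1, (ENNReal.ofReal 3 + ENNReal.ofReal (|φ u| * logPlus |φ u|)) := by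
          refine lintegral_mono fun u => ?_
          rw [Real.enorm_eq_ofReal_abs, ← ENNReal.ofReal_add (by norm_num) (hlnn u)]
          exact ENNReal.ofReal_le_ofReal (le_logPlus (abs_nonneg _))
      _ = ENNReal.ofReal 3 * ENNReal.ofReal (2 * Real.pi) + L := by
          rw [lintegral_add_left measurable_const, setLIntegral_const, hvol]
      _ ≤ _ := by
          gcongr
          rw [← ENNReal.ofReal_mul (by norm_num)]
          apply ENNReal.ofReal_le_ofReal
          nlinarith [Real.pi_lt_d2]
  have hφi : IntegrableOn φ J1 := by
    refine ⟨hm.aestronglyMeasurable, ?_⟩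
    exact lt_of_le_of_lt hIle (ENNReal.add_lt_top.2 ⟨ENNReal.ofReal_lt_top, lt_top_iff_ne_top.2 hLt⟩)
  have h : PerInt φ := ⟨hm, hper, hφi⟩
  set D : ℝ → ℝ := fun u => (if e < |u| then ct u else 0) - Qk (1 - e) u with hD
  have hr0 : 0 ≤ 1 - e := by linarith
  have hr1 : 1 - e < 1 := by linarith
  have hcm : Measurable fun u => (if e < |u| then ct u else 0) :=
    Measurable.ite (measurableSet_lt measurable_const measurable_id.abs) ct_meas measurable_const
  have hDm : Measurable D := hcm.sub (Qk_cont hr0 hr1).measurable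
  have hDb : ∀ u ∈ J1, |D u| ≤ 13 * (e / (e ^ 2 + u ^ 2)) := by
    intro u hu
    rcases eq_or_ne u 0 with h0 | h0
    · subst h0
      simp [hD, Qk, he.not_gt]; positivity
    · exact kernel_diff he he1 h0 (J1_abs hu)
  have hsplit : ∀ y, ∫ v in Se e, ct v * φ (y + v) = (∫ u in J1, D u * φ (y + u)) +
      ((∫ u in J1, Qk (1 - e) u * (max (φ (y + u)) 0)) - ∫ u in J1, Qk (1 - e) u * (max (-φ (y + u)) 0)) := by
    intro y
    have i3 : IntegrableOn (fun u => Qk (1 - e) u * (max (φ (y + u)) 0)) J1 :=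
      int_mul_J1 (Qk_cont hr0 hr1) (h.pos.shift y)
    have i4 : IntegrableOn (fun u => Qk (1 - e) u * (max (-φ (y + u)) 0)) J1 :=
      int_mul_J1 (Qk_cont hr0 hr1) (h.neg'.shift y)
    have hQ : IntegrableOn (fun u => Qk (1 - e) u * φ (y + u)) J1 := int_mul_J1 (Qk_cont hr0 hr1) (h.shift y)
    have hi : IntegrableOn (fun u => (if e < |u| then ct u else 0) * φ (y + u)) J1 := by
      refine intB h y J1_meas subset_rfl hcm (C := 1 / e) fun u hu => ?_
      split_ifs with hh
      · exact ct_Se he ⟨hh, J1_abs hu⟩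
      · rw [abs_zero]; positivity
    have e1 : ∫ u in Se e, ct u * φ (y + u) = ∫ u in J1, (if e < |u| then ct u else 0) * φ (y + u) := by
      rw [cut_int (s := J1) (by ext u; simp only [Se, J1, mem_setOf_eq, mem_inter_iff, mem_Ioo, abs_lt]; tauto)]
      congr 1; ext u; rw [ite_mul, zero_mul]
    have e2 : ∫ u in J1, D u * φ (y + u) = (∫ u in J1, (if e < |u| then ct u else 0) * φ (y + u)) - ∫ u in J1, Qk (1 - e) u * φ (y + u) := by
      rw [← integral_sub hi hQ]; congr 1; ext u; simp only [hD]; ring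
    have e3 : ∫ u in J1, Qk (1 - e) u * φ (y + u) = (∫ u in J1, Qk (1 - e) u * (max (φ (y + u)) 0)) - ∫ u in J1, Qk (1 - e) u * (max (-φ (y + u)) 0) := by
      rw [← integral_sub i3 i4]
      congr 1; ext u
      rw [← mul_sub]; congr 1
      rcases le_total (φ (y + u)) 0 with hh | hh
      · rw [max_eq_right hh, max_eq_left (by linarith)]; ring
      · rw [max_eq_left hh, max_eq_right (by linarith)]; ring
    rw [e1, e2, ← e3]; ring
  have bD : ∫⁻ y in J1, ‖∫ u in J1, D u * φ (y + u)‖ₑ ≤ 208 * I := by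
    calc _ ≤ ∫⁻ y in J1, ∫⁻ u in J1, ‖D u‖ₑ * ‖φ (y + u)‖ₑ := by
          refine lintegral_mono fun y => ?_
          refine (enorm_integral_le_lintegral_enorm _).trans (le_of_eq ?_)
          congr 1; ext u; rw [enorm_mul]
      _ = ∫⁻ u in J1, ∫⁻ y in J1, ‖D u‖ₑ * ‖φ (y + u)‖ₑ := by
          rw [lintegral_lintegral_swap]
          apply Measurable.aemeasurable
          exact (hDm.comp measurable_snd).enorm.mul (hm.comp (measurable_fst.add measurable_snd)).enorm
      _ = ∫⁻ u in J1, ‖D u‖ₑ * I := by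
          congr 1; ext u
          have hmm : Measurable fun y => ‖φ (y + u)‖ₑ := (hm.comp (measurable_id.add measurable_const)).enorm
          rw [lintegral_const_mul _ hmm]
          congr 1
          have := per_lint_J1 (g := fun t => ‖φ t‖ₑ) (fun t => by simp only [hper t]) u
          rw [hI, ← this]; congr 1; ext y; rw [add_comm]
      _ = (∫⁻ u in J1, ‖D u‖ₑ) * I := lintegral_mul_const _ hDm.enorm
      _ ≤ 208 * I := by
          gcongr
          calc _ ≤ ∫⁻ u in J1, ENNReal.ofReal 13 * ENNReal.ofReal (e / (e ^ 2 + (u - 0) ^ 2)) := by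
                refine setLIntegral_mono' J1_meas fun u hu => ?_
                rw [Real.enorm_eq_ofReal_abs, ← ENNReal.ofReal_mul (by norm_num), sub_zero]
                exact ENNReal.ofReal_le_ofReal (hDb u hu)
            _ ≤ ∫⁻ u, ENNReal.ofReal 13 * ENNReal.ofReal (e / (e ^ 2 + (u - 0) ^ 2)) := setLIntegral_le_lintegral _ _
            _ = ENNReal.ofReal 13 * ∫⁻ u, ENNReal.ofReal (e / (e ^ 2 + (u - 0) ^ 2)) := lintegral_const_mul' _ _ ENNReal.ofReal_ne_top
            _ ≤ ENNReal.ofReal 13 * 16 := by gcongr; exact pois_one he 0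
            _ = 208 := by rw [show ENNReal.ofReal 13 = 13 by simp]; norm_num
  have hcmp : ∀ ψ : ℝ → ℝ, PerInt ψ → (∀ u, 0 ≤ ψ u) → (∀ u, ψ u ≤ |φ u|) →
      ∫⁻ y in J1, ‖∫ u in J1, Qk (1 - e) u * ψ (y + u)‖ₑ ≤ 1000 * (1 + L) := by
    intro ψ hψ hp hle
    have hlψ : IntegrableOn (fun u => ψ u * logPlus (ψ u)) J1 :=
      hLi.mono' (hψ.meas.mul (meas_logPlus.comp hψ.meas)).aestronglyMeasurable (ae_of_all _ fun u => by
        rw [Real.norm_eq_abs, abs_of_nonneg (mul_nonneg (hp u) (logPlus_nonneg _))]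
        exact mono_llog (hp u) (hle u))
    refine (llogl hψ hp hlψ hr0 hr1).trans ?_
    rw [← hLr]
    have hnn : 0 ≤ ∫ u in J1, |φ u| * logPlus |φ u| := integral_nonneg hlnn
    calc _ ≤ ENNReal.ofReal (1000 * (1 + ∫ u in J1, |φ u| * logPlus |φ u|)) := by
          apply ENNReal.ofReal_le_ofReal
          have := integral_mono hlψ hLi fun u => mono_llog (hp u) (hle u)
          linarith
      _ = _ := by
          rw [ENNReal.ofReal_mul (by norm_num), ENNReal.ofReal_add (by norm_num) hnn]; simp
  have b1 := hcmp _ h.pos (fun u => le_max_right _ _) (fun u => max_le (le_abs_self _) (abs_nonneg _))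
  have b2 := hcmp _ h.neg' (fun u => le_max_right _ _) (fun u => max_le (neg_le_abs _) (abs_nonneg _))
  have mint : ∀ (k ψ : ℝ → ℝ), Measurable k → Measurable ψ → Measurable fun y => ‖∫ u in J1, k u * ψ (y + u)‖ₑ := by
    intro k ψ hk hψ
    have : StronglyMeasurable fun w : ℝ × ℝ => k w.2 * ψ (w.1 + w.2) :=
      ((hk.comp measurable_snd).mul (hψ.comp (measurable_fst.add measurable_snd))).stronglyMeasurable
    exact (this.integral_prod_right' (ν := volume.restrict J1)).measurable.enorm
  have m1 := mint D φ hDm hm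
  have m2 := mint _ _ (Qk_cont hr0 hr1).measurable h.pos.meas
  calc _ ≤ ∫⁻ y in J1, (‖∫ u in J1, D u * φ (y + u)‖ₑ + (‖∫ u in J1, Qk (1 - e) u * (max (φ (y + u)) 0)‖ₑ +
          ‖∫ u in J1, Qk (1 - e) u * (max (-φ (y + u)) 0)‖ₑ)) := by
        refine lintegral_mono fun y => ?_
        rw [hsplit y]
        refine (enorm_add_le _ _).trans ?_
        gcongr
        exact enorm_sub_le
    _ = (∫⁻ y in J1, ‖∫ u in J1, D u * φ (y + u)‖ₑ) + ((∫⁻ y in J1, ‖∫ u in J1, Qk (1 - e) u * (max (φ (y + u)) 0)‖ₑ) +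
          ∫⁻ y in J1, ‖∫ u in J1, Qk (1 - e) u * (max (-φ (y + u)) 0)‖ₑ) := by
        rw [lintegral_add_left m1, lintegral_add_left m2]
    _ ≤ 208 * (ENNReal.ofReal 19 + L) + (1000 * (1 + L) + 1000 * (1 + L)) := by
        gcongr; exact bD.trans (by gcongr)
    _ = 5952 + 2208 * L := by
        rw [show ENNReal.ofReal 19 = 19 by simp]; ring
    _ ≤ 6000 + 6000 * L := by gcongr <;> norm_num
    _ = _ := by ring
end

set_option linter.all false
open MeasureTheory Filter Set
open scoped ENNReal
noncomputable section

def Hf (f : ℝ × ℝ → ℝ) (e : ℝ) (q : ℝ × ℝ) : ℝ :=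
  ∫ v in Se e, (1 / Real.pi) * (f (q.1 + v, q.2 + v) / (2 * Real.tan (v / 2)))

lemma Hf_eq (f : ℝ × ℝ → ℝ) (e : ℝ) (q : ℝ × ℝ) :
    Hf f e q = (1 / Real.pi) * ∫ v in Se e, ct v * f (q.1 + v, q.2 + v) := by
  unfold Hf
  rw [integral_const_mul]
  congr 2; ext v; unfold ct; ring

lemma Hf_meas {f : ℝ × ℝ → ℝ} (hf : Measurable f) (e : ℝ) : StronglyMeasurable (Hf f e) := by
  have h : (Hf f e) = fun q => (1 / Real.pi) * ∫ v in Se e, ct v * f (q.1 + v, q.2 + v) := funext (Hf_eq f e)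
  rw [h]
  have : StronglyMeasurable fun w : (ℝ × ℝ) × ℝ => ct w.2 * f (w.1.1 + w.2, w.1.2 + w.2) :=
    ((ct_meas.comp measurable_snd).mul (hf.comp (by fun_prop))).stronglyMeasurable
  exact (this.integral_prod_right' (ν := volume.restrict (Se e))).const_mul _

lemma Hf_per {f : ℝ × ℝ → ℝ} (hf : Biperiodic f) (e : ℝ) : Biperiodic (Hf f e) := by
  intro x y
  unfold Hf
  constructor
  · congr 1; ext v
    simp only
    rw [add_right_comm, (hf (x + v) (y + v)).1]
  · congr 1; ext v
    simp only
    rw [add_right_comm y, (hf (x + v) (y + v)).2]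

lemma diag {g : ℝ × ℝ → ℝ≥0∞} (hg : Measurable g) (hp : ∀ x y, g (x + 2 * Real.pi, y) = g (x, y)) :
    ∫⁻ y in J1, ∫⁻ x in J1, g (x, y) = ∫⁻ a in J1, ∫⁻ t in J1, g (a + t, t) := by
  have : ∀ y, ∫⁻ x in J1, g (x, y) = ∫⁻ a in J1, g (a + y, y) := by
    intro y
    rw [← per_lint_J1 (g := fun x => g (x, y)) (fun x => hp x y) y]
    congr 1; ext a; rw [add_comm]
  simp only [this]
  rw [lintegral_lintegral_swap]
  exact (hg.comp (by fun_prop : Measurable fun w : ℝ × ℝ => (w.2 + w.1, w.1))).aemeasurable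

lemma vol_J1' : volume J1 = ENNReal.ofReal (2 * Real.pi) := by
  unfold J1; rw [Real.volume_Ioo]; congr 1; ring

def Lf (f : ℝ × ℝ → ℝ) (p : ℝ × ℝ) : ℝ := |f p| * logPlus |f p|

lemma Lf_meas {f : ℝ × ℝ → ℝ} (hf : Measurable f) : Measurable (Lf f) :=
  hf.abs.mul (meas_logPlus.comp hf.abs)

lemma Lf_nonneg (f : ℝ × ℝ → ℝ) (p : ℝ × ℝ) : 0 ≤ Lf f p := mul_nonneg (abs_nonneg _) (logPlus_nonneg _)

lemma Hf_L1 {f : ℝ × ℝ → ℝ} (hf : Measurable f) (hp : Biperiodic f) {e : ℝ} (he : 0 < e) (he1 : e ≤ 1) :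
    ∫⁻ y in J1, ∫⁻ x in J1, ‖Hf f e (x, y)‖ₑ ≤
      6000 * (ENNReal.ofReal (2 * Real.pi) + ∫⁻ y in J1, ∫⁻ x in J1, ENNReal.ofReal (Lf f (x, y))) := by
  rw [diag (Hf_meas hf e).measurable.enorm (fun x y => by rw [(Hf_per hp e x y).1]),
    diag (Lf_meas hf).ennreal_ofReal (fun x y => by unfold Lf; rw [(hp x y).1])]
  have hmi : Measurable fun a => ∫⁻ t in J1, ENNReal.ofReal (Lf f (a + t, t)) := by
    apply Measurable.lintegral_prod_right' (f := fun w : ℝ × ℝ => ENNReal.ofReal (Lf f (w.1 + w.2, w.2)))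
    exact ((Lf_meas hf).comp (by fun_prop)).ennreal_ofReal
  calc _ ≤ ∫⁻ a in J1, 6000 * (1 + ∫⁻ t in J1, ENNReal.ofReal (Lf f (a + t, t))) := by
        refine lintegral_mono fun a => ?_
        have hφ : Measurable fun t => f (a + t, t) := hf.comp (by fun_prop)
        have hφp : Function.Periodic (fun t => f (a + t, t)) (2 * Real.pi) := by
          intro t
          simp only
          rw [← add_assoc, (hp (a + t) (t + 2 * Real.pi)).1, (hp (a + t) t).2]
        refine le_trans (lintegral_mono fun y => ?_) (trunc_L1 hφ hφp he he1)
        rw [Hf_eq, enorm_mul]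
        have e1 : (∫ v in Se e, ct v * f (a + y + v, y + v)) = ∫ v in Se e, ct v * f (a + (y + v), y + v) := by
          congr 1; ext v; rw [add_assoc]
        simp only
        rw [e1]
        have : ‖1 / Real.pi‖ₑ ≤ 1 := by
          rw [Real.enorm_eq_ofReal_abs, ENNReal.ofReal_le_one, abs_of_pos (by positivity), div_le_one Real.pi_pos]
          linarith [Real.pi_gt_three]
        calc _ ≤ 1 * _ := mul_le_mul' this le_rfl
          _ = _ := one_mul _
    _ = _ := by
        have hm3 : Measurable (fun a : ℝ => 1 + ∫⁻ t in J1, ENNReal.ofReal (Lf f (a + t, t))) := measurable_const.add hmi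
        rw [lintegral_const_mul _ hm3, lintegral_add_left measurable_const, setLIntegral_const, vol_J1', one_mul]

lemma T1_restrict : volume.restrict T1 = volume.restrict J1 :=
  Measure.restrict_congr_set Ioo_ae_eq_Ico.symm

lemma T2_restrict : (volume : Measure (ℝ × ℝ)).restrict T2 = (volume.restrict J1).prod (volume.restrict J1) := by
  unfold T2
  rw [show (volume : Measure (ℝ × ℝ)) = volume.prod volume from rfl, ← Measure.prod_restrict, T1_restrict]

def ej (j : ℕ) : ℝ := 1 / ((j : ℝ) + 1)
lemma ej_pos (j : ℕ) : 0 < ej j := by unfold ej; positivity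
lemma ej_le (j : ℕ) : ej j ≤ 1 := by
  unfold ej; rw [div_le_one (by positivity)]; linarith [(Nat.cast_nonneg j : (0:ℝ) ≤ j)]
lemma ej_tendsto : Tendsto ej atTop (nhdsWithin 0 (Set.Ioi 0)) :=
  tendsto_nhdsWithin_iff.2 ⟨tendsto_one_div_add_atTop_nhds_zero_nat, Eventually.of_forall ej_pos⟩

def Gf (f : ℝ × ℝ → ℝ) (q : ℝ × ℝ) : ℝ := limUnder atTop (fun j => Hf f (ej j) q)

lemma Gf_meas {f : ℝ × ℝ → ℝ} (hf : Measurable f) : Measurable (Gf f) :=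
  (StronglyMeasurable.limUnder fun j => Hf_meas hf (ej j)).measurable

lemma Gf_per {f : ℝ × ℝ → ℝ} (hf : Biperiodic f) : Biperiodic (Gf f) := by
  intro x y
  unfold Gf
  simp only [fun j => (Hf_per hf (ej j) x y).1, fun j => (Hf_per hf (ej j) x y).2, and_self]

lemma ae_swap {R : ℝ × ℝ → Prop} (h : ∀ᵐ p, R p) : ∀ᵐ y : ℝ, ∀ᵐ x : ℝ, R (x, y) := by
  have h1 : ∀ᵐ p : ℝ × ℝ, R p.swap :=
    (Measure.measurePreserving_swap (μ := (volume : Measure ℝ)) (ν := (volume : Measure ℝ))).quasiMeasurePreserving.ae h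
  exact Measure.ae_ae_of_ae_prod h1

lemma Gf_L1 {f : ℝ × ℝ → ℝ} (hf : Measurable f) (hp : Biperiodic f) {F : ℝ × ℝ → ℝ → ℝ}
    (hF : ∀ᵐ w : (ℝ × ℝ) × ℝ, Tendsto (fun j => Hf f (ej j) (w.1.1 + w.2, w.1.2)) atTop (nhds (F w.1 w.2))) :
    ∫⁻ y in J1, ∫⁻ x in J1, ‖Gf f (x, y)‖ₑ ≤
      6000 * (ENNReal.ofReal (2 * Real.pi) + ∫⁻ y in J1, ∫⁻ x in J1, ENNReal.ofReal (Lf f (x, y))) := by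
  have h1 : ∀ᵐ p : ℝ × ℝ, ∀ᵐ u : ℝ, Tendsto (fun j => Hf f (ej j) (p.1 + u, p.2)) atTop (nhds (F p u)) :=
    Measure.ae_ae_of_ae_prod hF
  have h2 : ∀ᵐ x : ℝ, ∀ᵐ y : ℝ, ∀ᵐ u : ℝ, Tendsto (fun j => Hf f (ej j) (x + u, y)) atTop (nhds (F (x, y) u)) :=
    Measure.ae_ae_of_ae_prod h1
  obtain ⟨x, hx⟩ := h2.exists
  have h3 : ∀ᵐ y : ℝ, ∀ᵐ t : ℝ, Tendsto (fun j => Hf f (ej j) (t, y)) atTop (nhds (Gf f (t, y))) := by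
    filter_upwards [hx] with y hy
    have := (measurePreserving_add_left (volume : Measure ℝ) (-x)).quasiMeasurePreserving.ae hy
    filter_upwards [this] with t ht
    rw [add_neg_cancel_left] at ht
    have e : Gf f (t, y) = F (x, y) (-x + t) := ht.limUnder_eq
    rw [e]; exact ht
  have hHm : ∀ j, Measurable fun q : ℝ × ℝ => ‖Hf f (ej j) q‖ₑ := fun j => (Hf_meas hf _).measurable.enorm
  calc _ ≤ ∫⁻ y in J1, ∫⁻ x in J1, liminf (fun j => ‖Hf f (ej j) (x, y)‖ₑ) atTop := by
        refine lintegral_mono_ae (ae_restrict_of_ae ?_)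
        filter_upwards [h3] with y hy
        refine lintegral_mono_ae (ae_restrict_of_ae ?_)
        filter_upwards [hy] with t ht
        exact ht.enorm.liminf_eq.ge
    _ ≤ ∫⁻ y in J1, liminf (fun j => ∫⁻ x in J1, ‖Hf f (ej j) (x, y)‖ₑ) atTop := by
        refine lintegral_mono fun y => lintegral_liminf_le fun j => ?_
        exact (hHm j).comp (by fun_prop : Measurable fun x : ℝ => (x, y))
    _ ≤ liminf (fun j => ∫⁻ y in J1, ∫⁻ x in J1, ‖Hf f (ej j) (x, y)‖ₑ) atTop := by
        refine lintegral_liminf_le fun j => ?_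
        exact Measurable.lintegral_prod_left' (hHm j)
    _ ≤ liminf (fun j : ℕ => 6000 * (ENNReal.ofReal (2 * Real.pi) + ∫⁻ y in J1, ∫⁻ x in J1, ENNReal.ofReal (Lf f (x, y)))) atTop :=
        liminf_le_liminf (Eventually.of_forall fun j => Hf_L1 hf hp (ej_pos j) (ej_le j))
    _ = _ := liminf_const _
end

set_option linter.all false
open MeasureTheory Filter Set
open scoped ENNReal
noncomputable section

lemma pvK_congr {f : ℝ × ℝ → ℝ} {F : ℝ × ℝ → ℝ → ℝ} {p : ℝ × ℝ} {k : ℕ} {L : ℝ}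
    (h : ∀ᵐ u : ℝ, F p u = Gf f (p.1 + u, p.2))
    (hI : pvT1 (fun u => (1 / (2 * Real.pi)) *
              (Real.cos (((k + 1 : ℕ) : ℝ) * u) / (2 * Real.tan (u / 2))) * F p u) L) :
    pvT1 (pvK (fun x => Gf f (x, p.2)) p.1 k) L := by
  have e : ∀ s : Set ℝ, ∫ t in s, pvK (fun x => Gf f (x, p.2)) p.1 k t =
      ∫ u in s, (1 / (2 * Real.pi)) *
              (Real.cos (((k + 1 : ℕ) : ℝ) * u) / (2 * Real.tan (u / 2))) * F p u := by
    intro s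
    refine integral_congr_ae (ae_restrict_of_ae ?_)
    filter_upwards [h] with u hu
    simp only [pvK, hu]
  unfold pvT1 at hI ⊢
  simp only [e]
  exact hI

lemma I1_aemeas {f : ℝ × ℝ → ℝ} (hf : Measurable f) {k : ℕ} {I : ℝ × ℝ → ℝ}
    (h : ∀ᵐ p : ℝ × ℝ, pvT1 (pvK (fun x => Gf f (x, p.2)) p.1 k) (I p)) : AEMeasurable I := by
  have hG := Gf_meas hf
  refine aemeasurable_of_tendsto_metrizable_ae atTop (f := fun j p => ∫ t in Se (ej j), pvK (fun x => Gf f (x, p.2)) p.1 k t) (fun j => ?_) ?_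
  · have hm : Measurable fun w : (ℝ × ℝ) × ℝ => pvK (fun x => Gf f (x, w.1.2)) w.1.1 k w.2 := by
      simp only [pvK_eq]
      have h1 : Measurable fun w : (ℝ × ℝ) × ℝ => Real.cos (((k + 1 : ℕ) : ℝ) * w.2) := (cosm k).comp measurable_snd
      have h2 : Measurable fun w : (ℝ × ℝ) × ℝ => ct w.2 := ct_meas.comp measurable_snd
      have h3 : Measurable fun w : (ℝ × ℝ) × ℝ => Gf f (w.1.1 + w.2, w.1.2) := hG.comp (by fun_prop)
      exact ((h1.mul h2).mul h3).const_mul _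
    exact (hm.stronglyMeasurable.integral_prod_right' (ν := volume.restrict (Se (ej j)))).measurable.aemeasurable
  · filter_upwards [h] with p hp
    exact hp.comp ej_tendsto

lemma Lf_int {f : ℝ × ℝ → ℝ} (hf : Measurable f) (h : IntegrableOn (fun p => |f p| * logPlus |f p|) T2) :
    ∫⁻ y in J1, ∫⁻ x in J1, ENNReal.ofReal (Lf f (x, y)) =
      ENNReal.ofReal (∫ p in T2, |f p| * logPlus |f p|) := by
  rw [ofReal_integral_eq_lintegral_ofReal h (ae_of_all _ fun p => Lf_nonneg f p), T2_restrict]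
  exact (lintegral_prod_symm _ ((Lf_meas hf).ennreal_ofReal.aemeasurable)).symm

lemma Gf_bd {f : ℝ × ℝ → ℝ} (hf : Measurable f) (hp : Biperiodic f)
    (h : IntegrableOn (fun p => |f p| * logPlus |f p|) T2) {F : ℝ × ℝ → ℝ → ℝ}
    (hF : ∀ᵐ w : (ℝ × ℝ) × ℝ, Tendsto (fun j => Hf f (ej j) (w.1.1 + w.2, w.1.2)) atTop (nhds (F w.1 w.2))) :
    ∫⁻ y in J1, ∫⁻ x in J1, ‖Gf f (x, y)‖ₑ ≤
      ENNReal.ofReal (42000 * (1 + ∫ p in T2, |f p| * logPlus |f p|)) := by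
  have h0 : 0 ≤ ∫ p in T2, |f p| * logPlus |f p| := integral_nonneg fun p => Lf_nonneg f p
  refine (Gf_L1 hf hp hF).trans ?_
  rw [Lf_int hf h, ← ENNReal.ofReal_add (by positivity) h0,
    show (6000 : ℝ≥0∞) = ENNReal.ofReal 6000 by simp, ← ENNReal.ofReal_mul (by norm_num)]
  refine ENNReal.ofReal_le_ofReal ?_
  linarith [Real.pi_lt_d2]

lemma Gf_PerInt {f : ℝ × ℝ → ℝ} (hf : Measurable f) (hp : Biperiodic f) {y : ℝ}
    (h : ∫⁻ x in J1, ‖Gf f (x, y)‖ₑ < ⊤) : PerInt (fun x => Gf f (x, y)) := by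
  have hm : Measurable fun x => Gf f (x, y) := (Gf_meas hf).comp (by fun_prop)
  exact ⟨hm, fun x => (Gf_per hp x y).1, hm.aestronglyMeasurable, h⟩

def badSet (ξ : ℕ → ℝ × ℝ → ℝ) (A : ℝ) : Set (ℝ × ℝ) :=
  {p | (∃ N : ℕ, 1 ≤ N ∧ N * A < |∑ k ∈ Finset.range N, ξ k p|) ∨
    (∃ k0 m : ℕ, 1 ≤ m ∧ m ^ 2 * A < ∑ i ∈ Finset.range m, ∑ j ∈ Finset.range m, |ξ (k0 + i) p - ξ (k0 + j) p|)}

lemma badSet_meas {ξ : ℕ → ℝ × ℝ → ℝ} (h : ∀ k, Measurable (ξ k)) (A : ℝ) : MeasurableSet (badSet ξ A) := by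
  have e : badSet ξ A = (⋃ N : ℕ, ⋃ _ : 1 ≤ N, {p | N * A < |∑ k ∈ Finset.range N, ξ k p|}) ∪
      (⋃ k0 : ℕ, ⋃ m : ℕ, ⋃ _ : 1 ≤ m, {p | m ^ 2 * A < ∑ i ∈ Finset.range m, ∑ j ∈ Finset.range m, |ξ (k0 + i) p - ξ (k0 + j) p|}) := by
    ext p; simp [badSet]
  rw [e]
  refine MeasurableSet.union ?_ ?_
  · refine MeasurableSet.iUnion fun N => MeasurableSet.iUnion fun _ => measurableSet_lt measurable_const ?_
    have : Measurable fun p => ∑ k ∈ Finset.range N, ξ k p := Finset.measurable_fun_sum _ fun k _ => h k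
    exact this.abs
  · refine MeasurableSet.iUnion fun k0 => MeasurableSet.iUnion fun m => MeasurableSet.iUnion fun _ => measurableSet_lt measurable_const ?_
    refine Finset.measurable_fun_sum _ fun i _ => Finset.measurable_fun_sum _ fun j _ => ?_
    have : Measurable fun p => ξ (k0 + i) p - ξ (k0 + j) p := (h _).sub (h _)
    exact this.abs

lemma main_aux {f : ℝ × ℝ → ℝ} (hf : Measurable f) (hp : Biperiodic f)
    (h : IntegrableOn (fun p => |f p| * logPlus |f p|) T2) {F : ℝ × ℝ → ℝ → ℝ} {I1 : ℕ → ℝ × ℝ → ℝ}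
    (hF : ∀ᵐ w : (ℝ × ℝ) × ℝ, Tendsto (fun j => Hf f (ej j) (w.1.1 + w.2, w.1.2)) atTop (nhds (F w.1 w.2)))
    (hI : ∀ k : ℕ, ∀ᵐ p : ℝ × ℝ, pvT1 (fun u => (1 / (2 * Real.pi)) *
              (Real.cos (((k + 1 : ℕ) : ℝ) * u) / (2 * Real.tan (u / 2))) * F p u) (I1 (k + 1) p))
    {mu : ℝ} (hmu : 0 < mu) :
    volume {p : ℝ × ℝ | p ∈ T2 ∧ 7 * (1100 * mu) < bmoSeq (fun k => I1 (k + 1) p)} ≤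
      ENNReal.ofReal (30000 / mu) * ENNReal.ofReal (42000 * (1 + ∫ p in T2, |f p| * logPlus |f p|)) := by
  have h1 : ∀ᵐ p : ℝ × ℝ, ∀ᵐ u : ℝ, F p u = Gf f (p.1 + u, p.2) := by
    have : ∀ᵐ w : (ℝ × ℝ) × ℝ, F w.1 w.2 = Gf f (w.1.1 + w.2, w.1.2) := by
      filter_upwards [hF] with w hw
      exact hw.limUnder_eq.symm
    exact Measure.ae_ae_of_ae_prod this
  have h2 : ∀ k, ∀ᵐ p : ℝ × ℝ, pvT1 (pvK (fun x => Gf f (x, p.2)) p.1 k) (I1 (k + 1) p) := by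
    intro k
    filter_upwards [h1, hI k] with p hp1 hp2
    exact pvK_congr hp1 hp2
  have hae : ∀ k, AEMeasurable (I1 (k + 1)) := fun k => I1_aemeas hf (h2 k)
  set ξ : ℕ → ℝ × ℝ → ℝ := fun k => (hae k).mk _ with hξ
  have hξm : ∀ k, Measurable (ξ k) := fun k => (hae k).measurable_mk
  have heq : ∀ᵐ p, ∀ k, I1 (k + 1) p = ξ k p := ae_all_iff.2 fun k => (hae k).ae_eq_mk
  have h3 : ∀ᵐ p : ℝ × ℝ, ∀ k, pvT1 (pvK (fun x => Gf f (x, p.2)) p.1 k) (ξ k p) := by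
    filter_upwards [heq, ae_all_iff.2 h2] with p a b k
    rw [← a k]; exact b k
  have hbd := Gf_bd hf hp h hF
  have hA : 0 ≤ 1100 * mu := by positivity
  have hT2 : MeasurableSet T2 := measurableSet_Ico.prod measurableSet_Ico
  have hB := badSet_meas hξm (1100 * mu)
  have hsub : volume {p : ℝ × ℝ | p ∈ T2 ∧ 7 * (1100 * mu) < bmoSeq (fun k => I1 (k + 1) p)} ≤
      volume (badSet ξ (1100 * mu) ∩ T2) := by
    refine measure_mono_ae ?_
    filter_upwards [heq] with p hpe
    rintro ⟨hpT, hlt⟩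
    refine ⟨?_, hpT⟩
    by_contra hnb
    have e : (fun k => I1 (k + 1) p) = fun k => ξ k p := funext hpe
    rw [e] at hlt
    simp only [badSet, mem_setOf_eq, not_or, not_exists, not_and, not_lt] at hnb
    exact absurd (bmo_det hA hnb.1 hnb.2) (not_le.2 hlt)
  refine hsub.trans ?_
  have hvol : volume (badSet ξ (1100 * mu) ∩ T2) =
      ∫⁻ y in J1, (volume.restrict J1) ((fun x => (x, y)) ⁻¹' badSet ξ (1100 * mu)) := by
    rw [← Measure.restrict_apply hB, T2_restrict, Measure.prod_apply_symm hB]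
  rw [hvol]
  have hGm : Measurable fun q : ℝ × ℝ => ‖Gf f q‖ₑ := (Gf_meas hf).enorm
  have hgm : Measurable fun y => ∫⁻ x in J1, ‖Gf f (x, y)‖ₑ := Measurable.lintegral_prod_left' hGm
  have hfin : ∀ᵐ y ∂(volume.restrict J1), ∫⁻ x in J1, ‖Gf f (x, y)‖ₑ < ⊤ :=
    ae_lt_top hgm (ne_of_lt (lt_of_le_of_lt hbd ENNReal.ofReal_lt_top))
  calc _ ≤ ∫⁻ y in J1, ENNReal.ofReal (30000 / mu) * ∫⁻ x in J1, ‖Gf f (x, y)‖ₑ := by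
        refine lintegral_mono_ae ?_
        filter_upwards [hfin, ae_restrict_of_ae (ae_swap h3)] with y hy hy3
        obtain ⟨B, hBv, hBg⟩ := weak1 (Gf_PerInt hf hp hy) hmu
        refine le_trans ?_ hBv
        rw [Measure.restrict_apply (hB.preimage (by fun_prop))]
        refine measure_mono_ae ?_
        filter_upwards [hy3] with x hx
        rintro ⟨hxb, hxJ⟩
        by_contra hxB
        have hxa : |x| ≤ Real.pi := abs_le.2 ⟨hxJ.1.le, hxJ.2.le⟩
        have := hBg x hxa hxB (fun k => ξ k (x, y)) hx
        rcases hxb with ⟨N, hN, hl⟩ | ⟨k0, m, hm, hl⟩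
        · exact absurd (this.1 N hN) (not_le.2 hl)
        · exact absurd (this.2 k0 m hm) (not_le.2 hl)
    _ = ENNReal.ofReal (30000 / mu) * ∫⁻ y in J1, ∫⁻ x in J1, ‖Gf f (x, y)‖ₑ := lintegral_const_mul _ hgm
    _ ≤ _ := mul_le_mul' le_rfl hbd

/-- for `f ∈ L log L(𝕋²)` and the iterated principal values
`I^{(1)}_n(x,y,f) = p.v. (1/2π) ∫_𝕋 [cos(nu)/(2 tan(u/2))] ·
  (p.v. (1/π) ∫_𝕋 f(x+u+v, y+v)/(2 tan(v/2)) dv) du` (`n ≥ 1`, a.e. `(x,y)`),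
one has the weak type estimate
`|{(x,y) ∈ 𝕋² : bmo[I^{(1)}_n(x,y,f)] > λ}| ≤ (c/λ)(1 + ∬ |f| log⁺|f|)`
for an absolute constant `c > 0`. -/
theorem bmo_weak_type_I1 :
    ∃ c : ℝ, 0 < c ∧ ∀ f : ℝ × ℝ → ℝ, Measurable f → Biperiodic f →
      IntegrableOn f T2 → IntegrableOn (fun p => |f p| * logPlus |f p|) T2 →
      ∀ F : ℝ × ℝ → ℝ → ℝ, ∀ I1 : ℕ → ℝ × ℝ → ℝ,
        (∀ᵐ w : (ℝ × ℝ) × ℝ,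
          pvT1 (fun v => (1 / Real.pi) * (f (w.1.1 + w.2 + v, w.1.2 + v) /
              (2 * Real.tan (v / 2)))) (F w.1 w.2)) →
        (∀ n : ℕ, 1 ≤ n → ∀ᵐ p : ℝ × ℝ,
          pvT1 (fun u => (1 / (2 * Real.pi)) *
              (Real.cos ((n : ℝ) * u) / (2 * Real.tan (u / 2))) * F p u) (I1 n p)) →
        ∀ lam : ℝ, 0 < lam →
          volume {p : ℝ × ℝ | p ∈ T2 ∧ lam < bmoSeq (fun k => I1 (k + 1) p)} ≤
            ENNReal.ofReal ((c / lam) * (1 + ∫ p in T2, |f p| * logPlus |f p|)) := by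
  refine ⟨30000 * 7700 * 42000, by norm_num, ?_⟩
  intro f hf hp _ h F I1 hF hI lam hlam
  have hF' : ∀ᵐ w : (ℝ × ℝ) × ℝ, Tendsto (fun j => Hf f (ej j) (w.1.1 + w.2, w.1.2)) atTop (nhds (F w.1 w.2)) := by
    filter_upwards [hF] with w hw
    exact hw.comp ej_tendsto
  have key := main_aux hf hp h hF' (fun k => hI (k + 1) (by omega)) (mu := lam / 7700) (by positivity)
  rw [show 7 * (1100 * (lam / 7700)) = lam by ring, ← ENNReal.ofReal_mul (by positivity)] at key
  refine key.trans (le_of_eq ?_)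
  congr 1
  field_simp
end
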